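/- Let X = R(w_0), the set of reduced words for the longest element w_0 of the type B_n Coxeter group, with C = ℤ/n²ℤ acting on X by cyclic rotation of words. Then (X, C, X(q)) exhibits the cyclic sieving phenomenon, where X(q) = [n²]_q! / ([n]_q^n Π_{i=1}^{n−1} ([i]_q · [2n−i]_q)^i). -/

import Mathlib

/-! ### `q`-analogues, as polynomials with integer coefficients -/

open Polynomial in
/-- The `q`-integer `[m]_q = 1 + q + ⋯ + q^(m-1)`, as a polynomial in `ℤ[q]`. -/
noncomputable def qInt (m : ℕ) : Polynomial ℤ := ∑ k ∈ Finset.range m, Polynomial.X ^ k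

/-- The `q`-factorial `[N]_q! = [N]_q [N-1]_q ⋯ [1]_q`. -/
noncomputable def qFact (N : ℕ) : Polynomial ℤ := ∏ m ∈ Finset.range N, qInt (m + 1)

open Polynomial in
/-- The `q`-analogue of the hook length formula for the `n × n` square Young diagram,
`[n²]_q! / ([n]_q^n · ∏_(i=1)^(n-1) ([i]_q [2n-i]_q)^i)`.
(The division is exact; it is expressed by `Polynomial.divByMonic`, the divisor being
a monic polynomial.) -/
noncomputable def qHookSquare (n : ℕ) : Polynomial ℤ :=
  qFact (n ^ 2) /ₘ ((qInt n) ^ n * ∏ i ∈ Finset.Icc 1 (n - 1), (qInt i * qInt (2 * n - i)) ^ i)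

namespace BnCSP

/-! ### Part A : the abstract trace lemma -/

lemma sum_range_shift (n : ℕ) (F : ℕ → ℚ) (hF : ∀ t, F (t + n) = F t) (s : ℕ) :
    ∑ t ∈ Finset.range n, F (t + s) = ∑ t ∈ Finset.range n, F t := by
  induction s with
  | zero => simp
  | succ s ih =>
    rw [← ih]
    have h1 := Finset.sum_range_succ (fun t => F (t + s)) n
    have h2 := Finset.sum_range_succ' (fun t => F (t + s)) n
    rw [h1] at h2
    have h3 : F (n + s) = F (0 + s) := by rw [zero_add, add_comm]; exact hF s
    have h4 : ∀ t, F (t + 1 + s) = F (t + (s + 1)) := fun t => by congr 1; ring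
    simp only [h4] at h2
    linarith

/-- decrease the head by two -/
def dec2 : List ℤ → List ℤ
  | [] => []
  | a :: u => (a - 2) :: u

structure TraceData (k : ℕ) (T g : List ℤ → ℚ) : Prop where
  negT : ∀ w : List ℤ, w.length = k → ∀ x ∈ w, x < 0 → T w = 0
  negg : ∀ w : List ℤ, w.length = k → ∀ x ∈ w, x < 0 → g w = 0
  rot : ∀ w : List ℤ, w.length = k → T (w.rotate 1) = T w
  r1 : ∀ (i j : ℤ) (u : List ℤ), (i :: j :: u).length = k →
    T (j :: i :: u) - T (i :: j :: u) = g ((i - 2) :: (j - 1) :: u) - g ((i - 1) :: (j - 2) :: u)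
  symm : ∀ (i j : ℤ) (u : List ℤ), (i :: j :: u).length = k → g (i :: j :: u) = g (j :: i :: u)
  r2 : ∀ w : List ℤ, w.length = k → ∑ s ∈ Finset.range k, g (dec2 (w.rotate s)) = 0

lemma TraceData.rotn {k : ℕ} {T g : List ℤ → ℚ} (h : TraceData k T g) (w : List ℤ) (hw : w.length = k) (s : ℕ) :
    T (w.rotate s) = T w := by
  induction s with
  | zero => simp
  | succ s ih => rw [← List.rotate_rotate, h.rot _ (by simpa using hw), ih]

lemma TraceData.append {k : ℕ} {T g : List ℤ → ℚ} (h : TraceData k T g) (p q : List ℤ) (hw : (p ++ q).length = k) :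
    T (p ++ q) = T (q ++ p) := by
  rw [← h.rotn (p ++ q) hw p.length, List.rotate_append_length_eq]

/-- descent: if `g(y,x,u) = g(y+1,x-1,u)` for the relevant range then all vanish -/
lemma descend (f : ℤ → ℤ → ℚ) (h0 : ∀ x y, x < 0 → f x y = 0)
    (h : ∀ x y, f x y = f (x - 1) (y + 1)) (x y : ℤ) : f x y = 0 := by
  have key : ∀ N : ℕ, ∀ x y : ℤ, x < N → f x y = 0 := by
    intro N
    induction N with
    | zero => intro x y hx; exact h0 x y (by simpa using hx)
    | succ N ih => intro x y hx; rw [h]; exact ih _ _ (by push_cast at hx; omega)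
  exact key (x.toNat + 1) x y (by push_cast; omega)

lemma descend' (M : ℤ) (f : ℤ → ℤ → ℚ) (h0 : ∀ x y, x < 0 → f x y = 0)
    (h : ∀ x y, x ≤ M → f x y = f (x - 1) (y + 1)) (x y : ℤ) (hx : x ≤ M) : f x y = 0 := by
  have key : ∀ N : ℕ, ∀ x y : ℤ, x ≤ M → x < N → f x y = 0 := by
    intro N
    induction N with
    | zero => intro x y _ hx; exact h0 x y (by simpa using hx)
    | succ N ih => intro x y hM hx; rw [h _ _ hM]; exact ih _ _ (by omega) (by push_cast at hx; omega)
  exact key (x.toNat + 1) x y hx (by push_cast; omega)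

/-- swap equality for words containing `m` -/
def SwapOK (k : ℕ) (T : List ℤ → ℚ) (m : ℤ) : Prop :=
  ∀ (i j : ℤ) (u : List ℤ), (i :: j :: u).length = k → m ∈ i :: j :: u → T (i :: j :: u) = T (j :: i :: u)


lemma stepA {k : ℕ} {T g : List ℤ → ℚ} (h : TraceData k T g) {m : ℤ}
    (hm : ∀ m' < m, SwapOK k T m') (m' : ℤ) (hm' : m' < m) (x y : ℤ) (u : List ℤ) (hl : (x :: y :: u).length = k)
    (hu : m' ∈ u) : g (x :: y :: u) = 0 := by
  simp only [List.length_cons] at hl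
  refine descend (fun x y => g (x :: y :: u)) ?_ ?_ x y
  · intro x y hx
    exact h.negg _ (by simpa using hl) x (by simp) hx
  · intro x y
    have h1 := h.r1 (x + 1) (y + 2) u (by simpa using hl)
    have h2 := hm m' hm' (x + 1) (y + 2) u (by simpa using hl) (by simp [hu])
    have e1 : x + 1 - 2 = x - 1 := by ring
    have e2 : y + 2 - 1 = y + 1 := by ring
    have e3 : x + 1 - 1 = x := by ring
    have e4 : y + 2 - 2 = y := by ring
    rw [e1, e2, e3, e4, h2] at h1
    linarith

lemma stepB {k : ℕ} {T g : List ℤ → ℚ} (h : TraceData k T g) {m : ℤ}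
    (hm : ∀ m' < m, SwapOK k T m') (x y : ℤ) (u : List ℤ) (hl : (x :: y :: u).length = k)
    (hx : x ≤ m - 2) : g (x :: y :: u) = 0 := by
  simp only [List.length_cons] at hl
  refine descend' (m - 2) (fun x y => g (x :: y :: u)) ?_ ?_ x y hx
  · intro x y hx
    exact h.negg _ (by simpa using hl) x (by simp) hx
  · intro x y hx
    have h1 := h.r1 (x + 1) (y + 2) u (by simpa using hl)
    have h2 := hm (x + 1) (by omega) (x + 1) (y + 2) u (by simpa using hl) (by simp)
    have e1 : x + 1 - 2 = x - 1 := by ring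
    have e2 : y + 2 - 1 = y + 1 := by ring
    have e3 : x + 1 - 1 = x := by ring
    have e4 : y + 2 - 2 = y := by ring
    rw [e1, e2, e3, e4, h2] at h1
    linarith

lemma stepC {k : ℕ} {T g : List ℤ → ℚ} (h : TraceData k T g) {m : ℤ}
    (hm : ∀ m' < m, SwapOK k T m') (y : ℤ) (u : List ℤ) (hl : (y :: (m - 1) :: u).length = k) :
    g (y :: (m - 1) :: u) = 0 := by
  simp only [List.length_cons] at hl
  have h1 := h.r2 ((y + 2) :: (m - 1) :: u) (by simpa using hl)
  rw [Finset.sum_eq_single 0] at h1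
  · simpa [dec2] using h1
  · intro s hs hs0
    rw [Finset.mem_range] at hs
    obtain ⟨s, rfl⟩ : ∃ s', s = s' + 1 := ⟨s - 1, by omega⟩
    rw [List.rotate_eq_drop_append_take (by simp; omega)]
    simp only [List.drop_succ_cons, List.take_succ_cons]
    rcases s with _ | s
    · cases hu : u ++ [y + 2] with
      | nil => simp at hu
      | cons z v =>
        have hl2 := congrArg List.length hu
        simp at hl2
        simp only [List.drop_zero, List.take_zero, List.cons_append, hu, dec2]
        exact stepB h hm _ _ _ (by simp; omega) (by omega)
    · simp only [List.drop_succ_cons, List.take_succ_cons]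
      have hs' : s < u.length := by omega
      rw [List.drop_eq_getElem_cons hs']
      cases hd : u.drop (s + 1) with
      | nil =>
        simp only [List.cons_append, List.nil_append, dec2]
        have := congrArg List.length hd
        simp at this
        exact stepA h hm (m - 1) (by omega) _ _ _ (by simp; omega) (by simp)
      | cons z v =>
        have := congrArg List.length hd
        simp at this
        simp only [List.cons_append, dec2]
        exact stepA h hm (m - 1) (by omega) _ _ _ (by simp; omega) (by simp)
  · intro h0
    simp at h0; omega

lemma stepD {k : ℕ} {T g : List ℤ → ℚ} (h : TraceData k T g) {m : ℤ}
    (hm : ∀ m' < m, SwapOK k T m') (j : ℤ) (u : List ℤ) (hl : (j :: m :: u).length = k) :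
    T (j :: m :: u) = T (m :: j :: u) := by
  have h1 := h.r1 m j u (by simpa using hl)
  rw [stepB h hm (m - 2) (j - 1) u (by simpa using hl) le_rfl,
    h.symm _ _ _ (by simpa using hl), stepC h hm (j - 2) u (by simpa using hl)] at h1
  linarith

lemma stepD_mid {k : ℕ} {T g : List ℤ → ℚ} (h : TraceData k T g) {m : ℤ}
    (hm : ∀ m' < m, SwapOK k T m') (p q : List ℤ) (j : ℤ) (hl : (p ++ j :: m :: q).length = k) :
    T (p ++ j :: m :: q) = T (p ++ m :: j :: q) := by
  rw [h.append p (j :: m :: q) hl, h.append p (m :: j :: q) (by simpa using hl)]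
  exact stepD h hm _ _ (by simp at hl ⊢; omega)

lemma stepD_move {k : ℕ} {T g : List ℤ → ℚ} (h : TraceData k T g) {m : ℤ}
    (hm : ∀ m' < m, SwapOK k T m') (p q r : List ℤ) (hl : (p ++ q ++ m :: r).length = k) :
    T (p ++ m :: q ++ r) = T (p ++ q ++ m :: r) := by
  induction q generalizing p with
  | nil => simp
  | cons a q ih =>
    have := ih (p ++ [a]) (by simpa using hl)
    have h2 := stepD_mid h hm p (q ++ r) a (by simp at hl ⊢; omega)
    simp only [List.append_assoc, List.cons_append, List.nil_append] at this h2 ⊢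
    rw [← this, h2]

/-- position independence of `m` for `g` -/
lemma stepG {k : ℕ} {T g : List ℤ → ℚ} (h : TraceData k T g) {m : ℤ}
    (hm : ∀ m' < m, SwapOK k T m') (x y : ℤ) (p q : List ℤ) (hl : (x :: y :: (p ++ m :: q)).length = k) :
    g (x :: y :: (p ++ m :: q)) = g (x :: y :: (p ++ q ++ [m])) := by
  simp only [List.length_cons, List.length_append] at hl
  have := descend (fun x y => g (x :: y :: (p ++ m :: q)) - g (x :: y :: (p ++ q ++ [m]))) ?_ ?_ x y
  · linarith
  · intro x y hx
    rw [h.negg _ (by simp; omega) x (by simp) hx, h.negg _ (by simp; omega) x (by simp) hx]; simp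
  · intro x y
    have h1 := h.r1 (x + 1) (y + 2) (p ++ m :: q) (by simp; omega)
    have h2 := h.r1 (x + 1) (y + 2) (p ++ q ++ [m]) (by simp; omega)
    have h3 := stepD_move h hm ((x + 1) :: (y + 2) :: p) q [] (by simp; omega)
    have h4 := stepD_move h hm ((y + 2) :: (x + 1) :: p) q [] (by simp; omega)
    have e1 : x + 1 - 2 = x - 1 := by ring
    have e2 : y + 2 - 1 = y + 1 := by ring
    have e3 : x + 1 - 1 = x := by ring
    have e4 : y + 2 - 2 = y := by ring
    rw [e1, e2, e3, e4] at h1 h2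
    simp only [List.append_assoc, List.cons_append, List.append_nil] at h1 h2 h3 h4 ⊢
    linarith


lemma stepExtra {k : ℕ} {T g : List ℤ → ℚ} (h : TraceData k T g) {m : ℤ}
    (hm : ∀ m' < m, SwapOK k T m') (j : ℤ) (q : List ℤ) (hl : (j :: m :: q).length = k) :
    g ((j - 2) :: m :: q) = T ((m + 1) :: j :: q) - T ((m + 1) :: (q ++ [j])) := by
  have h1 := h.r1 (m + 1) j q (by simpa using hl)
  have e1 : m + 1 - 2 = m - 1 := by ring
  have e2 : m + 1 - 1 = m := by ring
  rw [e1, e2, h.symm _ _ _ (by simpa using hl), stepC h hm _ _ (by simpa using hl),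
    h.symm m _ _ (by simpa using hl)] at h1
  have h2 := h.append [j] ((m + 1) :: q) (by simpa using hl)
  simp only [List.cons_append, List.nil_append] at h2
  linarith

lemma stepNext {k : ℕ} {T g : List ℤ → ℚ} (h : TraceData (k + 3) T g) {m : ℤ}
    (hm : ∀ m' < m, SwapOK (k + 3) T m') :
    TraceData (k + 2) (fun v => T (v ++ [m])) (fun v => g (v ++ [m])) where
  negT w hw x hx hx0 := h.negT _ (by simp [hw]) x (by simp [hx]) hx0
  negg w hw x hx hx0 := h.negg _ (by simp [hw]) x (by simp [hx]) hx0
  rot w hw := by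
    cases w with
    | nil => simp
    | cons a v =>
      simp at hw
      simp only [List.rotate_cons_succ, List.rotate_zero]
      have h1 := stepD_mid h hm v [] a (by simp; omega)
      have h2 := h.append [a] (v ++ [m]) (by simp; omega)
      have h3 := h.append (v ++ [m]) [a] (by simp; omega)
      simp only [List.cons_append, List.nil_append, List.append_assoc] at h1 h2 h3 ⊢
      rw [h1, h2]
  r1 i j u hl := by
    have := h.r1 i j (u ++ [m]) (by simp at hl ⊢; omega)
    simpa using this
  symm i j u hl := by
    have := h.symm i j (u ++ [m]) (by simp at hl ⊢; omega)
    simpa using this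
  r2 v hv := by
    set F : ℕ → ℚ := fun t => g (dec2 (v.rotate t) ++ [m]) with hF
    set E : ℕ → ℚ := fun t => T ((m + 1) :: v.rotate t) with hE
    have perF : ∀ t, F (t + (k + 2)) = F t := by
      intro t; simp only [hF]; rw [add_comm t, ← List.rotate_rotate, ← hv, List.rotate_length]
    have perE : ∀ t, E (t + (k + 2)) = E t := by
      intro t; simp only [hE]; rw [add_comm t, ← List.rotate_rotate, ← hv, List.rotate_length]
    change ∑ t ∈ Finset.range (k + 2), F t = 0
    have key : ∀ t, ∑ s ∈ Finset.range (k + 1), F (t + s) + (E (t + (k + 1)) - E t) = 0 := by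
      intro t
      set r := v.rotate t with hr
      have hrl : r.length = k + 2 := by simp [hr, hv]
      have h1 := h.r2 (r ++ [m]) (by simp [hrl])
      rw [Finset.sum_range_succ, Finset.sum_range_succ] at h1
      have t1 : g (dec2 ((r ++ [m]).rotate (k + 2))) = 0 := by
        rw [← hrl, List.rotate_append_length_eq]
        match r, hrl with
        | y :: r', hrl =>
          simp only [List.cons_append, List.nil_append, dec2]
          exact stepB h hm _ _ _ (by simp only [List.length_cons] at hrl ⊢; omega) le_rfl
      have t2 : g (dec2 ((r ++ [m]).rotate (k + 1))) = E (t + (k + 1)) - E t := by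
        obtain ⟨q, j, hq⟩ : ∃ q j, r = q ++ [j] :=
          ⟨r.dropLast, r.getLast (by intro h0; rw [h0] at hrl; simp at hrl),
            (List.dropLast_append_getLast _).symm⟩
        have hql : q.length = k + 1 := by rw [hq] at hrl; simpa using hrl
        have e1 : (r ++ [m]).rotate (k + 1) = j :: m :: q := by
          rw [hq, ← hql, List.append_assoc, List.rotate_append_length_eq]; simp
        have e2 : v.rotate (t + (k + 1)) = j :: q := by
          rw [← List.rotate_rotate, ← hr, hq, ← hql, List.rotate_append_length_eq]; simp
        rw [e1]
        simp only [dec2, hE]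
        rw [e2, ← hr, hq]
        exact stepExtra h hm _ _ (by simp [hql])
      have t3 : ∀ s ∈ Finset.range (k + 1), g (dec2 ((r ++ [m]).rotate s)) = F (t + s) := by
        intro s hs
        rw [Finset.mem_range] at hs
        simp only [hF]
        rw [← List.rotate_rotate, ← hr, List.rotate_eq_drop_append_take (by simp; omega),
          List.rotate_eq_drop_append_take (by omega), List.drop_append_of_le_length (by omega),
          List.take_append_of_le_length (by omega)]
        have hdl : (r.drop s).length = k + 2 - s := by simp [hrl]
        match hd : r.drop s with
        | [] => rw [hd] at hdl; simp at hdl; omega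
        | [a] => rw [hd] at hdl; simp at hdl; omega
        | a :: b :: z =>
          have := stepG h hm (a - 2) b z (r.take s) (by
            rw [hd] at hdl; simp at hdl ⊢; omega)
          simpa [dec2] using this
      rw [t1, t2, Finset.sum_congr rfl t3] at h1
      linarith
    have h2 := Finset.sum_eq_zero (s := Finset.range (k + 2)) (fun t _ => key t)
    rw [Finset.sum_add_distrib, Finset.sum_sub_distrib, sum_range_shift _ _ perE, sub_self,
      add_zero, Finset.sum_comm] at h2
    have h3 : ∀ s ∈ Finset.range (k + 1), ∑ t ∈ Finset.range (k + 2), F (t + s)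
        = ∑ t ∈ Finset.range (k + 2), F t := fun s _ => sum_range_shift _ _ perF s
    rw [Finset.sum_congr rfl h3, Finset.sum_const, Finset.card_range, nsmul_eq_mul] at h2
    have h4 : ((k + 1 : ℕ) : ℚ) ≠ 0 := by positivity
    exact (mul_eq_zero.mp h2).resolve_left h4

theorem trace_swap (k : ℕ) (T g : List ℤ → ℚ) (h : TraceData k T g) (i j : ℤ) (u : List ℤ)
    (hl : (i :: j :: u).length = k) : T (i :: j :: u) = T (j :: i :: u) := by
  induction k generalizing T g i j u with
  | zero => simp at hl
  | succ k ih =>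
    match k, ih, h, hl with
    | 0, _, _, hl => simp at hl
    | 1, _, h, hl =>
      have : u = [] := by simpa using hl
      subst this
      exact h.append [i] [j] (by simp)
    | k + 2, ih, h, hl =>
      have main : ∀ N : ℕ, ∀ m : ℤ, m < N → SwapOK (k + 3) T m := by
        intro N
        induction N with
        | zero =>
          intro m hm i j u hl hmem
          rw [h.negT _ hl m hmem (by simpa using hm),
            h.negT _ (by simpa using hl) m (by simp at hmem ⊢; tauto) (by simpa using hm)]
        | succ N ihN =>
          intro m hmN i j u hl hmem
          have hm : ∀ m' < m, SwapOK (k + 3) T m' := fun m' hm' => ihN m' (by push_cast at hmN; omega)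
          simp only [List.mem_cons] at hmem
          rcases hmem with rfl | rfl | hu
          · exact (stepD h hm _ _ (by simpa using hl)).symm
          · exact (stepD h hm _ _ (by simpa using hl))
          · obtain ⟨u1, u2, rfl⟩ := List.append_of_mem hu
            have h1 := stepD_move h hm (i :: j :: u1) u2 [] (by simp at hl ⊢; omega)
            have h2 := stepD_move h hm (j :: i :: u1) u2 [] (by simp at hl ⊢; omega)
            have h3 := ih _ _ (stepNext h hm) i j (u1 ++ u2) (by simp at hl ⊢; omega)
            simp only [List.append_assoc, List.cons_append, List.append_nil] at h1 h2 h3 ⊢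
            rw [h1, h2, h3]
      exact main (i.toNat + 1) i (by push_cast; omega) i j u hl (by simp)

theorem trace_perm (k : ℕ) (T g : List ℤ → ℚ) (h : TraceData k T g) (w w' : List ℤ)
    (hl : w.length = k) (hp : w.Perm w') : T w = T w' := by
  suffices H : ∀ w w' : List ℤ, w.Perm w' → ∀ p, (p ++ w).length = k → T (p ++ w) = T (p ++ w') from
    H w w' hp [] (by simpa using hl)
  intro w w' hp
  induction hp with
  | nil => intros; rfl
  | cons x _ ih =>
    intro p hp
    have := ih (p ++ [x]) (by simpa using hp)
    simpa using this
  | swap x y l =>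
    intro p hp
    rw [h.append p _ hp, h.append p (x :: y :: l) (by simpa using hp)]
    exact trace_swap k T g h _ _ _ (by simp at hp ⊢; omega)
  | trans h1 _ ih1 ih2 =>
    intro p hp
    rw [ih1 p hp, ih2 p (by simp [← h1.length_eq]; simpa using hp)]

end BnCSP

namespace BnCSP

/-! ### Part B : Jacobi-Trudi determinants -/

lemma sum_updateRow_eq_sum_updateCol {ι R : Type*} [Fintype ι] [DecidableEq ι] [CommRing R]
    (M N : Matrix ι ι R) :
    ∑ i, (M.updateRow i (N i)).det = ∑ j, (M.updateCol j (fun i => N i j)).det := by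
  have h1 : ∀ j, (M.updateCol j (fun i => N i j)).det = ∑ i, M.adjugate j i * N i j := by
    intro j
    rw [← Matrix.cramer_apply, Matrix.cramer_eq_adjugate_mulVec]
    rfl
  have h2 : ∀ i, (M.updateRow i (N i)).det = ∑ j, M.adjugate j i * N i j := by
    intro i
    rw [← Matrix.cramer_transpose_apply, Matrix.cramer_eq_adjugate_mulVec,
      ← Matrix.adjugate_transpose]
    rfl
  simp only [h1, h2]
  exact Finset.sum_comm

/-- complete homogeneous data -/
structure HData {R : Type*} [CommRing R] (k : ℕ) (e : ℕ → R) (h : ℤ → R) : Prop where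
  neg : ∀ m < 0, h m = 0
  zero : h 0 = 1
  recur : ∀ m, m ≠ 0 → h m = ∑ j : Fin (k + 1), ((-1) ^ (k - (j : ℕ)) * e (k + 1 - j)) *
    h (m - (k + 1) + (j : ℕ))

/-- the matrix -/
def sMat {R : Type*} [CommRing R] (k : ℕ) (h : ℤ → R) (α : Fin (k + 1) → ℤ) :
    Matrix (Fin (k + 1)) (Fin (k + 1)) R :=
  Matrix.of fun i j => h (α i - k + (j : ℕ))

/-- the determinant -/
noncomputable def sDet {R : Type*} [CommRing R] (k : ℕ) (h : ℤ → R) (α : Fin (k + 1) → ℤ) : R :=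
  (sMat k h α).det

/-- staircase -/
def delta (k : ℕ) : Fin (k + 1) → ℤ := fun i => k - (i : ℕ)

section
variable {R : Type*} [CommRing R] {k : ℕ} {e : ℕ → R} {h : ℤ → R}

lemma sDet_perm (α : Fin (k + 1) → ℤ) (σ : Equiv.Perm (Fin (k + 1))) :
    sDet k h (α ∘ σ) = (Equiv.Perm.sign σ : ℤ) * sDet k h α := by
  have := Matrix.det_permute σ (sMat k h α)
  exact this

lemma sDet_eq (α : Fin (k + 1) → ℤ) (i j : Fin (k + 1)) (hij : i ≠ j) (hα : α i = α j) :
    sDet k h α = 0 :=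
  Matrix.det_zero_of_row_eq hij (by ext l; simp [sMat, hα])

lemma sDet_delta (H : HData k e h) : sDet k h (delta k) = 1 := by
  rw [sDet, Matrix.det_of_isUpperTriangular]
  · refine Finset.prod_eq_one fun i _ => ?_
    simp [sMat, delta, H.zero]
  · intro i j hij
    simp only [sMat, delta, Matrix.of_apply]
    apply H.neg
    simp only [id] at hij
    have : (j : ℕ) < (i : ℕ) := hij
    omega

lemma lastcol (H : HData k e h) (α : Fin (k + 1) → ℤ) (hα : ∀ i, 0 ≤ α i) (i : Fin (k + 1)) :
    h (α i + 1) = ∑ j : Fin (k + 1), ((-1) ^ (k - (j : ℕ)) * e (k + 1 - j)) • sMat k h α i j := by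
  rw [H.recur _ (by have := hα i; omega)]
  refine Finset.sum_congr rfl fun j _ => ?_
  simp only [sMat, Matrix.of_apply, smul_eq_mul]
  congr 2
  ring

lemma e1_sDet (H : HData k e h) (α : Fin (k + 1) → ℤ) (hα : ∀ i, 0 ≤ α i) :
    e 1 * sDet k h α = ∑ i, sDet k h (α + Pi.single i 1) := by
  have h1 := sum_updateRow_eq_sum_updateCol (sMat k h α) (sMat k h (fun i => α i + 1))
  have h2 : ∀ i, (Matrix.updateRow (sMat k h α) i (sMat k h (fun i => α i + 1) i)).det
      = sDet k h (α + Pi.single i 1) := by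
    intro i
    rw [sDet]
    congr 1
    ext a b
    rw [Matrix.updateRow_apply]
    split_ifs with hab
    · subst hab; simp [sMat]
    · simp [sMat, hab]
  rw [Finset.sum_congr rfl (fun i _ => h2 i)] at h1
  rw [h1, Finset.sum_eq_single (Fin.last k)]
  · have h3 : (fun i => sMat k h (fun i => α i + 1) i (Fin.last k)) = fun i =>
        ∑ j : Fin (k + 1), ((-1) ^ (k - (j : ℕ)) * e (k + 1 - j)) • sMat k h α i j := by
      ext i
      rw [← lastcol H α hα i]
      simp only [sMat, Matrix.of_apply, Fin.val_last]
      congr 1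
      ring
    rw [h3, Matrix.det_updateCol_sum]
    simp [sDet]
  · intro j _ hj
    have hj' : (j : ℕ) < k := Fin.val_lt_last hj
    refine Matrix.det_zero_of_column_eq (i := j) (j := ⟨j + 1, by omega⟩) (by
      intro h0; have := congrArg Fin.val h0; simp at this) ?_
    intro i
    rw [Matrix.updateCol_self, Matrix.updateCol_ne (by
      intro h0; have := congrArg Fin.val h0; simp at this)]
    simp only [sMat, Matrix.of_apply]
    congr 1
    push_cast
    ring
  · simp

lemma en_sDet (H : HData k e h) (α : Fin (k + 1) → ℤ) (hα : ∀ i, 0 ≤ α i) :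
    sDet k h (fun i => α i + 1) = e (k + 1) * sDet k h α := by
  have h1 : sMat k h (fun i => α i + 1) =
      ((sMat k h α).updateCol 0 (fun i =>
        ∑ j : Fin (k + 1), ((-1) ^ (k - (j : ℕ)) * e (k + 1 - j)) • sMat k h α i j)).submatrix id
        (finRotate (k + 1)) := by
    ext i j
    rw [Matrix.submatrix_apply, id, Matrix.updateCol_apply]
    by_cases hj : j = Fin.last k
    · subst hj
      simp only [finRotate_last, if_true]
      rw [← lastcol H α hα i]
      simp only [sMat, Matrix.of_apply, Fin.val_last]
      congr 1
      ring
    · have hv := coe_finRotate_of_ne_last hj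
      rw [if_neg (by intro h0; rw [h0] at hv; simp at hv)]
      simp only [sMat, Matrix.of_apply, hv]
      congr 1
      push_cast
      ring
  rw [sDet, h1, Matrix.det_permute', Matrix.det_updateCol_sum, sign_finRotate, sDet]
  simp only [Nat.add_sub_cancel, Fin.val_zero, Nat.sub_zero, smul_eq_mul]
  push_cast
  have : ((-1 : R)) ^ k * (-1) ^ k = 1 := by rw [← mul_pow]; simp
  linear_combination (e (k + 1) * (sMat k h α).det) * this

lemma sDet_rect (H : HData k e h) (m : ℕ) :
    sDet k h (fun i => delta k i + m) = e (k + 1) ^ m := by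
  induction m with
  | zero => simpa using sDet_delta H
  | succ m ih =>
    have := en_sDet H (fun i => delta k i + m) (fun i => by simp only [delta]; omega)
    rw [ih] at this
    rw [pow_succ, mul_comm, ← this]
    congr 1
    ext i
    push_cast; ring

/-- multiplicities -/
def cnt {ι : Type*} [Fintype ι] {m : ℕ} (u : ι → Fin m) (i : Fin m) : ℕ :=
  (Finset.univ.filter fun t => u t = i).card

lemma cnt_cons {m p : ℕ} (a : Fin m) (u : Fin p → Fin m) (i : Fin m) :
    cnt (Fin.cons a u : Fin (p + 1) → Fin m) i = cnt u i + if a = i then 1 else 0 := by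
  simp only [cnt, Finset.card_filter]
  rw [Fin.sum_univ_succ]
  simp [add_comm]

lemma e1_pow (H : HData k e h) (p : ℕ) :
    e 1 ^ p = ∑ u : Fin p → Fin (k + 1), sDet k h (fun i => delta k i + cnt u i) := by
  induction p with
  | zero => simp [cnt, sDet_delta H]
  | succ p ih =>
    rw [pow_succ, mul_comm, ih, Finset.mul_sum]
    rw [← (Fin.consEquiv (fun _ => Fin (k + 1))).sum_comp, Fintype.sum_prod_type, Finset.sum_comm]
    refine Finset.sum_congr rfl fun u _ => ?_
    rw [e1_sDet H _ (fun i => by simp only [delta]; omega)]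
    refine Finset.sum_congr rfl fun a _ => ?_
    congr 1
    ext i
    simp only [Fin.consEquiv, Equiv.coe_fn_mk, cnt_cons, Pi.add_apply, Pi.single_apply]
    push_cast
    by_cases hia : i = a
    · subst hia; simp [add_assoc]
    · simp [hia, Ne.symm hia]
end

/-- the virtual character value at the identity -/
def chiOne (k p : ℕ) : ℤ := ∑ σ : Equiv.Perm (Fin (k + 1)), (Equiv.Perm.sign σ : ℤ) *
  ((Finset.univ.filter fun u : Fin p → Fin (k + 1) =>
    ∀ i, (cnt u i : ℤ) = (k + 1 : ℕ) + (i : ℕ) - (σ i : ℕ)).card : ℤ)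

lemma cnt_sum {m p : ℕ} (u : Fin p → Fin m) : ∑ i, cnt u i = p := by
  simp only [cnt]
  have := Finset.card_eq_sum_card_fiberwise (f := u) (s := Finset.univ) (t := Finset.univ) (by simp)
  simpa using this.symm

lemma top_subset (n : ℕ) (S : Finset ℕ) (hS : S ⊆ Finset.range (2 * n)) (hc : S.card = n)
    (hs : ∑ x ∈ S, x = ∑ x ∈ Finset.Ico n (2 * n), x) : S = Finset.Ico n (2 * n) := by
  set I := Finset.Ico n (2 * n) with hI
  have hIc : I.card = n := by simp [hI]; omega
  have h1 : (S \ I).card = (I \ S).card := by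
    rw [Finset.card_sdiff_comm]; omega
  have h2 : ∑ x ∈ S \ I, x = ∑ x ∈ I \ S, x := by
    have a := Finset.sum_inter_add_sum_sdiff S I (fun x => x)
    have b := Finset.sum_inter_add_sum_sdiff I S (fun x => x)
    rw [Finset.inter_comm] at b
    omega
  have h3 : ∑ x ∈ S \ I, (x + 1) ≤ (S \ I).card * n := by
    rw [← smul_eq_mul]
    refine Finset.sum_le_card_nsmul _ _ _ fun x hx => ?_
    rw [Finset.mem_sdiff] at hx
    have := Finset.mem_range.mp (hS hx.1)
    have := hx.2
    rw [hI, Finset.mem_Ico] at this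
    omega
  have h4 : (I \ S).card * n ≤ ∑ x ∈ I \ S, x := by
    rw [← smul_eq_mul]
    refine Finset.card_nsmul_le_sum _ _ _ fun x hx => ?_
    rw [Finset.mem_sdiff, hI, Finset.mem_Ico] at hx
    exact hx.1.1
  rw [Finset.sum_add_distrib] at h3
  simp only [Finset.sum_const, smul_eq_mul, mul_one] at h3
  have h5 : (S \ I).card = 0 := by rw [h1] at h3 ⊢; omega
  have h6 : S ⊆ I := by rwa [Finset.card_eq_zero, Finset.sdiff_eq_empty_iff_subset] at h5
  exact Finset.eq_of_subset_of_card_le h6 (by omega)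

lemma exists_perm_of_top (k : ℕ) (a : Fin (k + 1) → ℕ) (ha : Function.Injective a)
    (hlt : ∀ i, a i < 2 * (k + 1)) (hsum : ∑ i, a i = ∑ i : Fin (k + 1), (k + 1 + (i : ℕ))) :
    ∃ σ : Equiv.Perm (Fin (k + 1)), ∀ i, a i = k + 1 + (k - (σ i : ℕ)) := by
  have h1 := top_subset (k + 1) (Finset.univ.image a) (by
    intro x hx; simp only [Finset.mem_image, Finset.mem_univ, true_and] at hx
    obtain ⟨i, rfl⟩ := hx; simpa using hlt i) (by
    rw [Finset.card_image_of_injective _ ha]; simp) (by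
    rw [Finset.sum_image (fun x _ y _ h => ha h), hsum, Finset.sum_Ico_eq_sum_range,
      Finset.sum_range]
    have : 2 * (k + 1) - (k + 1) = k + 1 := by omega
    rw [this])
  have h2 : ∀ i, k + 1 ≤ a i := by
    intro i
    have : a i ∈ Finset.univ.image a := by simp
    rw [h1, Finset.mem_Ico] at this
    exact this.1
  let f : Fin (k + 1) → Fin (k + 1) := fun i => ⟨k - (a i - (k + 1)), by omega⟩
  have hf : Function.Injective f := by
    intro i j hij
    apply ha
    have := congrArg Fin.val hij
    simp only [f] at this
    have := h2 i; have := h2 j; have := hlt i; have := hlt j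
    omega
  refine ⟨Equiv.ofBijective f (Finite.injective_iff_bijective.mp hf), fun i => ?_⟩
  simp only [Equiv.ofBijective_apply, f]
  have := h2 i; have := hlt i
  omega

/-- If the functional kills `sDet α` as soon as some entry is `≥ 2(k+1)`, then it evaluates
`e₁^(n²)` to `chiOne` times its value on the rectangle. -/
lemma functional_e1_pow {R : Type*} [CommRing R] {k : ℕ} {e : ℕ → R} {h : ℤ → R} (H : HData k e h)
    (L : R →+ ℚ)
    (hL : ∀ α : Fin (k + 1) → ℤ, (∃ i, 2 * (k + 1 : ℤ) ≤ α i) → L (sDet k h α) = 0) :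
    L (e 1 ^ ((k + 1) ^ 2)) = chiOne k ((k + 1) ^ 2) * L (e (k + 1) ^ (k + 1)) := by
  set n := k + 1 with hn
  rw [e1_pow H, map_sum, chiOne]
  have key : ∀ u : Fin (n ^ 2) → Fin (k + 1), L (sDet k h (fun i => delta k i + cnt u i)) =
      ∑ σ : Equiv.Perm (Fin (k + 1)), if (∀ i, (cnt u i : ℤ) = (k + 1 : ℕ) + (i : ℕ) - (σ i : ℕ))
        then (Equiv.Perm.sign σ : ℤ) * L (e n ^ n) else 0 := by
    intro u
    by_cases hex : ∃ σ : Equiv.Perm (Fin (k + 1)),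
        ∀ i, (cnt u i : ℤ) = (k + 1 : ℕ) + (i : ℕ) - (σ i : ℕ)
    · obtain ⟨σ, hσ⟩ := hex
      rw [Finset.sum_eq_single σ, if_pos hσ]
      · have h1 : (fun i => delta k i + (cnt u i : ℤ)) = (fun i => delta k i + (n : ℕ)) ∘ σ := by
          ext i
          simp only [Function.comp, delta, hσ i, hn]
          push_cast
          ring
        rw [h1, sDet_perm, sDet_rect H]
        rcases Int.units_eq_one_or (Equiv.Perm.sign σ) with hs | hs <;> simp [hs, hn]
      · intro τ _ hτ
        rw [if_neg]
        intro h0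
        apply hτ
        ext i
        have := h0 i
        rw [hσ i] at this
        omega
      · simp
    · rw [Finset.sum_eq_zero (fun σ _ => if_neg (fun h0 => hex ⟨σ, h0⟩))]
      by_cases hbig : ∃ i, 2 * (k + 1 : ℤ) ≤ delta k i + cnt u i
      · exact hL _ hbig
      · push Not at hbig
        by_cases hinj : Function.Injective (fun i : Fin (k + 1) => k - (i : ℕ) + cnt u i)
        · exfalso
          obtain ⟨σ, hσ⟩ := exists_perm_of_top k _ hinj (fun i => by
            have := hbig i; simp only [delta] at this; omega) (by
            rw [Finset.sum_add_distrib, cnt_sum, Finset.sum_add_distrib]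
            have : ∑ i : Fin (k + 1), (k - (i : ℕ)) = ∑ i : Fin (k + 1), (i : ℕ) := by
              rw [← Equiv.sum_comp Fin.revPerm]
              refine Finset.sum_congr rfl fun i _ => ?_
              simp [Fin.revPerm]
              omega
            rw [this]
            simp [hn]
            ring)
          apply hex
          refine ⟨σ, fun i => ?_⟩
          have := hσ i
          omega
        · simp only [Function.Injective] at hinj
          push Not at hinj
          obtain ⟨i, j, hij, hne⟩ := hinj
          rw [sDet_eq _ i j hne, map_zero]
          simp only [delta]
          omega
  rw [Finset.sum_congr rfl (fun u _ => key u), Finset.sum_comm]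
  push_cast
  rw [Finset.sum_mul]
  refine Finset.sum_congr rfl fun σ _ => ?_
  rw [Finset.sum_ite, Finset.sum_const_zero, add_zero, Finset.sum_const, nsmul_eq_mul]
  push_cast
  ring

end BnCSP

namespace BnCSP

/-! ### Part C1 : nilCoxeter algebra of type B, abstractly -/

structure Nil {E : Type*} [Ring E] (U : ℕ → E) : Prop where
  sq : ∀ i, U i * U i = 0
  comm : ∀ i j, i + 2 ≤ j → U i * U j = U j * U i
  braid3 : ∀ i, U (i + 1) * U (i + 2) * U (i + 1) = U (i + 2) * U (i + 1) * U (i + 2)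
  braid4 : U 0 * U 1 * U 0 * U 1 = U 1 * U 0 * U 1 * U 0

section
variable {E : Type*} [Ring E] [Algebra ℚ E] {U : ℕ → E}

/-- `1 + x U_j` -/
def bb (U : ℕ → E) (j : ℕ) (x : ℚ) : E := 1 + x • U j

lemma bb_add (H : Nil U) (j : ℕ) (x y : ℚ) : bb U j x * bb U j y = bb U j (x + y) := by
  simp only [bb, add_mul, mul_add, one_mul, mul_one, smul_mul_assoc, mul_smul_comm, H.sq]
  module

lemma bb_zero (j : ℕ) : bb U j 0 = 1 := by simp [bb]

lemma bb_comm (H : Nil U) (i j : ℕ) (hij : i + 2 ≤ j) (x y : ℚ) :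
    Commute (bb U i x) (bb U j y) := by
  have : Commute (U i) (U j) := H.comm i j hij
  unfold bb
  exact ((Commute.one_right _).add_right ((Commute.one_left _).add_left
    ((this.smul_left x)) |>.smul_right y))

lemma yb_aux {a b : E} (ha : a * a = 0) (hb : b * b = 0) (hab : a * b * a = b * a * b) (x y : ℚ) :
    (1 + x • b) * (1 + x • a) * (1 + y • b) * (1 + (-x) • a) =
    (1 + y • b) * (1 + y • a) * (1 + x • b) * (1 + (-y) • a) := by
  have h1 : ∀ z, a * (a * z) = 0 := fun z => by rw [← mul_assoc, ha, zero_mul]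
  have h2 : ∀ z, b * (b * z) = 0 := fun z => by rw [← mul_assoc, hb, zero_mul]
  have h3 : b * (a * b) = a * (b * a) := by rw [← mul_assoc, ← mul_assoc, hab]
  have h4 : ∀ z, b * (a * (b * z)) = a * (b * (a * z)) := fun z => by
    rw [← mul_assoc, ← mul_assoc, ← hab]; simp only [mul_assoc]
  simp only [add_mul, mul_add, one_mul, mul_one, smul_mul_assoc, mul_smul_comm, smul_smul,
    mul_assoc, ha, hb, h1, h2, h3, h4, smul_zero, add_zero, mul_zero]
  module

/-- `b_m(x) ⋯ b_1(x)` -/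
def BB (U : ℕ → E) : ℕ → ℚ → E
  | 0, _ => 1
  | m + 1, x => bb U (m + 1) x * BB U m x

lemma BB_comm_bb (H : Nil U) (m j : ℕ) (hmj : m + 2 ≤ j) (x y : ℚ) :
    Commute (BB U m x) (bb U j y) := by
  induction m with
  | zero => exact Commute.one_left _
  | succ m ih =>
    exact (bb_comm H (m + 1) j hmj x y).mul_left (ih (by omega))

lemma BB_comm (H : Nil U) (m : ℕ) (x y : ℚ) : Commute (BB U m x) (BB U m y) := by
  induction m with
  | zero => exact Commute.one_left _
  | succ m ih =>
    cases m with
    | zero =>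
      simp only [BB, mul_one]
      show _ * _ = _ * _
      rw [bb_add H, bb_add H, add_comm x]
    | succ m =>
      have ih' : BB U (m + 1) x * BB U (m + 1) y = BB U (m + 1) y * BB U (m + 1) x := ih
      have e1 : ∀ x y, BB U m x * BB U (m + 1) y =
          bb U (m + 1) (-x) * (BB U (m + 1) x * BB U (m + 1) y) := by
        intro x y
        have e0 : BB U (m + 1) x = bb U (m + 1) x * BB U m x := rfl
        rw [e0, mul_assoc (bb U (m + 1) x), ← mul_assoc (bb U (m + 1) (-x)),
          bb_add H, neg_add_cancel, bb_zero, one_mul]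
      have e2 : ∀ x y, BB U (m + 2) x * BB U (m + 2) y =
          (bb U (m + 2) x * bb U (m + 1) x * bb U (m + 2) y * bb U (m + 1) (-x)) *
            (BB U (m + 1) x * BB U (m + 1) y) := by
        intro x y
        have c := (BB_comm_bb H m (m + 2) le_rfl x y).eq
        calc BB U (m + 2) x * BB U (m + 2) y
            = bb U (m + 2) x * bb U (m + 1) x * (BB U m x * bb U (m + 2) y) * BB U (m + 1) y := by
              simp only [BB, mul_assoc]
          _ = bb U (m + 2) x * bb U (m + 1) x * bb U (m + 2) y * (BB U m x * BB U (m + 1) y) := by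
              rw [c]; simp only [mul_assoc]
          _ = _ := by rw [e1]; simp only [mul_assoc]
      show _ * _ = _ * _
      rw [e2, e2, ← ih']
      congr 1
      exact yb_aux (H.sq _) (H.sq _) (H.braid3 m) x y

/-- the full product -/
def AA (U : ℕ → E) (m : ℕ) (x : ℚ) : E := BB U m x * bb U 0 x

/-- kappa -/
def kap (U : ℕ → E) : E := U 1 * U 0 * U 1 - U 0 * U 1 * U 0

lemma kap_sq (H : Nil U) : kap U * kap U = 0 := by
  have ha := H.sq 0
  have hb := H.sq 1
  have h1 : ∀ z, U 0 * (U 0 * z) = 0 := fun z => by rw [← mul_assoc, ha, zero_mul]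
  have h2 : ∀ z, U 1 * (U 1 * z) = 0 := fun z => by rw [← mul_assoc, hb, zero_mul]
  have h4 : ∀ z, U 1 * (U 0 * (U 1 * (U 0 * z))) = U 0 * (U 1 * (U 0 * (U 1 * z))) := fun z => by
    have := H.braid4
    simp only [← mul_assoc]
    rw [← this]
  simp only [kap, mul_sub, sub_mul, mul_assoc, h4, hb, h1, h2, mul_zero, sub_self]

lemma R_aux (H : Nil U) (x y : ℚ) :
    bb U 1 (-y) * bb U 0 x * bb U 1 y * bb U 0 y - bb U 1 (-x) * bb U 0 y * bb U 1 x * bb U 0 x =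
    (x * y * (x - y)) • (bb U 1 (-x) * bb U 0 y * bb U 1 x * bb U 0 x * kap U) := by
  have ha := H.sq 0
  have hb := H.sq 1
  have h1 : ∀ z, U 0 * (U 0 * z) = 0 := fun z => by rw [← mul_assoc, ha, zero_mul]
  have h2 : ∀ z, U 1 * (U 1 * z) = 0 := fun z => by rw [← mul_assoc, hb, zero_mul]
  have h4 : ∀ z, U 1 * (U 0 * (U 1 * (U 0 * z))) = U 0 * (U 1 * (U 0 * (U 1 * z))) := fun z => by
    have := H.braid4
    simp only [← mul_assoc]
    rw [← this]
  have h3 : U 1 * (U 0 * (U 1 * U 0)) = U 0 * (U 1 * (U 0 * U 1)) := by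
    have := H.braid4
    simp only [← mul_assoc]
    rw [← this]
  simp only [bb, kap, add_mul, mul_add, mul_sub, one_mul, mul_one, smul_mul_assoc, mul_smul_comm,
    smul_smul, mul_assoc, ha, hb, h1, h2, h3, h4, smul_zero, add_zero, mul_zero]
  module

lemma BB_bb0 (H : Nil U) (m : ℕ) (x y : ℚ) :
    Commute (BB U (m + 1) x * bb U 1 (-x)) (bb U 0 y) := by
  induction m with
  | zero =>
    simp only [BB, mul_one]
    rw [zero_add, bb_add H, add_neg_cancel, bb_zero]
    exact Commute.one_left _
  | succ m ih =>
    rw [BB, mul_assoc]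
    exact ((bb_comm H 0 (m + 2) (by omega) y x).symm).mul_left ih

lemma AA_split (H : Nil U) (m : ℕ) (x y : ℚ) :
    AA U (m + 1) x * AA U (m + 1) y = BB U (m + 1) x * BB U (m + 1) y *
      (bb U 1 (-y) * bb U 0 x * bb U 1 y * bb U 0 y) := by
  have c := (BB_bb0 H m y x).eq
  have e : BB U (m + 1) y = BB U (m + 1) y * bb U 1 (-y) * bb U 1 y := by
    rw [mul_assoc, bb_add H, neg_add_cancel, bb_zero, mul_one]
  calc AA U (m + 1) x * AA U (m + 1) y
      = BB U (m + 1) x * bb U 0 x * BB U (m + 1) y * bb U 0 y := by simp only [AA, mul_assoc]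
    _ = BB U (m + 1) x * bb U 0 x * (BB U (m + 1) y * bb U 1 (-y) * bb U 1 y) * bb U 0 y := by
        rw [← e]
    _ = BB U (m + 1) x * (bb U 0 x * (BB U (m + 1) y * bb U 1 (-y))) * bb U 1 y * bb U 0 y := by
        simp only [mul_assoc]
    _ = _ := by rw [← c]; simp only [mul_assoc]

theorem AA_comm (H : Nil U) (m : ℕ) (x y : ℚ) :
    AA U (m + 1) x * AA U (m + 1) y - AA U (m + 1) y * AA U (m + 1) x =
      (x * y * (x - y)) • (AA U (m + 1) y * AA U (m + 1) x * kap U) := by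
  rw [AA_split H m x y, AA_split H m y x, ← (BB_comm H (m + 1) x y).eq, ← mul_sub, R_aux H,
    mul_smul_comm]
  simp only [mul_assoc]

end

end BnCSP

namespace BnCSP
open Polynomial

/-! ### Part C1b : coefficients -/

lemma coeff_zero_one {V : Type*} [AddCommGroup V] [Module ℚ V] (M : ℕ) (c : ℕ → V)
    (h : ∀ x : ℚ, ∑ i ∈ Finset.range M, x ^ i • c i = 0) : ∀ i < M, c i = 0 := by
  intro i hi
  rw [← Module.forall_dual_apply_eq_zero_iff ℚ]
  intro φ
  have h2 : (∑ i ∈ Finset.range M, C (φ (c i)) * X ^ i : ℚ[X]) = 0 := by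
    apply Polynomial.funext
    intro x
    have := congrArg φ (h x)
    rw [map_sum, map_zero] at this
    simp only [map_smul, smul_eq_mul] at this
    rw [eval_finsetSum, eval_zero, ← this]
    refine Finset.sum_congr rfl fun i _ => ?_
    rw [eval_mul, eval_C, eval_pow, eval_X, mul_comm]
  have h3 := congrArg (fun p => p.coeff i) h2
  simpa [finsetSum_coeff, coeff_C_mul, coeff_X_pow, hi] using h3

lemma coeff_zero_two {V : Type*} [AddCommGroup V] [Module ℚ V] (M : ℕ) (c : ℕ → ℕ → V)
    (h : ∀ x y : ℚ, ∑ i ∈ Finset.range M, ∑ j ∈ Finset.range M, (x ^ i * y ^ j) • c i j = 0) :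
    ∀ i < M, ∀ j < M, c i j = 0 := by
  intro i hi j hj
  have h1 : ∀ y : ℚ, ∑ j ∈ Finset.range M, y ^ j • c i j = 0 := by
    intro y
    refine coeff_zero_one M (fun i => ∑ j ∈ Finset.range M, y ^ j • c i j) ?_ i hi
    intro x
    rw [← h x y]
    refine Finset.sum_congr rfl fun i _ => ?_
    simp only [Finset.smul_sum, smul_smul]
  exact coeff_zero_one M (c i) h1 j hj

section
variable {E : Type*} [Ring E] [Algebra ℚ E] {U : ℕ → E}

/-- evaluation at a central scalar -/
noncomputable def evq (x : ℚ) : E[X] →+* E :=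
  eval₂RingHom' (RingHom.id E) (algebraMap ℚ E x) (fun a => (Algebra.commutes x a).symm)

lemma evq_eq (x : ℚ) (P : E[X]) (M : ℕ) (hM : P.natDegree < M) :
    evq x P = ∑ i ∈ Finset.range M, x ^ i • P.coeff i := by
  show eval₂ (RingHom.id E) (algebraMap ℚ E x) P = _
  rw [eval₂_eq_sum_range' _ hM]
  refine Finset.sum_congr rfl fun i _ => ?_
  rw [← map_pow, RingHom.id_apply, Algebra.smul_def, Algebra.commutes]

/-- integer indexed coefficients -/
noncomputable def aZ (P : E[X]) (i : ℤ) : E := if i < 0 then 0 else P.coeff i.toNat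

lemma aZ_neg (P : E[X]) (i : ℤ) (hi : i < 0) : aZ P i = 0 := by simp [aZ, hi]

lemma aZ_nat (P : E[X]) (i : ℕ) : aZ P i = P.coeff i := by simp [aZ]

lemma evq_shift (x : ℚ) (P : E[X]) (s M : ℕ) (hM : P.natDegree + s < M) :
    x ^ s • evq x P = ∑ i ∈ Finset.range M, x ^ i • aZ P ((i : ℤ) - s) := by
  have h1 : evq x (X ^ s * P) = x ^ s • evq x P := by
    rw [map_mul, map_pow]
    have : evq x (X : E[X]) = algebraMap ℚ E x := eval₂_X _ _
    rw [this, ← map_pow, Algebra.smul_def]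
  rw [← h1, evq_eq x _ M]
  · refine Finset.sum_congr rfl fun i _ => ?_
    rw [coeff_X_pow_mul', aZ]
    by_cases h : s ≤ i
    · rw [if_pos h, if_neg (by omega)]
      congr 2
      omega
    · rw [if_neg h, if_pos (by omega)]
  · refine lt_of_le_of_lt (natDegree_mul_le) ?_
    refine lt_of_le_of_lt (Nat.add_le_add_right (natDegree_X_pow_le s) _) ?_
    omega

/-- polynomial versions -/
noncomputable def Bp (U : ℕ → E) : ℕ → E[X]
  | 0 => 1
  | m + 1 => (1 + C (U (m + 1)) * X) * Bp U m

/-- polynomial version of `AA` -/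
noncomputable def Ap (U : ℕ → E) (m : ℕ) : E[X] := Bp U m * (1 + C (U 0) * X)

lemma evq_lin (x : ℚ) (u : E) : evq x (1 + C u * X) = 1 + x • u := by
  rw [map_add, map_mul, map_one]
  have h1 : evq x (X : E[X]) = algebraMap ℚ E x := eval₂_X _ _
  have h2 : evq x (C u) = u := eval₂_C _ _
  rw [h1, h2, Algebra.smul_def, Algebra.commutes]

lemma evq_Bp (x : ℚ) (m : ℕ) : evq x (Bp U m) = BB U m x := by
  induction m with
  | zero => simp [Bp, BB]
  | succ m ih => rw [Bp, BB, map_mul, ih, evq_lin]; rfl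

lemma evq_Ap (x : ℚ) (m : ℕ) : evq x (Ap U m) = AA U m x := by
  rw [Ap, map_mul, evq_Bp, evq_lin]; rfl

lemma double_sum (M : ℕ) (x y : ℚ) (f g : ℕ → E) :
    (∑ i ∈ Finset.range M, x ^ i • f i) * (∑ j ∈ Finset.range M, y ^ j • g j) =
    ∑ i ∈ Finset.range M, ∑ j ∈ Finset.range M, (x ^ i * y ^ j) • (f i * g j) := by
  rw [Finset.sum_mul_sum]
  refine Finset.sum_congr rfl fun i _ => Finset.sum_congr rfl fun j _ => ?_
  rw [smul_mul_smul_comm]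

lemma double_sum' (M : ℕ) (x y : ℚ) (f g : ℕ → E) :
    (∑ j ∈ Finset.range M, y ^ j • f j) * (∑ i ∈ Finset.range M, x ^ i • g i) =
    ∑ i ∈ Finset.range M, ∑ j ∈ Finset.range M, (x ^ i * y ^ j) • (f j * g i) := by
  rw [double_sum, Finset.sum_comm]
  refine Finset.sum_congr rfl fun i _ => Finset.sum_congr rfl fun j _ => ?_
  rw [mul_comm]

theorem aZ_comm (H : Nil U) (m : ℕ) (i j : ℤ) :
    aZ (Ap U (m + 1)) i * aZ (Ap U (m + 1)) j - aZ (Ap U (m + 1)) j * aZ (Ap U (m + 1)) i =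
    aZ (Ap U (m + 1)) (j - 1) * aZ (Ap U (m + 1)) (i - 2) * kap U -
    aZ (Ap U (m + 1)) (j - 2) * aZ (Ap U (m + 1)) (i - 1) * kap U := by
  set P := Ap U (m + 1) with hP
  by_cases hi : i < 0
  · simp [aZ_neg P i hi, aZ_neg P (i - 1) (by omega), aZ_neg P (i - 2) (by omega)]
  by_cases hj : j < 0
  · simp [aZ_neg P j hj, aZ_neg P (j - 1) (by omega), aZ_neg P (j - 2) (by omega)]
  obtain ⟨i, rfl⟩ := Int.eq_ofNat_of_zero_le (not_lt.mp hi)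
  obtain ⟨j, rfl⟩ := Int.eq_ofNat_of_zero_le (not_lt.mp hj)
  set M := P.natDegree + 3 + i + j with hM
  have key := coeff_zero_two M (fun i j : ℕ => aZ P i * aZ P j - aZ P j * aZ P i -
    (aZ P (j - 1) * aZ P (i - 2) * kap U - aZ P (j - 2) * aZ P (i - 1) * kap U)) ?_ i (by omega)
    j (by omega)
  · exact sub_eq_zero.mp key
  · intro x y
    have h0 := AA_comm H m x y
    rw [← evq_Ap, ← evq_Ap, ← hP] at h0
    have x0 := evq_shift x P 0 M (by omega)
    have y0 := evq_shift y P 0 M (by omega)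
    have x1 := evq_shift x P 1 M (by omega)
    have y1 := evq_shift y P 1 M (by omega)
    have x2 := evq_shift x P 2 M (by omega)
    have y2 := evq_shift y P 2 M (by omega)
    simp only [pow_zero, one_smul, Nat.cast_zero, sub_zero] at x0 y0
    have e1 := double_sum M x y (fun i : ℕ => aZ P i) (fun i : ℕ => aZ P i)
    have e2 := double_sum' M x y (fun i : ℕ => aZ P i) (fun i : ℕ => aZ P i)
    have e3 := double_sum' M x y (fun j : ℕ => aZ P (j - 1)) (fun i : ℕ => aZ P (i - 2))
    have e4 := double_sum' M x y (fun j : ℕ => aZ P (j - 2)) (fun i : ℕ => aZ P (i - 1))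
    rw [← x0, ← y0] at e1
    rw [← x0, ← y0] at e2
    simp only [Nat.cast_one, Nat.cast_ofNat] at x1 y1 x2 y2
    rw [← y1, ← x2] at e3
    rw [← x1, ← y2] at e4
    have e3' := congrArg (· * kap U) e3
    have e4' := congrArg (· * kap U) e4
    simp only [Finset.sum_mul, smul_mul_assoc] at e3' e4'
    simp only [smul_sub, Finset.sum_sub_distrib]
    rw [← e1, ← e2, ← e3', ← e4', h0]
    simp only [smul_mul_assoc, mul_smul_comm, smul_smul, pow_one]
    module

theorem aZ_symm (H : Nil U) (m : ℕ) (i j : ℤ) :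
    aZ (Ap U (m + 1)) i * aZ (Ap U (m + 1)) j * kap U =
      aZ (Ap U (m + 1)) j * aZ (Ap U (m + 1)) i * kap U := by
  have := congrArg (· * kap U) (aZ_comm H m i j)
  simp only [sub_mul, mul_assoc, kap_sq H, mul_zero, sub_self] at this
  simpa [mul_assoc] using sub_eq_zero.mp this

end

end BnCSP

namespace BnCSP
open Polynomial

/-! ### Part C1c : from a trace to the count -/

/-- existence of complete homogeneous data -/
noncomputable def hN {R : Type*} [CommRing R] (k : ℕ) (e : ℕ → R) (m : ℕ) : R :=
  if m = 0 then 1 else ∑ j : Fin (k + 1), if h : k + 1 - (j : ℕ) ≤ m then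
    ((-1) ^ (k - (j : ℕ)) * e (k + 1 - j)) * hN k e (m - (k + 1 - j)) else 0
termination_by m
decreasing_by omega

lemma hData_exists {R : Type*} [CommRing R] (k : ℕ) (e : ℕ → R) :
    HData k e (fun m : ℤ => if m < 0 then 0 else hN k e m.toNat) where
  neg m hm := by simp [hm]
  zero := by simp; rw [hN]; simp
  recur m hm := by
    by_cases h : m < 0
    · rw [if_pos h, Finset.sum_eq_zero]
      intro j _
      rw [if_pos (by omega), mul_zero]
    · rw [if_neg h, hN, if_neg (by omega)]
      refine Finset.sum_congr rfl fun j _ => ?_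
      by_cases hj : k + 1 - (j : ℕ) ≤ m.toNat
      · rw [dif_pos hj, if_neg (by omega)]
        congr 2
        omega
      · rw [dif_neg hj, if_pos (by omega), mul_zero]

section
variable {E : Type*} [Ring E] [Algebra ℚ E] {U : ℕ → E}

/-- product of a list, read from right to left -/
def prodR (a : ℤ → E) : List ℤ → E
  | [] => 1
  | x :: u => prodR a u * a x

lemma prodR_append (a : ℤ → E) (u v : List ℤ) : prodR a (u ++ v) = prodR a v * prodR a u := by
  induction u with
  | nil => simp [prodR]
  | cons x u ih => simp [prodR, ih, mul_assoc]

lemma prodR_zero (a : ℤ → E) (w : List ℤ) (x : ℤ) (hx : x ∈ w) (h0 : a x = 0) : prodR a w = 0 := by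
  induction w with
  | nil => simp at hx
  | cons y u ih =>
    rcases List.mem_cons.mp hx with rfl | h
    · simp [prodR, h0]
    · simp [prodR, ih h]

/-- `τ` is a trace on the subalgebra generated by `U` -/
structure TraceOn (U : ℕ → E) (τ : E →ₗ[ℚ] ℚ) : Prop where
  comm : ∀ Z ∈ Algebra.adjoin ℚ (Set.range U), ∀ W ∈ Algebra.adjoin ℚ (Set.range U),
    τ (Z * W) = τ (W * Z)

lemma coeff_lin_mul (u : E) (Q : E[X]) (i : ℕ) :
    ((1 + C u * X) * Q).coeff i = Q.coeff i + (if i = 0 then 0 else u * Q.coeff (i - 1)) := by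
  rw [add_mul, one_mul, coeff_add, mul_assoc, coeff_C_mul]
  cases i with
  | zero => simp
  | succ i => simp

lemma coeff_mul_lin (u : E) (Q : E[X]) (i : ℕ) :
    (Q * (1 + C u * X)).coeff i = Q.coeff i + (if i = 0 then 0 else Q.coeff (i - 1) * u) := by
  rw [mul_add, mul_one, coeff_add, ← mul_assoc]
  cases i with
  | zero => simp
  | succ i => simp

lemma Bp_mem (m i : ℕ) : (Bp U m).coeff i ∈ Algebra.adjoin ℚ (Set.range U) := by
  induction m generalizing i with
  | zero =>
    rw [Bp, coeff_one]; split_ifs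
    · exact Subalgebra.one_mem _
    · exact Subalgebra.zero_mem _
  | succ m ih =>
    rw [Bp, coeff_lin_mul]
    refine Subalgebra.add_mem _ (ih i) ?_
    split_ifs
    · exact Subalgebra.zero_mem _
    · exact Subalgebra.mul_mem _ (Algebra.subset_adjoin ⟨_, rfl⟩) (ih _)

lemma Ap_mem (m i : ℕ) : (Ap U m).coeff i ∈ Algebra.adjoin ℚ (Set.range U) := by
  rw [Ap, coeff_mul_lin]
  refine Subalgebra.add_mem _ (Bp_mem m i) ?_
  split_ifs
  · exact Subalgebra.zero_mem _
  · exact Subalgebra.mul_mem _ (Bp_mem _ _) (Algebra.subset_adjoin ⟨_, rfl⟩)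

lemma aZ_mem (m : ℕ) (i : ℤ) : aZ (Ap U m) i ∈ Algebra.adjoin ℚ (Set.range U) := by
  rw [aZ]; split_ifs
  · exact Subalgebra.zero_mem _
  · exact Ap_mem _ _

lemma prodR_mem (m : ℕ) (w : List ℤ) :
    prodR (aZ (Ap U m)) w ∈ Algebra.adjoin ℚ (Set.range U) := by
  induction w with
  | nil => exact Subalgebra.one_mem _
  | cons x u ih => exact Subalgebra.mul_mem _ ih (aZ_mem _ _)

lemma kap_mem : kap U ∈ Algebra.adjoin ℚ (Set.range U) := by
  have h : ∀ i, U i ∈ Algebra.adjoin ℚ (Set.range U) := fun i => Algebra.subset_adjoin ⟨_, rfl⟩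
  exact Subalgebra.sub_mem _ (Subalgebra.mul_mem _ (Subalgebra.mul_mem _ (h _) (h _)) (h _))
    (Subalgebra.mul_mem _ (Subalgebra.mul_mem _ (h _) (h _)) (h _))

lemma Ap_coeff_zero (m : ℕ) : (Ap U m).coeff 0 = 1 := by
  have : ∀ m, (Bp U m).coeff 0 = 1 := by
    intro m
    induction m with
    | zero => simp [Bp]
    | succ m ih => rw [Bp, coeff_lin_mul, ih]; simp
  rw [Ap, coeff_mul_lin, this]; simp

lemma traceData (H : Nil U) (m : ℕ) (τ : E →ₗ[ℚ] ℚ) (hτ : TraceOn U τ) (K : ℕ) :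
    TraceData K (fun w => τ (prodR (aZ (Ap U (m + 1))) w))
      (fun w => τ (prodR (aZ (Ap U (m + 1))) w * kap U)) where
  negT w _ x hx h0 := by
    show τ (prodR _ w) = 0
    rw [prodR_zero _ w x hx (aZ_neg _ _ h0), map_zero]
  negg w _ x hx h0 := by
    show τ (prodR _ w * _) = 0
    rw [prodR_zero _ w x hx (aZ_neg _ _ h0), zero_mul, map_zero]
  rot w _ := by
    cases w with
    | nil => simp
    | cons x u =>
      simp only [List.rotate_cons_succ, List.rotate_zero, prodR_append, prodR, one_mul]
      exact hτ.comm _ (aZ_mem _ _) _ (prodR_mem _ _)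
  r1 i j u _ := by
    simp only [prodR]
    rw [← map_sub, ← map_sub]
    congr 1
    have := aZ_comm H m i j
    rw [mul_assoc, mul_assoc, ← mul_sub, this]
    simp only [mul_sub, mul_assoc]
  symm i j u _ := by
    simp only [prodR]
    congr 1
    have := aZ_symm H m i j
    rw [mul_assoc (prodR _ u), mul_assoc (prodR _ u), mul_assoc (prodR _ u), mul_assoc (prodR _ u),
      this]
  r2 w hw := by
    set a := aZ (Ap U (m + 1)) with ha
    have ha0 : a 0 = 1 := by
      have := aZ_nat (Ap U (m + 1)) 0
      rw [Ap_coeff_zero] at this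
      simpa using this
    have c1 : ∀ x, a 1 * a x - a x * a 1 = - (a (x - 2) * kap U) := by
      intro x
      rw [ha, aZ_comm H m 1 x, ← ha, show (1 : ℤ) - 1 = 0 by norm_num, ha0,
        show a (1 - 2) = 0 from aZ_neg _ _ (by norm_num)]
      simp
    have step : ∀ s ∈ Finset.range K, τ (prodR a (dec2 (w.rotate s)) * kap U) =
        - (τ (prodR a (w.drop (s + 1)) * a 1 * prodR a (w.take (s + 1))) -
          τ (prodR a (w.drop s) * a 1 * prodR a (w.take s))) := by
      intro s hs
      have hs' : s < w.length := by rw [hw]; exact Finset.mem_range.mp hs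
      rw [← map_sub, List.rotate_eq_drop_append_take hs'.le, List.drop_eq_getElem_cons hs',
        ← List.take_concat_get' w s hs', prodR_append]
      set x := w[s]
      simp only [List.cons_append, dec2, prodR, prodR_append, one_mul]
      have e : prodR a (List.drop (s + 1) w) * a 1 * (a x * prodR a (List.take s w)) -
          prodR a (List.drop (s + 1) w) * a x * a 1 * prodR a (List.take s w) =
          - (prodR a (List.drop (s + 1) w) * a (x - 2) * kap U * prodR a (List.take s w)) := by
        calc _ = prodR a (List.drop (s + 1) w) * (a 1 * a x - a x * a 1) *
              prodR a (List.take s w) := by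
              simp only [mul_sub, sub_mul, mul_assoc]
          _ = _ := by rw [c1]; simp only [mul_neg, neg_mul, mul_assoc]
      rw [e, map_neg, neg_neg]
      have := hτ.comm (prodR a (List.take s w)) (prodR_mem _ _)
        (prodR a (List.drop (s + 1) w) * a (x - 2) * kap U)
        (Subalgebra.mul_mem _ (Subalgebra.mul_mem _ (prodR_mem _ _) (aZ_mem _ _)) kap_mem)
      rw [← this]
      simp only [mul_assoc]
    rw [Finset.sum_congr rfl step, Finset.sum_neg_distrib, Finset.sum_range_sub
      (fun s => τ (prodR a (w.drop s) * a 1 * prodR a (w.take s)))]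
    rw [← hw]
    simp only [List.drop_length, List.take_length, List.drop_zero, List.take_zero, prodR, one_mul,
      mul_one]
    rw [hτ.comm _ (aZ_mem _ _) _ (prodR_mem _ _), sub_self, neg_zero]

/-- inverse product -/
noncomputable def Hp (U : ℕ → E) : ℕ → E[X]
  | 0 => 1 + C (U 0) * X
  | m + 1 => Hp U m * (1 + C (U (m + 1)) * X)

/-- signed product -/
noncomputable def An (U : ℕ → E) (m : ℕ) : E[X] := Ap (fun i => - U i) m

lemma lin_inv (u : E) (hu : u * u = 0) : (1 + C u * X) * (1 + C (-u) * X) = 1 := by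
  have : C u * X * (C u * X) = (0 : E[X]) := by
    rw [mul_assoc, ← mul_assoc X, X_mul_C, mul_assoc, ← mul_assoc, ← C_mul, hu]; simp
  simp only [map_neg, neg_mul, mul_add, add_mul, one_mul, mul_one, mul_neg, this]
  abel

lemma Hp_An (H : Nil U) (m : ℕ) : Hp U m * An U m = 1 := by
  have key : ∀ m, Hp U m * Bp (fun i => - U i) m = 1 + C (U 0) * X := by
    intro m
    induction m with
    | zero => simp [Hp, Bp]
    | succ m ih =>
      rw [Hp, Bp, mul_assoc, ← mul_assoc (1 + C (U (m + 1)) * X), lin_inv _ (H.sq _), one_mul, ih]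
  rw [An, Ap, ← mul_assoc, key, lin_inv _ (H.sq _)]

lemma An_coeff (m i : ℕ) : (An U m).coeff i = (-1) ^ i * (Ap U m).coeff i := by
  have key : ∀ m i, (Bp (fun i => - U i) m).coeff i = (-1) ^ i * (Bp U m).coeff i := by
    intro m
    induction m with
    | zero => intro i; cases i <;> simp [Bp, coeff_one]
    | succ m ih =>
      intro i
      rw [Bp, Bp, coeff_lin_mul, coeff_lin_mul, ih]
      cases i with
      | zero => simp
      | succ i =>
        simp only [Nat.add_sub_cancel, ih, pow_succ]
        rcases neg_one_pow_eq_or E i with h | h <;> simp [h, add_comm]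
  rw [An, Ap, Ap, coeff_mul_lin, coeff_mul_lin, key]
  cases i with
  | zero => simp
  | succ i =>
    simp only [Nat.add_sub_cancel, key, pow_succ]
    rcases neg_one_pow_eq_or E i with h | h <;> simp [h, add_comm]

lemma Hp_natDegree (m : ℕ) : (Hp U m).natDegree ≤ m + 1 := by
  have lin : ∀ u : E, (1 + C u * X).natDegree ≤ 1 := by
    intro u
    refine (natDegree_add_le _ _).trans ?_
    simp only [natDegree_one, zero_le, sup_of_le_right]
    exact (natDegree_C_mul_le _ _).trans natDegree_X_le
  induction m with
  | zero => exact lin _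
  | succ m ih =>
    rw [Hp]
    exact natDegree_mul_le.trans (Nat.add_le_add ih (lin _))

lemma Bp_natDegree (m : ℕ) : (Bp U m).natDegree ≤ m := by
  have lin : ∀ u : E, (1 + C u * X).natDegree ≤ 1 := by
    intro u
    refine (natDegree_add_le _ _).trans ?_
    simp only [natDegree_one, zero_le, sup_of_le_right]
    exact (natDegree_C_mul_le _ _).trans natDegree_X_le
  induction m with
  | zero => simp [Bp]
  | succ m ih =>
    rw [Bp]
    exact natDegree_mul_le.trans (by have := lin (U (m + 1)); omega)

lemma Ap_coeff_big (k : ℕ) (hU : U (k + 1) = 0) (i : ℕ) (hi : k + 1 < i) :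
    (Ap U (k + 1)).coeff i = 0 := by
  have : Bp U (k + 1) = Bp U k := by rw [Bp, hU]; simp
  rw [Ap, coeff_mul_lin, this, coeff_eq_zero_of_natDegree_lt (by have := Bp_natDegree (U := U) k; omega),
    coeff_eq_zero_of_natDegree_lt (by have := Bp_natDegree (U := U) k; omega)]
  simp

lemma Hp_coeff_big (k : ℕ) (hU : U (k + 1) = 0) (i : ℕ) (hi : k + 1 < i) :
    (Hp U (k + 1)).coeff i = 0 := by
  have : Hp U (k + 1) = Hp U k := by rw [Hp, hU]; simp
  rw [this, coeff_eq_zero_of_natDegree_lt (by have := Hp_natDegree (U := U) k; omega)]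

lemma Hp_rec (H : Nil U) (k : ℕ) (hU : U (k + 1) = 0) (m : ℕ) (hm : m ≠ 0) :
    (Hp U (k + 1)).coeff m = ∑ j : Fin (k + 1), if k + 1 - (j : ℕ) ≤ m then
      (-1) ^ (k - (j : ℕ)) * ((Hp U (k + 1)).coeff (m - (k + 1 - j)) *
        (Ap U (k + 1)).coeff (k + 1 - j)) else 0 := by
  set f : ℕ → E := fun i => if i ≤ m then (Hp U (k + 1)).coeff (m - i) * (An U (k + 1)).coeff i else 0
    with hf
  have h1 := congrArg (fun p => p.coeff m) (Hp_An H (k + 1))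
  simp only [coeff_one, hm, if_false, coeff_mul] at h1
  rw [Finset.Nat.sum_antidiagonal_eq_sum_range_succ_mk, ← Finset.sum_range_reflect] at h1
  have h2 : ∑ i ∈ Finset.range (m + 1), f i = 0 := by
    rw [← h1]
    refine Finset.sum_congr rfl fun i hi => ?_
    rw [Finset.mem_range] at hi
    simp only [hf]
    rw [if_pos (by omega)]
    have e1 : m + 1 - 1 - i = m - i := by omega
    have e2 : m - (m - i) = i := by omega
    simp only [e1, e2]
  have h3 : ∑ i ∈ Finset.range (m + 1), f i = ∑ i ∈ Finset.range (k + 2), f i := by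
    rcases le_total (m + 1) (k + 2) with h | h
    · refine Finset.sum_subset (Finset.range_mono h) ?_
      intro i _ hi
      simp only [Finset.mem_range, hf] at hi ⊢
      rw [if_neg (by omega)]
    · refine (Finset.sum_subset (Finset.range_mono h) ?_).symm
      intro i _ hi
      simp only [Finset.mem_range, hf] at hi ⊢
      rw [An_coeff, Ap_coeff_big k hU i (by omega)]; simp
  rw [h3, Finset.sum_range_succ', ← Finset.sum_range_reflect, Finset.sum_range] at h2
  have h4 : f 0 = (Hp U (k + 1)).coeff m := by
    simp [hf, An_coeff, Ap_coeff_zero]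
  rw [h4] at h2
  rw [← neg_eq_of_add_eq_zero_right h2, ← Finset.sum_neg_distrib]
  refine Finset.sum_congr rfl fun j _ => ?_
  have e1 : k + 1 - 1 - (j : ℕ) + 1 = k + 1 - j := by omega
  rw [e1]
  simp only [hf]
  split_ifs with h
  · rw [An_coeff, show k + 1 - (j : ℕ) = (k - j) + 1 by omega]
    rcases neg_one_pow_eq_or E (k - j) with h | h <;> simp [pow_succ, h]
  · simp

end

end BnCSP

namespace BnCSP

/-! ### Part C1d : the functional -/

section
variable {E : Type*} [Ring E] [Algebra ℚ E] {U : ℕ → E}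

/-- the functional on polynomials attached to a function on lists -/
noncomputable def Lc (T : List ℤ → ℚ) : MvPolynomial ℕ ℚ →ₗ[ℚ] ℚ :=
  (MvPolynomial.basisMonomials ℕ ℚ).constr ℚ
    (fun s => T ((Finsupp.toMultiset s).toList.map (fun i : ℕ => (i : ℤ))))

lemma prod_map_X (l : List ℕ) : (l.map (fun i => (MvPolynomial.X i : MvPolynomial ℕ ℚ))).prod =
    MvPolynomial.monomial (Multiset.toFinsupp (l : Multiset ℕ)) 1 := by
  induction l with
  | nil => simp
  | cons x l ih =>
    rw [List.map_cons, List.prod_cons, ih, MvPolynomial.X, MvPolynomial.monomial_mul, one_mul,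
      ← Multiset.cons_coe, ← Multiset.singleton_add, Multiset.toFinsupp_add,
      Multiset.toFinsupp_singleton]

lemma Lc_prod (T : List ℤ → ℚ) (hT : ∀ w w' : List ℤ, w.Perm w' → T w = T w') (l : List ℕ) :
    Lc T (l.map (fun i => (MvPolynomial.X i : MvPolynomial ℕ ℚ))).prod =
      T (l.map (fun i : ℕ => (i : ℤ))) := by
  have h0 : ∀ s, MvPolynomial.monomial s (1 : ℚ) = MvPolynomial.basisMonomials ℕ ℚ s := by
    intro s; simp
  rw [prod_map_X, h0, Lc, Module.Basis.constr_basis]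
  apply hT
  apply List.Perm.map
  rw [← Multiset.coe_eq_coe]
  simp

lemma Lc_hN (H : Nil U) (k : ℕ) (hU : U (k + 1) = 0) (τ : E →ₗ[ℚ] ℚ) (hτ : TraceOn U τ) (m : ℕ) :
    ∀ l : List ℕ, Lc (fun w => τ (prodR (aZ (Ap U (k + 1))) w))
      (hN k (fun i => (MvPolynomial.X i : MvPolynomial ℕ ℚ)) m *
        (l.map (fun i => (MvPolynomial.X i : MvPolynomial ℕ ℚ))).prod) =
      τ ((Hp U (k + 1)).coeff m * prodR (aZ (Ap U (k + 1))) (l.map (fun i : ℕ => (i : ℤ)))) := by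
  have hT : ∀ w w' : List ℤ, w.Perm w' → (fun w => τ (prodR (aZ (Ap U (k + 1))) w)) w =
      (fun w => τ (prodR (aZ (Ap U (k + 1))) w)) w' :=
    fun w w' h => trace_perm _ _ _ (traceData H k τ hτ w.length) w w' rfl h
  induction m using Nat.strong_induction_on with
  | _ m ih =>
  intro l
  by_cases hm : m = 0
  · subst hm
    rw [hN, if_pos rfl, one_mul, Lc_prod _ hT]
    have : (Hp U (k + 1)).coeff 0 = 1 := by
      have : ∀ m, (Hp U m).coeff 0 = 1 := by
        intro m
        induction m with
        | zero => simp [Hp]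
        | succ m ih => rw [Hp, Polynomial.mul_coeff_zero, ih]; simp
      exact this _
    rw [this, one_mul]
  · rw [hN, if_neg hm, Hp_rec H k hU m hm, Finset.sum_mul, Finset.sum_mul, map_sum, map_sum]
    refine Finset.sum_congr rfl fun j _ => ?_
    by_cases h : k + 1 - (j : ℕ) ≤ m
    · rw [dif_pos h, if_pos h]
      have h1 := ih (m - (k + 1 - j)) (by omega) (l ++ [k + 1 - (j : ℕ)])
      rw [List.map_append, List.prod_append, List.map_append, prodR_append] at h1
      simp only [List.map_cons, List.map_nil, List.prod_singleton, prodR, one_mul, aZ_nat] at h1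
      rw [← mul_assoc] at h1
      have h4 : ∀ a b c : MvPolynomial ℕ ℚ, a * b * c = b * c * a := by intros; ring
      rcases Nat.even_or_odd (k - (j : ℕ)) with h2 | h2
      · rw [h2.neg_one_pow, h2.neg_one_pow, one_mul, one_mul, mul_assoc (Polynomial.coeff _ _), ← h1, h4]
      · rw [h2.neg_one_pow, h2.neg_one_pow, neg_one_mul, neg_one_mul, neg_mul, neg_mul, neg_mul, map_neg, map_neg,
          mul_assoc (Polynomial.coeff _ _), ← h1, h4]
    · rw [dif_neg h, if_neg h]; simp

lemma Lc_hN_zero (H : Nil U) (k : ℕ) (hU : U (k + 1) = 0) (τ : E →ₗ[ℚ] ℚ) (hτ : TraceOn U τ) (m : ℕ)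
    (hm : k + 1 < m) (f : MvPolynomial ℕ ℚ) : Lc (fun w => τ (prodR (aZ (Ap U (k + 1))) w))
      (hN k (fun i => (MvPolynomial.X i : MvPolynomial ℕ ℚ)) m * f) = 0 := by
  have : (Lc (fun w => τ (prodR (aZ (Ap U (k + 1))) w))) ∘ₗ LinearMap.mulLeft ℚ
      (hN k (fun i => (MvPolynomial.X i : MvPolynomial ℕ ℚ)) m) = 0 := by
    refine (MvPolynomial.basisMonomials ℕ ℚ).ext fun s => ?_
    have h1 := Lc_hN H k hU τ hτ m (Finsupp.toMultiset s).toList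
    rw [prod_map_X, Hp_coeff_big k hU m hm, zero_mul, map_zero] at h1
    simpa using h1
  exact LinearMap.congr_fun this f

/-- Conclusion of part C1. -/
theorem trace_main (H : Nil U) (k : ℕ) (hU : U (k + 1) = 0) (τ : E →ₗ[ℚ] ℚ) (hτ : TraceOn U τ) :
    τ ((Ap U (k + 1)).coeff 1 ^ ((k + 1) ^ 2)) =
      chiOne k ((k + 1) ^ 2) * τ ((Ap U (k + 1)).coeff (k + 1) ^ (k + 1)) := by
  have hT : ∀ w w' : List ℤ, w.Perm w' → (fun w => τ (prodR (aZ (Ap U (k + 1))) w)) w =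
      (fun w => τ (prodR (aZ (Ap U (k + 1))) w)) w' :=
    fun w w' h => trace_perm _ _ _ (traceData H k τ hτ w.length) w w' rfl h
  have h1 := functional_e1_pow (hData_exists k (fun i => (MvPolynomial.X i : MvPolynomial ℕ ℚ)))
    (Lc (fun w => τ (prodR (aZ (Ap U (k + 1))) w))).toAddMonoidHom ?_
  · have h2 : ∀ i r : ℕ, Lc (fun w => τ (prodR (aZ (Ap U (k + 1))) w))
        ((MvPolynomial.X i : MvPolynomial ℕ ℚ) ^ r) = τ ((Ap U (k + 1)).coeff i ^ r) := by
      intro i r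
      have h3 := Lc_prod _ hT (List.replicate r i)
      rw [List.map_replicate, List.prod_replicate] at h3
      rw [h3, List.map_replicate]
      congr 1
      induction r with
      | zero => simp [prodR]
      | succ r ih => rw [List.replicate_succ, prodR, aZ_nat, pow_succ, ih (by
          have h3 := Lc_prod _ hT (List.replicate r i)
          rwa [List.map_replicate, List.prod_replicate] at h3)]
    simp only [LinearMap.toAddMonoidHom_coe, h2] at h1
    exact h1
  · rintro α ⟨i, hi⟩
    rw [sDet, Matrix.det_succ_row _ i, map_sum]
    refine Finset.sum_eq_zero fun j _ => ?_
    simp only [sMat, Matrix.of_apply, LinearMap.toAddMonoidHom_coe]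
    rw [if_neg (by omega), mul_comm ((-1) ^ _), mul_assoc]
    exact Lc_hN_zero H k hU τ hτ _ (by omega) _

end

end BnCSP

namespace BnCSP

/-! ### Part S : signed permutations as states -/

/-- the action of a letter on states -/
def act {n : ℕ} (i : Fin n) (p : Fin n → ℤ) : Fin n → ℤ :=
  if h : (i : ℕ) + 1 < n then p ∘ Equiv.swap i ⟨i + 1, h⟩ else Function.update p i (-p i)

/-- the letter increases the length -/
def asc {n : ℕ} (i : Fin n) (p : Fin n → ℤ) : Prop :=
  if h : (i : ℕ) + 1 < n then p ⟨i + 1, h⟩ < p i else 0 < p i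

noncomputable instance {n : ℕ} (i : Fin n) (p : Fin n → ℤ) : Decidable (asc i p) := Classical.dec _

/-- action of a word -/
def run {n : ℕ} (ω : List (Fin n)) (p : Fin n → ℤ) : Fin n → ℤ := ω.foldl (fun p i => act i p) p

/-- all steps are ascents -/
def path {n : ℕ} : List (Fin n) → (Fin n → ℤ) → Prop
  | [], _ => True
  | i :: u, p => asc i p ∧ path u (act i p)

/-- the dominant state -/
def start (n : ℕ) : Fin n → ℤ := fun j => n - (j : ℕ)

/-- signed permutations -/
structure Gen {n : ℕ} (p : Fin n → ℤ) : Prop where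
  pos : ∀ i, 1 ≤ |p i|
  le : ∀ i, |p i| ≤ n
  inj : ∀ i j, |p i| = |p j| → i = j

variable {n : ℕ}

lemma act_swap (i : Fin n) (h : (i : ℕ) + 1 < n) (p : Fin n → ℤ) :
    act i p = p ∘ Equiv.swap i ⟨i + 1, h⟩ := by rw [act, dif_pos h]

lemma act_touch (i : Fin n) (h : ¬ (i : ℕ) + 1 < n) (p : Fin n → ℤ) :
    act i p = Function.update p i (-p i) := by rw [act, dif_neg h]

lemma asc_swap (i : Fin n) (h : (i : ℕ) + 1 < n) (p : Fin n → ℤ) :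
    asc i p ↔ p ⟨i + 1, h⟩ < p i := by rw [asc, dif_pos h]

lemma asc_touch (i : Fin n) (h : ¬ (i : ℕ) + 1 < n) (p : Fin n → ℤ) :
    asc i p ↔ 0 < p i := by rw [asc, dif_neg h]

lemma act_act (i : Fin n) (p : Fin n → ℤ) : act i (act i p) = p := by
  by_cases h : (i : ℕ) + 1 < n
  · rw [act_swap i h, act_swap i h]; ext j; simp
  · rw [act_touch i h, act_touch i h]; simp

lemma act_neg (i : Fin n) (p : Fin n → ℤ) : act i (-p) = -act i p := by
  by_cases h : (i : ℕ) + 1 < n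
  · rw [act_swap i h, act_swap i h]; ext j; simp
  · rw [act_touch i h, act_touch i h]; ext j
    by_cases hj : j = i
    · subst hj; simp
    · simp [hj]

lemma act_comp (i : Fin n) (g : ℤ → ℤ) (hg : ∀ x, g (-x) = - g x) (p : Fin n → ℤ) :
    act i (g ∘ p) = g ∘ act i p := by
  by_cases h : (i : ℕ) + 1 < n
  · rw [act_swap i h, act_swap i h]; rfl
  · rw [act_touch i h, act_touch i h]; ext j
    by_cases hj : j = i
    · subst hj; simp [hg]
    · simp [hj]

lemma run_nil (p : Fin n → ℤ) : run [] p = p := rfl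
lemma run_cons (i : Fin n) (u) (p : Fin n → ℤ) : run (i :: u) p = run u (act i p) := rfl
lemma run_append (u v) (p : Fin n → ℤ) : run (u ++ v) p = run v (run u p) := by
  simp [run, List.foldl_append]

lemma run_comp (u : List (Fin n)) (g : ℤ → ℤ) (hg : ∀ x, g (-x) = - g x) (p : Fin n → ℤ) :
    run u (g ∘ p) = g ∘ run u p := by
  induction u generalizing p with
  | nil => rfl
  | cons i u ih => rw [run_cons, act_comp i g hg, ih, run_cons]

lemma path_append (u v) (p : Fin n → ℤ) : path (u ++ v) p ↔ path u p ∧ path v (run u p) := by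
  induction u generalizing p with
  | nil => simp [path, run_nil]
  | cons i u ih => simp [path, ih, run_cons, and_assoc]

lemma Gen.act {p : Fin n → ℤ} (hp : Gen p) (i : Fin n) : Gen (act i p) := by
  by_cases h : (i : ℕ) + 1 < n
  · rw [act_swap i h]
    refine ⟨fun j => hp.pos _, fun j => hp.le _, fun a b hab => ?_⟩
    exact (Equiv.injective _) (hp.inj _ _ hab)
  · have : ∀ j, |BnCSP.act i p j| = |p j| := by
      intro j
      rw [act_touch i h]
      by_cases hj : j = i
      · subst hj; simp
      · simp [hj]
    refine ⟨fun j => ?_, fun j => ?_, fun a b hab => ?_⟩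
    · rw [this]; exact hp.pos j
    · rw [this]; exact hp.le j
    · rw [this, this] at hab; exact hp.inj _ _ hab

lemma Gen.run {p : Fin n → ℤ} (hp : Gen p) (u) : Gen (run u p) := by
  induction u generalizing p with
  | nil => exact hp
  | cons i u ih => exact ih (hp.act i)

lemma gen_start : Gen (start n) := by
  refine ⟨fun i => ?_, fun i => ?_, fun i j h => ?_⟩
  · have := i.2; rw [start, abs_of_nonneg (by omega)]; omega
  · have := i.2; rw [start, abs_of_nonneg (by omega)]; omega
  · have := i.2; have := j.2
    rw [start, abs_of_nonneg (by omega), start, abs_of_nonneg (by omega)] at h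
    ext; omega

lemma Gen.neg {p : Fin n → ℤ} (hp : Gen p) : Gen (-p) :=
  ⟨fun i => by simpa using hp.pos i, fun i => by simpa using hp.le i,
    fun i j h => hp.inj i j (by simpa using h)⟩

lemma not_asc {p : Fin n → ℤ} (hp : Gen p) (i : Fin n) : ¬ asc i p ↔ asc i (act i p) := by
  by_cases h : (i : ℕ) + 1 < n
  · rw [asc_swap i h, asc_swap i h, act_swap i h]
    have := hp.inj i ⟨i + 1, h⟩
    have h2 : p i ≠ p ⟨i + 1, h⟩ := by
      intro h3; have h4 := this (by rw [h3]); simp [Fin.ext_iff] at h4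
    simp; omega
  · rw [asc_touch i h, asc_touch i h, act_touch i h]
    have := hp.pos i
    have h2 : p i ≠ 0 := by intro h; rw [h] at this; simp at this
    simp; omega

/-- pair contribution -/
def FF (x y : ℤ) : ℤ := (if x < y then 1 else 0) + (if x + y < 0 then 1 else 0)

/-- length of a state -/
def inv (p : Fin n → ℤ) : ℤ :=
  (∑ a, ∑ b, if a < b then FF (p a) (p b) else 0) + ∑ a, if p a < 0 then 1 else 0

lemma inv_swap (i : Fin n) (h : (i : ℕ) + 1 < n) (p : Fin n → ℤ) :
    inv (act i p) = inv p + (FF (p ⟨i + 1, h⟩) (p i) - FF (p i) (p ⟨i + 1, h⟩)) := by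
  rw [act_swap i h]
  set s := Equiv.swap i ⟨i + 1, h⟩ with hs
  have hss : ∀ a, s (s a) = a := fun a => by simp [hs]
  have e1 : ∑ a, (if (p ∘ s) a < 0 then 1 else 0 : ℤ) = ∑ a, if p a < 0 then 1 else 0 :=
    Equiv.sum_comp s (fun a => if p a < 0 then (1 : ℤ) else 0)
  have e2 : ∑ a, ∑ b, (if a < b then FF ((p ∘ s) a) ((p ∘ s) b) else 0) =
      ∑ a, ∑ b, (if s a < s b then FF (p a) (p b) else 0) := by
    rw [← Equiv.sum_comp s]
    refine Finset.sum_congr rfl fun a _ => ?_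
    rw [← Equiv.sum_comp s]
    simp [hss]
  have e3 : ∀ a b, (if s a < s b then FF (p a) (p b) else 0) = (if a < b then FF (p a) (p b) else 0) +
      (if a = ⟨i + 1, h⟩ then (if b = i then FF (p a) (p b) else 0) else 0) -
      (if a = i then (if b = ⟨i + 1, h⟩ then FF (p a) (p b) else 0) else 0) := by
    intro a b
    have sa : ((s a : Fin n) : ℕ) = if (a : ℕ) = i then (i : ℕ) + 1 else if (a : ℕ) = i + 1 then (i : ℕ) else a := by
      rw [hs, Equiv.swap_apply_def]; simp only [Fin.ext_iff]; split_ifs <;> rfl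
    have sb : ((s b : Fin n) : ℕ) = if (b : ℕ) = i then (i : ℕ) + 1 else if (b : ℕ) = i + 1 then (i : ℕ) else b := by
      rw [hs, Equiv.swap_apply_def]; simp only [Fin.ext_iff]; split_ifs <;> rfl
    simp only [Fin.lt_def, sa, sb, Fin.ext_iff]
    split_ifs <;> first | omega | simp
  rw [inv, inv, e1, e2]
  simp only [e3, Finset.sum_add_distrib, Finset.sum_sub_distrib, Finset.sum_ite_eq', Finset.mem_univ, if_true,
    Finset.sum_ite_irrel, Finset.sum_const_zero]
  ring

lemma inv_touch (i : Fin n) (h : ¬ (i : ℕ) + 1 < n) (p : Fin n → ℤ) :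
    inv (act i p) = inv p + ((if -p i < 0 then 1 else 0) - (if p i < 0 then 1 else 0)) := by
  rw [act_touch i h, inv, inv]
  have e1 : ∀ a b, (if a < b then FF (Function.update p i (-p i) a) (Function.update p i (-p i) b) else 0) =
      (if a < b then FF (p a) (p b) else 0) := by
    intro a b
    split_ifs with hab
    · have ha : a ≠ i := by rintro rfl; have := b.2; rw [Fin.lt_def] at hab; omega
      by_cases hb : b = i
      · subst hb
        rw [Function.update_of_ne ha, Function.update_self, FF, FF]
        split_ifs <;> omega
      · rw [Function.update_of_ne ha, Function.update_of_ne hb]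
    · rfl
  simp only [e1]
  have e2 : ∀ a, (if Function.update p i (-p i) a < 0 then (1 : ℤ) else 0) = (if p a < 0 then 1 else 0) +
      (if a = i then ((if -p i < 0 then 1 else 0) - (if p i < 0 then 1 else 0)) else 0) := by
    intro a
    by_cases hb : a = i
    · subst hb; simp
    · simp [hb]
  simp only [e2, Finset.sum_add_distrib, Finset.sum_ite_eq', Finset.mem_univ, if_true]
  ring

lemma inv_asc (i : Fin n) (p : Fin n → ℤ) (h : asc i p) : inv (act i p) = inv p + 1 := by
  by_cases hi : (i : ℕ) + 1 < n
  · rw [inv_swap i hi]; rw [asc_swap i hi] at h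
    simp only [FF]; split_ifs <;> omega
  · rw [inv_touch i hi]; rw [asc_touch i hi] at h
    split_ifs <;> omega

lemma inv_desc {p : Fin n → ℤ} (hp : Gen p) (i : Fin n) (h : ¬ asc i p) : inv (act i p) = inv p - 1 := by
  rw [not_asc hp] at h
  have := inv_asc i _ h
  rw [act_act] at this; omega

lemma inv_start : inv (start n) = 0 := by
  rw [inv, Finset.sum_eq_zero, Finset.sum_eq_zero, add_zero]
  · intro a _; have := a.2; rw [start, if_neg]; omega
  · intro a _
    refine Finset.sum_eq_zero fun b _ => ?_
    split_ifs with h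
    · rw [Fin.lt_def] at h
      rw [FF, start, start, if_neg, if_neg, add_zero] <;> omega
    · rfl

lemma inv_nonneg (p : Fin n → ℤ) : 0 ≤ inv p := by
  rw [inv]
  refine add_nonneg (Finset.sum_nonneg fun a _ => Finset.sum_nonneg fun b _ => ?_)
    (Finset.sum_nonneg fun a _ => ?_)
  · simp only [FF]; split_ifs <;> omega
  · split_ifs <;> omega

lemma inv_neg {p : Fin n → ℤ} (hp : Gen p) : inv (-p) = n ^ 2 - inv p := by
  have hne : ∀ a b, a ≠ b → p a ≠ p b ∧ p a + p b ≠ 0 := by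
    intro a b hab
    refine ⟨fun h => hab (hp.inj _ _ (by rw [h])), fun h => hab (hp.inj _ _ ?_)⟩
    rw [show p a = - p b by omega, abs_neg]
  have e1 : inv (-p) + inv p = (∑ a : Fin n, ∑ b : Fin n, if a < b then (2 : ℤ) else 0) + ∑ a : Fin n, 1 := by
    rw [inv, inv, add_add_add_comm, ← Finset.sum_add_distrib, ← Finset.sum_add_distrib]
    congr 1
    · refine Finset.sum_congr rfl fun a _ => ?_
      rw [← Finset.sum_add_distrib]
      refine Finset.sum_congr rfl fun b _ => ?_
      split_ifs with hab
      · have := hne a b hab.ne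
        simp only [FF, Pi.neg_apply]; split_ifs <;> omega
      · rfl
    · refine Finset.sum_congr rfl fun a _ => ?_
      have := hp.pos a
      have h2 : p a ≠ 0 := by intro h; rw [h] at this; simp at this
      simp only [Pi.neg_apply]; split_ifs <;> omega
  have e2 : (∑ a : Fin n, ∑ b : Fin n, if a < b then (2 : ℤ) else 0) =
      ∑ a : Fin n, ∑ b : Fin n, if a ≠ b then (1 : ℤ) else 0 := by
    have : (∑ a : Fin n, ∑ b : Fin n, if a < b then (1 : ℤ) else 0) =
      ∑ a : Fin n, ∑ b : Fin n, if b < a then (1 : ℤ) else 0 := Finset.sum_comm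
    have h3 : (∑ a : Fin n, ∑ b : Fin n, if a < b then (2 : ℤ) else 0) =
      (∑ a : Fin n, ∑ b : Fin n, if a < b then (1 : ℤ) else 0) +
      (∑ a : Fin n, ∑ b : Fin n, if a < b then (1 : ℤ) else 0) := by
      simp only [← Finset.sum_add_distrib]
      refine Finset.sum_congr rfl fun a _ => Finset.sum_congr rfl fun b _ => ?_
      split_ifs <;> omega
    rw [h3]; nth_rw 2 [this]
    simp only [← Finset.sum_add_distrib]
    refine Finset.sum_congr rfl fun a _ => Finset.sum_congr rfl fun b _ => ?_
    rcases lt_trichotomy a b with h | h | h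
    · simp [h, h.ne, h.le, h.not_gt]
    · simp [h]
    · simp [h, h.ne', h.le, h.not_gt]
  have e3 : (∑ a : Fin n, ∑ b : Fin n, if a ≠ b then (1 : ℤ) else 0) + ∑ a : Fin n, 1 = n ^ 2 := by
    rw [← Finset.sum_add_distrib]
    have : ∀ a : Fin n, (∑ b : Fin n, if a ≠ b then (1 : ℤ) else 0) + 1 = n := by
      intro a
      have h1 : (∑ b : Fin n, if a ≠ b then (1 : ℤ) else 0) + (∑ b : Fin n, if a = b then (1 : ℤ) else 0) = n := by
        rw [← Finset.sum_add_distrib, Finset.sum_congr rfl (g := fun _ => 1)]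
        · simp
        · intro b _; by_cases hab : a = b
          · rw [if_neg (not_not.mpr hab), if_pos hab]; rfl
          · rw [if_pos hab, if_neg hab]; rfl
      rwa [Finset.sum_ite_eq, if_pos (Finset.mem_univ _)] at h1
    simp only [this]; simp [sq]
  rw [e2, e3] at e1; omega

lemma eq_start {p : Fin n → ℤ} (hp : Gen p) (h : ∀ i, asc i p) : p = start n := by
  have step : ∀ (i : ℕ) (h : i + 1 < n), p ⟨i + 1, h⟩ < p ⟨i, by omega⟩ := by
    intro i hi
    have := h ⟨i, by omega⟩
    rwa [asc_swap _ hi] at this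
  have up : ∀ (i : ℕ) (h : i < n), p ⟨i, h⟩ ≤ n - i := by
    intro i
    induction i with
    | zero => intro h0; have := hp.le ⟨0, h0⟩; have := le_abs_self (p ⟨0, h0⟩); push_cast; omega
    | succ i ih => intro h0; have := ih (by omega); have := step i h0; push_cast; omega
  have lo : ∀ (j : ℕ) (hj : j < n), (j : ℤ) + 1 ≤ p ⟨n - 1 - j, by omega⟩ := by
    intro j
    induction j with
    | zero =>
      intro h0
      have := h ⟨n - 1 - 0, by omega⟩
      rw [asc_touch _ (by simp; omega)] at this
      push_cast; omega
    | succ j ih =>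
      intro h0
      have h1 := ih (by omega)
      have h2 := step (n - 1 - (j + 1)) (by omega)
      have h3 : (⟨n - 1 - (j + 1) + 1, by omega⟩ : Fin n) = ⟨n - 1 - j, by omega⟩ := by ext; simp; omega
      rw [h3] at h2
      push_cast; omega
  ext i
  have h1 := up i i.2
  have h2 := lo (n - 1 - i) (by have := i.2; omega)
  have h3 : (⟨n - 1 - (n - 1 - i), by have := i.2; omega⟩ : Fin n) = i := by ext; simp; have := i.2; omega
  rw [h3] at h2
  have := i.2
  simp only [Fin.eta] at h1
  rw [start]; omega

lemma exists_desc {p : Fin n → ℤ} (hp : Gen p) (h : p ≠ start n) : ∃ i, ¬ asc i p := by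
  by_contra h1; push Not at h1; exact h (eq_start hp h1)

lemma inv_eq_zero {p : Fin n → ℤ} (hp : Gen p) (h : inv p = 0) : p = start n := by
  by_contra h1
  obtain ⟨i, hi⟩ := exists_desc hp h1
  have := inv_desc hp i hi
  have := inv_nonneg (act i p)
  omega

lemma inv_le {p : Fin n → ℤ} (hp : Gen p) : inv p ≤ n ^ 2 := by
  have := inv_neg hp; have := inv_nonneg (-p); omega

lemma inv_top {p : Fin n → ℤ} (hp : Gen p) : inv p = n ^ 2 ↔ p = - start n := by
  constructor
  · intro h
    have := inv_eq_zero hp.neg (by rw [inv_neg hp]; omega)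
    rw [← this, neg_neg]
  · rintro rfl
    rw [inv_neg gen_start, inv_start]; ring

lemma inv_run_le {p : Fin n → ℤ} (hp : Gen p) (u) : inv (run u p) ≤ inv p + u.length := by
  induction u generalizing p with
  | nil => simp [run_nil]
  | cons i u ih =>
    rw [run_cons]
    have := ih (hp.act i)
    have h2 : inv (act i p) ≤ inv p + 1 := by
      by_cases h : asc i p
      · rw [inv_asc _ _ h]
      · rw [inv_desc hp _ h]; omega
    push_cast [List.length_cons]; omega

lemma path_iff {p : Fin n → ℤ} (hp : Gen p) (u) : path u p ↔ inv (run u p) = inv p + u.length := by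
  induction u generalizing p with
  | nil => simp [run_nil, path]
  | cons i u ih =>
    rw [run_cons, path, ih (hp.act i)]
    by_cases h : asc i p
    · rw [inv_asc _ _ h]; simp only [h, true_and, List.length_cons]; push_cast; constructor <;> intro <;> omega
    · simp only [h, false_and, false_iff]
      have := inv_run_le (hp.act i) u
      rw [inv_desc hp _ h] at this
      push_cast [List.length_cons]; omega

/-- the set of reduced words of the longest element, combinatorially -/
def RW (n : ℕ) : Set (List (Fin n)) := {ω | ω.length = n ^ 2 ∧ path ω (start n)}

lemma mem_RW (ω : List (Fin n)) : ω ∈ RW n ↔ ω.length = n ^ 2 ∧ run ω (start n) = - start n := by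
  refine and_congr_right fun h => ?_
  rw [path_iff gen_start, inv_start, ← inv_top (gen_start.run ω), h]
  push_cast; simp

/-- change of labels attached to a letter -/
def gch (n : ℕ) (i : Fin n) : Equiv.Perm ℤ :=
  if h : (i : ℕ) + 1 < n then Equiv.swap (start n i) (start n ⟨i + 1, h⟩) *
    Equiv.swap (-start n i) (-start n ⟨i + 1, h⟩) else Equiv.swap (start n i) (-start n i)

lemma start_pos (i : Fin n) : 0 < start n i := by have := i.2; rw [start]; omega

lemma gch_odd (i : Fin n) (x : ℤ) : gch n i (-x) = - gch n i x := by
  unfold gch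
  have h1 := start_pos i
  split_ifs with h
  · have h2 := start_pos ⟨i + 1, h⟩
    simp only [Equiv.Perm.mul_apply, Equiv.swap_apply_def]
    split_ifs <;> omega
  · simp only [Equiv.swap_apply_def]
    split_ifs <;> omega

lemma gch_gch (i : Fin n) (x : ℤ) : gch n i (gch n i x) = x := by
  unfold gch
  have h1 := start_pos i
  split_ifs with h
  · have h2 := start_pos ⟨i + 1, h⟩
    simp only [Equiv.Perm.mul_apply, Equiv.swap_apply_def]
    split_ifs <;> omega
  · simp only [Equiv.swap_apply_def]
    split_ifs <;> omega

lemma start_inj (i j : Fin n) : start n i = start n j ↔ i = j := by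
  constructor
  · intro h; rw [start, start] at h; ext; omega
  · rintro rfl; rfl

lemma act_start (i : Fin n) : act i (start n) = gch n i ∘ start n := by
  ext j
  have h1 := start_pos i
  have h2 := start_pos j
  unfold gch
  split_ifs with h
  · have h3 := start_pos ⟨i + 1, h⟩
    rw [act_swap i h]
    simp only [Function.comp, Equiv.Perm.mul_apply, Equiv.swap_apply_def]
    have a1 := start_inj j i
    have a2 := start_inj j ⟨i + 1, h⟩
    by_cases c1 : j = i
    · simp [c1]; split_ifs <;> omega
    · by_cases c2 : j = ⟨i + 1, h⟩
      · rw [if_neg c1, if_pos c2, c2]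
        split_ifs <;> omega
      · rw [if_neg c1, if_neg c2]
        split_ifs <;> omega
  · rw [act_touch i h]
    simp only [Function.comp, Equiv.swap_apply_def]
    have a1 := start_inj j i
    by_cases c1 : j = i
    · subst c1; simp
    · rw [Function.update_of_ne c1]; split_ifs <;> omega

lemma RW_rotate_one (ω : List (Fin n)) (h : ω ∈ RW n) : ω.rotate 1 ∈ RW n := by
  rw [mem_RW] at h ⊢
  refine ⟨by simpa using h.1, ?_⟩
  cases ω with
  | nil => simpa using h.2
  | cons i u =>
    simp only [List.rotate_cons_succ, List.rotate_zero]
    have h1 := h.2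
    rw [run_cons, act_start, run_comp _ _ (gch_odd i)] at h1
    have h2 : run u (start n) = - (gch n i ∘ start n) := by
      ext j
      have := congrFun h1 j
      simp only [Function.comp, Pi.neg_apply] at this ⊢
      rw [← gch_odd, ← this, gch_gch]
    rw [run_append, h2, run_cons, run_nil, act_neg, ← act_start, act_act]

lemma RW_rotate (ω : List (Fin n)) (h : ω ∈ RW n) (d : ℕ) : ω.rotate d ∈ RW n := by
  induction d with
  | zero => simpa using h
  | succ d ih => rw [← List.rotate_rotate]; exact RW_rotate_one _ ih

end BnCSP

namespace BnCSP

/-! ### braid relations for states -/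

section
variable {n : ℕ}

lemma act_val (i : ℕ) (hi : i + 1 < n) (p : Fin n → ℤ) (j : ℕ) (hj : j < n) :
    act ⟨i, by omega⟩ p ⟨j, hj⟩ = if j = i then p ⟨i + 1, hi⟩ else if j = i + 1 then p ⟨i, by omega⟩
      else p ⟨j, hj⟩ := by
  rw [act_swap _ hi]
  simp only [Function.comp, Equiv.swap_apply_def, Fin.ext_iff]
  split_ifs <;> simp_all

lemma act_val_last (i : ℕ) (hi : i + 1 = n) (p : Fin n → ℤ) (j : ℕ) (hj : j < n) :
    act ⟨i, by omega⟩ p ⟨j, hj⟩ = if j = i then -p ⟨i, by omega⟩ else p ⟨j, hj⟩ := by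
  rw [act_touch _ (by simp; omega), Function.update_apply]
  simp only [Fin.ext_iff]

lemma asc_val (i : ℕ) (hi : i + 1 < n) (p : Fin n → ℤ) :
    asc ⟨i, by omega⟩ p ↔ p ⟨i + 1, hi⟩ < p ⟨i, by omega⟩ := asc_swap _ hi p

lemma asc_val_last (i : ℕ) (hi : i + 1 = n) (p : Fin n → ℤ) :
    asc ⟨i, by omega⟩ p ↔ 0 < p ⟨i, by omega⟩ := asc_touch _ (by simp; omega) p

lemma act_comm (i j : ℕ) (hij : i + 2 ≤ j) (hj : j < n) (p : Fin n → ℤ) :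
    act ⟨i, by omega⟩ (act ⟨j, hj⟩ p) = act ⟨j, hj⟩ (act ⟨i, by omega⟩ p) ∧
    (asc ⟨j, hj⟩ (act ⟨i, by omega⟩ p) ↔ asc ⟨j, hj⟩ p) ∧
    (asc ⟨i, by omega⟩ (act ⟨j, hj⟩ p) ↔ asc ⟨i, by omega⟩ p) := by
  have hi : i + 1 < n := by omega
  rcases Nat.lt_or_ge (j + 1) n with h | h
  · refine ⟨?_, ?_, ?_⟩
    · ext ⟨l, hl⟩
      simp only [act_val i hi, act_val j h]
      split_ifs <;> first | omega | rfl
    · simp only [asc_val j h, act_val i hi]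
      split_ifs <;> first | omega | rfl
    · simp only [asc_val i hi, act_val j h]
      split_ifs <;> first | omega | rfl
  · have h : j + 1 = n := by omega
    refine ⟨?_, ?_, ?_⟩
    · ext ⟨l, hl⟩
      simp only [act_val i hi, act_val_last j h]
      split_ifs <;> first | omega | rfl
    · simp only [asc_val_last j h, act_val i hi]
      split_ifs <;> first | omega | rfl
    · simp only [asc_val i hi, act_val_last j h]
      split_ifs <;> first | omega | rfl

lemma act_braid3 (i : ℕ) (hi : i + 2 < n) (p : Fin n → ℤ) :
    run [⟨i, by omega⟩, ⟨i + 1, by omega⟩, ⟨i, by omega⟩] p =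
      run [⟨i + 1, by omega⟩, ⟨i, by omega⟩, ⟨i + 1, by omega⟩] p ∧
    (path [⟨i, by omega⟩, ⟨i + 1, by omega⟩, ⟨i, by omega⟩] p ↔
      path [⟨i + 1, by omega⟩, ⟨i, by omega⟩, ⟨i + 1, by omega⟩] p) := by
  constructor
  · ext ⟨l, hl⟩
    simp only [run_cons, run_nil, act_val i (show i + 1 < n by omega), act_val (i + 1) hi]
    split_ifs <;> first | omega | rfl | (congr 2; omega)
  · simp only [path, asc_val i (show i + 1 < n by omega), asc_val (i + 1) hi,
      act_val i (show i + 1 < n by omega), act_val (i + 1) hi]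
    simp
    constructor <;> intro <;> omega

lemma act_braid4 (i : ℕ) (hi : i + 2 = n) (p : Fin n → ℤ) :
    run [⟨i, by omega⟩, ⟨i + 1, by omega⟩, ⟨i, by omega⟩, ⟨i + 1, by omega⟩] p =
      run [⟨i + 1, by omega⟩, ⟨i, by omega⟩, ⟨i + 1, by omega⟩, ⟨i, by omega⟩] p ∧
    (path [⟨i, by omega⟩, ⟨i + 1, by omega⟩, ⟨i, by omega⟩, ⟨i + 1, by omega⟩] p ↔
      path [⟨i + 1, by omega⟩, ⟨i, by omega⟩, ⟨i + 1, by omega⟩, ⟨i, by omega⟩] p) := by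
  constructor
  · ext ⟨l, hl⟩
    simp only [run_cons, run_nil, act_val i (show i + 1 < n by omega), act_val_last (i + 1) (show i + 1 + 1 = n from hi)]
    split_ifs <;> first | omega | rfl | (congr 2; omega)
  · simp only [path, asc_val i (show i + 1 < n by omega), asc_val_last (i + 1) (show i + 1 + 1 = n from hi),
      act_val i (show i + 1 < n by omega), act_val_last (i + 1) (show i + 1 + 1 = n from hi)]
    simp
    constructor <;> intro <;> omega

lemma not_path_sq (i : Fin n) (p : Fin n → ℤ) : ¬ path [i, i] p := by
  simp only [path]
  by_cases h : (i : ℕ) + 1 < n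
  · rw [asc_swap i h, asc_swap i h, act_swap i h]
    simp; intro; omega
  · rw [asc_touch i h, asc_touch i h, act_touch i h]
    simp; intro; omega

/-! ### the nil-Coxeter operators -/

open Classical in
/-- the operator of a letter -/
noncomputable def TT (i : Fin n) : Module.End ℚ ((Fin n → ℤ) → ℚ) where
  toFun f p := if asc i p then f (act i p) else 0
  map_add' f g := by ext p; simp only [Pi.add_apply]; split_ifs <;> simp
  map_smul' c f := by ext p; simp only [Pi.smul_apply]; split_ifs <;> simp

/-- the operator of a word -/
noncomputable def TW (ω : List (Fin n)) : Module.End ℚ ((Fin n → ℤ) → ℚ) := (ω.map TT).prod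

open Classical in
lemma TW_apply (ω : List (Fin n)) (f : (Fin n → ℤ) → ℚ) (p) :
    TW ω f p = if path ω p then f (run ω p) else 0 := by
  induction ω generalizing p with
  | nil => simp [TW, path, run_nil]
  | cons i u ih =>
    have : TW (i :: u) f p = if asc i p then TW u f (act i p) else 0 := by
      simp only [TW, List.map_cons, List.prod_cons, Module.End.mul_apply]
      simp only [TT, LinearMap.coe_mk, AddHom.coe_mk]
    rw [this, ih, run_cons, path]
    by_cases h : asc i p <;> simp [h]

lemma TW_append (u v : List (Fin n)) : TW (u ++ v) = TW u * TW v := by simp [TW]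

lemma TW_singleton (i : Fin n) : TW [i] = TT i := by simp [TW]

lemma TW_congr (u v : List (Fin n)) (h : ∀ p, run u p = run v p ∧ (path u p ↔ path v p)) :
    TW u = TW v := by
  refine LinearMap.ext fun f => funext fun p => ?_
  rw [TW_apply, TW_apply, (h p).1]
  by_cases hp : path v p
  · rw [if_pos ((h p).2.mpr hp), if_pos hp]
  · rw [if_neg (fun h' => hp ((h p).2.mp h')), if_neg hp]

open Classical in
/-- the functional -/
noncomputable def tau (n : ℕ) : Module.End ℚ ((Fin n → ℤ) → ℚ) →ₗ[ℚ] ℚ where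
  toFun Z := Z (fun q => if q = -start n then 1 else 0) (start n)
  map_add' _ _ := rfl
  map_smul' _ _ := rfl

open Classical in
lemma tau_TW (ω : List (Fin n)) : tau n (TW ω) = if ω ∈ RW n then 1 else 0 := by
  have : tau n (TW ω) = TW ω (fun q => if q = -start n then 1 else 0) (start n) := rfl
  rw [this, TW_apply, ← ite_and]
  congr 1
  rw [eq_iff_iff, path_iff gen_start, mem_RW, inv_start, zero_add, and_congr_left_iff]
  intro h
  rw [h, (inv_top gen_start.neg).mpr rfl]
  constructor <;> intro h2 <;> exact_mod_cast h2.symm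

lemma tau_comm (u v : List (Fin n)) : tau n (TW u * TW v) = tau n (TW v * TW u) := by
  rw [← TW_append, ← TW_append, tau_TW, tau_TW]
  congr 1
  rw [eq_iff_iff]
  constructor <;> intro h
  · have := RW_rotate _ h u.length
    rwa [List.rotate_append_length_eq] at this
  · have := RW_rotate _ h v.length
    rwa [List.rotate_append_length_eq] at this

end

section
variable (k : ℕ)

/-- reindexed operators -/
noncomputable def UU (j : ℕ) : Module.End ℚ ((Fin (k + 1) → ℤ) → ℚ) :=
  if j ≤ k then TT ⟨k - j, by omega⟩ else 0

lemma UU_TW (j : ℕ) (hj : j ≤ k) (a : ℕ) (ha : a + j = k) :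
    UU k j = TW [⟨a, by omega⟩] := by
  rw [UU, if_pos hj, TW_singleton]; congr 2; omega

lemma nil_UU : Nil (UU k) where
  sq i := by
    by_cases h : i ≤ k
    · rw [UU_TW k i h (k - i) (by omega), ← TW_append]
      refine LinearMap.ext fun f => funext fun p => ?_
      rw [TW_apply, List.singleton_append, if_neg (not_path_sq _ p)]; rfl
    · rw [UU, if_neg h, mul_zero]
  comm i j hij := by
    by_cases h : j ≤ k
    · rw [UU_TW k i (by omega) (k - i) (by omega), UU_TW k j h (k - j) (by omega), ← TW_append, ← TW_append]
      apply TW_congr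
      intro p
      obtain ⟨h1, h2, h3⟩ := act_comm (n := k + 1) (k - j) (k - i) (by omega) (by omega) p
      simp only [List.singleton_append, run_cons, run_nil, path, h1, h2, h3, true_and, and_true]
      exact and_comm
    · simp [UU, if_neg h]
  braid3 i := by
    by_cases h : i + 2 ≤ k
    · have e1 := UU_TW k (i + 1) (by omega) (k - (i + 2) + 1) (by omega)
      have e2 := UU_TW k (i + 2) (by omega) (k - (i + 2)) (by omega)
      rw [e1, e2]
      simp only [← TW_append]
      apply TW_congr
      intro p
      have := act_braid3 (n := k + 1) (k - (i + 2)) (by omega) p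
      exact ⟨this.1.symm, this.2.symm⟩
    · have : UU k (i + 2) = 0 := by rw [UU, if_neg h]
      simp [this]
  braid4 := by
    by_cases h : 1 ≤ k
    · have e1 := UU_TW k 0 (by omega) (k - 1 + 1) (by omega)
      have e2 := UU_TW k 1 (by omega) (k - 1) (by omega)
      rw [e1, e2]
      simp only [← TW_append]
      apply TW_congr
      intro p
      have := act_braid4 (n := k + 1) (k - 1) (by omega) p
      exact ⟨this.1.symm, this.2.symm⟩
    · have : UU k 1 = 0 := by rw [UU, if_neg h]
      simp [this]

lemma adjoin_UU (Z : Module.End ℚ ((Fin (k + 1) → ℤ) → ℚ)) (hZ : Z ∈ Algebra.adjoin ℚ (Set.range (UU k))) :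
    Z ∈ Submodule.span ℚ (Set.range (TW (n := k + 1))) := by
  rw [← Subalgebra.mem_toSubmodule, Algebra.adjoin_eq_span] at hZ
  refine (Submodule.span_le.mpr ?_) hZ
  intro M hM
  obtain ⟨l, hl, rfl⟩ := Submonoid.exists_list_of_mem_closure hM
  clear hM hZ
  suffices l.prod = 0 ∨ ∃ ω, l.prod = TW ω by
    rcases this with h | ⟨ω, h⟩
    · rw [h]; exact Submodule.zero_mem _
    · rw [h]; exact Submodule.subset_span ⟨ω, rfl⟩
  induction l with
  | nil => exact Or.inr ⟨[], by simp [TW]⟩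
  | cons x l ih =>
    rw [List.prod_cons]
    rcases ih (fun y hy => hl y (List.mem_cons_of_mem _ hy)) with h | ⟨ω, h⟩
    · left; rw [h, mul_zero]
    · obtain ⟨j, rfl⟩ := hl x List.mem_cons_self
      by_cases hj : j ≤ k
      · right; rw [UU_TW k j hj (k - j) (by omega), h, ← TW_append]; exact ⟨_, rfl⟩
      · left; rw [UU, if_neg hj, zero_mul]

lemma traceOn_UU : TraceOn (UU k) (tau (k + 1)) where
  comm Z hZ W hW := by
    have h1 := adjoin_UU k Z hZ
    have h2 := adjoin_UU k W hW
    clear hZ hW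
    induction h1 using Submodule.span_induction with
    | mem x hx =>
      obtain ⟨u, rfl⟩ := hx
      induction h2 using Submodule.span_induction with
      | mem y hy => obtain ⟨v, rfl⟩ := hy; exact tau_comm u v
      | zero => simp
      | add a b _ _ ha hb => rw [mul_add, add_mul, map_add, map_add, ha, hb]
      | smul c a _ ha => rw [mul_smul_comm, smul_mul_assoc, map_smul, map_smul, ha]
    | zero => simp
    | add a b _ _ ha hb => rw [mul_add, add_mul, map_add, map_add, ha, hb]
    | smul c a _ ha => rw [mul_smul_comm, smul_mul_assoc, map_smul, map_smul, ha]

lemma Bp_coeff_one {E : Type*} [Ring E] [Algebra ℚ E] (U : ℕ → E) (m : ℕ) :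
    (Bp U m).coeff 1 = ∑ j ∈ Finset.range m, U (j + 1) := by
  have h0 : ∀ m, (Bp U m).coeff 0 = 1 := by
    intro m
    induction m with
    | zero => simp [Bp]
    | succ m ih => rw [Bp, coeff_lin_mul, ih]; simp
  induction m with
  | zero => simp [Bp, Polynomial.coeff_one]
  | succ m ih => rw [Bp, coeff_lin_mul, ih, Finset.sum_range_succ, if_neg one_ne_zero, Nat.sub_self, h0, mul_one]

lemma Ap_one : (Ap (UU k) (k + 1)).coeff 1 = ∑ i : Fin (k + 1), TT i := by
  have h0 : ∀ m, (Bp (UU k) m).coeff 0 = 1 := by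
    intro m
    induction m with
    | zero => simp [Bp]
    | succ m ih => rw [Bp, coeff_lin_mul, ih]; simp
  rw [Ap, coeff_mul_lin, if_neg one_ne_zero, Bp_coeff_one, Nat.sub_self, h0, one_mul,
    ← Finset.sum_range_succ', Finset.sum_range_succ, UU, if_neg (by omega), add_zero,
    ← Finset.sum_range_reflect, Finset.sum_range]
  refine Finset.sum_congr rfl fun i _ => ?_
  rw [UU, if_pos (by omega)]
  congr 1; ext; simp; omega

/-- a long word -/
def wl : ℕ → List (Fin (k + 1))
  | 0 => [Fin.last k]
  | m + 1 => ⟨k - (m + 1), by omega⟩ :: wl m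

lemma wl_length (m : ℕ) : (wl k m).length = m + 1 := by
  induction m with
  | zero => rfl
  | succ m ih => rw [wl, List.length_cons, ih]

lemma Bp_top (m : ℕ) (hm : m ≤ k) : (Bp (UU k) m).coeff m * UU k 0 = TW (wl k m) := by
  induction m with
  | zero =>
    rw [Bp, wl, UU_TW k 0 (by omega) k (by omega)]; simp; rfl
  | succ m ih =>
    rw [Bp, coeff_lin_mul, if_neg (by omega), Nat.add_sub_cancel, add_mul, mul_assoc, ih (by omega),
      UU_TW k (m + 1) hm (k - (m + 1)) (by omega), ← TW_append,
      Polynomial.coeff_eq_zero_of_natDegree_lt (by have := Bp_natDegree (U := UU k) m; omega)]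
    simp [wl]

lemma Ap_top : (Ap (UU k) (k + 1)).coeff (k + 1) = TW (wl k k) := by
  have : Bp (UU k) (k + 1) = Bp (UU k) k := by rw [Bp, UU, if_neg (by omega)]; simp
  rw [Ap, coeff_mul_lin, this, if_neg (by omega), Nat.add_sub_cancel, Bp_top k k le_rfl,
    Polynomial.coeff_eq_zero_of_natDegree_lt (by have := Bp_natDegree (U := UU k) k; omega), zero_add]

lemma run_wl (m : ℕ) (hm : m ≤ k) (p : Fin (k + 1) → ℤ) (j : ℕ) (hj : j < k + 1) :
    run (wl k m) p ⟨j, hj⟩ = if h : j < k - m then p ⟨j, hj⟩ else if h : j < k then p ⟨j + 1, by omega⟩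
      else -p ⟨k - m, by omega⟩ := by
  induction m generalizing p with
  | zero =>
    rw [wl, run_cons, run_nil]
    have := act_val_last (n := k + 1) k rfl p j hj
    rw [show Fin.last k = ⟨k, by omega⟩ from rfl, this]
    split_ifs <;> first | omega | simp_all
  | succ m ih =>
    rw [wl, run_cons, ih (by omega)]
    simp only [act_val (n := k + 1) (k - (m + 1)) (by omega)]
    split_ifs <;> first | omega | rfl | (congr 2; omega) | (congr 3; omega)

lemma run_wl_pow (s : ℕ) (hs : s ≤ k + 1) (p : Fin (k + 1) → ℤ) (j : ℕ) (hj : j < k + 1) :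
    run (List.replicate s (wl k k)).flatten p ⟨j, hj⟩ =
      if h : j + s < k + 1 then p ⟨j + s, h⟩ else -p ⟨j + s - (k + 1), by omega⟩ := by
  induction s generalizing p with
  | zero => simp [run_nil, hj]
  | succ s ih =>
    rw [List.replicate_succ, List.flatten_cons, run_append, ih (by omega)]
    simp only [run_wl k k le_rfl]
    split_ifs <;> first | omega | rfl | (congr 2; omega) | (congr 3; omega)

lemma TW_pow {n : ℕ} (u : List (Fin n)) (s : ℕ) : TW u ^ s = TW (List.replicate s u).flatten := by
  induction s with
  | zero => simp [TW]
  | succ s ih => rw [List.replicate_succ, List.flatten_cons, TW_append, pow_succ', ih]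

lemma tau_top : tau (k + 1) ((Ap (UU k) (k + 1)).coeff (k + 1) ^ (k + 1)) = 1 := by
  rw [Ap_top, TW_pow, tau_TW, if_pos]
  rw [mem_RW]
  refine ⟨by simp [wl_length, sq], ?_⟩
  ext ⟨j, hj⟩
  rw [run_wl_pow k _ le_rfl, dif_neg (by omega)]
  simp

lemma sum_pow_words {n : ℕ} (N : ℕ) : (∑ i : Fin n, TT i) ^ N = ∑ u : Fin N → Fin n, TW (List.ofFn u) := by
  induction N with
  | zero => simp [TW]
  | succ N ih =>
    rw [pow_succ', ih, ← (Fin.consEquiv (fun _ => Fin n)).sum_comp, Fintype.sum_prod_type, Finset.sum_mul]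
    refine Finset.sum_congr rfl fun i _ => ?_
    rw [Finset.mul_sum]
    refine Finset.sum_congr rfl fun u _ => ?_
    simp [Fin.consEquiv, List.ofFn_succ, TW]

open Classical in
/-- the set of reduced words as functions -/
noncomputable def RF (n : ℕ) : Finset (Fin (n ^ 2) → Fin n) :=
  Finset.univ.filter fun u => List.ofFn u ∈ RW n

/-- **Part C**: the number of reduced words. -/
theorem card_RF : ((RF (k + 1)).card : ℤ) = chiOne k ((k + 1) ^ 2) := by
  have h := trace_main (nil_UU k) k (by rw [UU, if_neg (by omega)]) (tau (k + 1)) (traceOn_UU k)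
  rw [tau_top, mul_one, Ap_one, sum_pow_words, map_sum] at h
  simp only [tau_TW] at h
  rw [Finset.sum_boole] at h
  have h2 : (((RF (k + 1)).card : ℤ) : ℚ) = chiOne k ((k + 1) ^ 2) := by
    rw [← h, RF]; push_cast; congr
  exact_mod_cast h2

end

end BnCSP

namespace BnCSP

/-! ### Part D : wires -/

section
variable {n : ℕ}

/-- states along an infinite word -/
def st (w : ℕ → Fin n) : ℕ → Fin n → ℤ
  | 0 => start n
  | t + 1 => act (w t) (st w t)

/-- permutation part of a letter -/
def lp (i : Fin n) : Equiv.Perm (Fin n) :=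
  if h : (i : ℕ) + 1 < n then Equiv.swap i ⟨i + 1, h⟩ else 1

/-- positions of wires along an infinite word -/
def wp (w : ℕ → Fin n) : ℕ → Equiv.Perm (Fin n)
  | 0 => 1
  | t + 1 => lp (w t) * wp w t

/-- the other position of a letter -/
def nx (i : Fin n) : Fin n := if h : (i : ℕ) + 1 < n then ⟨i + 1, h⟩ else i

/-- wire moving up -/
def upN (w : ℕ → Fin n) (t : ℕ) : Fin n := (wp w t).symm (nx (w t))
/-- wire moving down -/
def dnN (w : ℕ → Fin n) (t : ℕ) : Fin n := (wp w t).symm (w t)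

lemma run_ofFn (w : ℕ → Fin n) (m : ℕ) : run (List.ofFn (fun i : Fin m => w i)) (start n) = st w m := by
  induction m with
  | zero => simp [run_nil, st]
  | succ m ih =>
    rw [List.ofFn_succ', List.concat_eq_append, run_append]
    simp only [Fin.val_castSucc, Fin.val_last]
    rw [ih]; rfl

lemma path_ofFn (w : ℕ → Fin n) (m : ℕ) : path (List.ofFn (fun i : Fin m => w i)) (start n) ↔
    ∀ t < m, asc (w t) (st w t) := by
  induction m with
  | zero => simp [path]
  | succ m ih =>
    rw [List.ofFn_succ', List.concat_eq_append, path_append]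
    simp only [Fin.val_castSucc, Fin.val_last]
    rw [ih, run_ofFn]
    simp only [path, and_true]
    constructor
    · rintro ⟨h1, h2⟩ t ht
      rcases Nat.lt_succ_iff_lt_or_eq.mp ht with h | rfl
      · exact h1 t h
      · exact h2
    · intro h
      exact ⟨fun t ht => h t (by omega), h m (by omega)⟩

lemma st_gen (w : ℕ → Fin n) (t : ℕ) : Gen (st w t) := by
  induction t with
  | zero => exact gen_start
  | succ t ih => exact ih.act _

/-- signed value of a wire -/
def sv (w : ℕ → Fin n) (t : ℕ) (i : Fin n) : ℤ := st w t (wp w t i)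

lemma sv_zero (w : ℕ → Fin n) (i : Fin n) : sv w 0 i = start n i := rfl

lemma sv_succ (w : ℕ → Fin n) (t : ℕ) (i : Fin n) :
    sv w (t + 1) i = if ¬ ((w t : ℕ) + 1 < n) ∧ wp w t i = w t then - sv w t i else sv w t i := by
  simp only [sv, st, wp, lp]
  by_cases h : (w t : ℕ) + 1 < n
  · rw [act_swap _ h, dif_pos h]; simp [h]
  · rw [act_touch _ h, dif_neg h]
    simp only [one_mul, h, not_false_eq_true, true_and]
    by_cases h2 : wp w t i = w t
    · simp [h2]
    · simp [h2]

lemma sv_abs (w : ℕ → Fin n) (t : ℕ) (i : Fin n) : |sv w t i| = start n i := by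
  induction t with
  | zero => rw [sv_zero, abs_of_pos (start_pos i)]
  | succ t ih =>
    rw [sv_succ]; split_ifs
    · rw [abs_neg, ih]
    · exact ih

/-- a monotone unit step function takes each step exactly once -/
lemma step_once (f : ℕ → ℤ) (N : ℕ) (h : ∀ t < N, f (t + 1) = f t ∨ f (t + 1) = f t + 1) (c : ℤ)
    (h0 : f 0 ≤ c) (hN : c < f N) : ∃ t < N, f t = c ∧ f (t + 1) = c + 1 := by
  induction N with
  | zero => omega
  | succ N ih =>
    by_cases hc : c < f N
    · obtain ⟨t, ht, h1⟩ := ih (fun t ht => h t (by omega)) hc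
      exact ⟨t, by omega, h1⟩
    · refine ⟨N, by omega, ?_⟩
      rcases h N (by omega) with h1 | h1 <;> omega

lemma step_mono (f : ℕ → ℤ) (N : ℕ) (h : ∀ t < N, f (t + 1) = f t ∨ f (t + 1) = f t + 1)
    (s t : ℕ) (hst : s ≤ t) (ht : t ≤ N) : f s ≤ f t := by
  induction t with
  | zero => rw [Nat.le_zero.mp hst]
  | succ t ih =>
    rcases Nat.lt_or_ge s (t + 1) with h1 | h1
    · have := ih (by omega) (by omega)
      rcases h t (by omega) with h2 | h2 <;> omega
    · rw [le_antisymm hst h1]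

/-- phase of a pair of wires -/
def ph (w : ℕ → Fin n) (i k : Fin n) (t : ℕ) : ℤ :=
  if 0 < sv w t i then (if wp w t i < wp w t k then 0 else 1)
  else (if wp w t k < wp w t i then 2 else 3)

lemma lp_val (s : Fin n) (j : Fin n) (h : (s : ℕ) + 1 < n) :
    ((lp s j : Fin n) : ℕ) = if (j : ℕ) = s then (s : ℕ) + 1 else if (j : ℕ) = s + 1 then (s : ℕ) else j := by
  rw [lp, dif_pos h, Equiv.swap_apply_def]
  simp only [Fin.ext_iff]
  split_ifs <;> rfl

lemma upN_eq (w : ℕ → Fin n) (t : ℕ) (i : Fin n) : upN w t = i ↔ nx (w t) = wp w t i := by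
  rw [upN, Equiv.symm_apply_eq]

lemma dnN_eq (w : ℕ → Fin n) (t : ℕ) (i : Fin n) : dnN w t = i ↔ w t = wp w t i := by
  rw [dnN, Equiv.symm_apply_eq]

lemma nx_val (s : Fin n) (h : (s : ℕ) + 1 < n) : ((nx s : Fin n) : ℕ) = s + 1 := by rw [nx, dif_pos h]
lemma nx_val' (s : Fin n) (h : ¬ (s : ℕ) + 1 < n) : nx s = s := by rw [nx, dif_neg h]

lemma ph_step (w : ℕ → Fin n) (i k : Fin n) (hik : i < k) (t : ℕ) (ha : asc (w t) (st w t)) :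
    ((upN w t = k ∧ dnN w t = i) ∧ ph w i k t = 0 ∧ ph w i k (t + 1) = 1) ∨
    ((upN w t = i ∧ dnN w t = i) ∧ ph w i k t = 1 ∧ ph w i k (t + 1) = 2) ∨
    ((upN w t = i ∧ dnN w t = k) ∧ ph w i k t = 2 ∧ ph w i k (t + 1) = 3) ∨
    ((¬ (upN w t = k ∧ dnN w t = i) ∧ ¬ (upN w t = i ∧ dnN w t = i) ∧ ¬ (upN w t = i ∧ dnN w t = k) ∧
      ((upN w t = k ∧ dnN w t = k) → ph w i k t = 0 ∨ ph w i k t = 3)) ∧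
      ph w i k (t + 1) = ph w i k t) := by
  simp only [upN_eq, dnN_eq]
  have hne : wp w t i ≠ wp w t k := fun h => hik.ne ((wp w t).injective h)
  rw [ne_eq, Fin.ext_iff] at hne
  have vi := sv_abs w t i
  have vk := sv_abs w t k
  have hs : start n k < start n i := by rw [Fin.lt_def] at hik; simp only [start]; omega
  have pk := start_pos k
  by_cases h : (w t : ℕ) + 1 < n
  · rw [asc_swap _ h] at ha
    have e1 : sv w (t + 1) i = sv w t i := by rw [sv_succ, if_neg]; tauto
    have l1 := lp_val (w t) (wp w t i) h
    have l2 := lp_val (w t) (wp w t k) h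
    have l3 := nx_val (w t) h
    simp only [ph, e1, wp, Equiv.Perm.mul_apply, Fin.lt_def, Fin.ext_iff, l1, l2, l3]
    have a1 : ((wp w t i : Fin n) : ℕ) = (w t : ℕ) → ((wp w t k : Fin n) : ℕ) = (w t : ℕ) + 1 → sv w t k < sv w t i := by
      intro b1 b2
      have c1 : wp w t i = w t := Fin.ext b1
      have c2 : wp w t k = ⟨(w t : ℕ) + 1, h⟩ := Fin.ext b2
      rw [sv, sv, c1, c2]; exact ha
    have a2 : ((wp w t k : Fin n) : ℕ) = (w t : ℕ) → ((wp w t i : Fin n) : ℕ) = (w t : ℕ) + 1 → sv w t i < sv w t k := by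
      intro b1 b2
      have c1 : wp w t k = w t := Fin.ext b1
      have c2 : wp w t i = ⟨(w t : ℕ) + 1, h⟩ := Fin.ext b2
      rw [sv, sv, c1, c2]; exact ha
    generalize sv w t i = x at *
    generalize sv w t k = y at *
    generalize ((wp w t i : Fin n) : ℕ) = p at *
    generalize ((wp w t k : Fin n) : ℕ) = q at *
    generalize ((w t : Fin n) : ℕ) = s at *
    by_cases c1 : p = s ∧ q = s + 1
    · have := a1 c1.1 c1.2
      have hx : 0 < x := by
        rcases abs_cases x with h1 | h1 <;> rcases abs_cases y with h2 | h2 <;> omega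
      left; simp [hx, c1.1, c1.2]
    · by_cases c2 : q = s ∧ p = s + 1
      · have := a2 c2.1 c2.2
        have hx : ¬ 0 < x := by
          rcases abs_cases x with h1 | h1 <;> rcases abs_cases y with h2 | h2 <;> omega
        right; right; left; simp [hx, c2.1, c2.2]
      · right; right; right
        refine ⟨⟨by omega, by omega, by omega, by omega⟩, ?_⟩
        split_ifs <;> omega
  · rw [asc_touch _ h] at ha
    have e1 := sv_succ w t i
    simp only [h, not_false_eq_true, true_and] at e1
    have l1 : lp (w t) = 1 := by rw [lp, dif_neg h]
    simp only [ph, e1, wp, l1, one_mul, Fin.lt_def, nx_val' _ h, Fin.ext_iff]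
    have a1 : ((wp w t i : Fin n) : ℕ) = (w t : ℕ) → 0 < sv w t i := by
      intro b1
      have c1 : wp w t i = w t := Fin.ext b1
      rw [sv, c1]; exact ha
    have b1 := (wp w t i).2
    have b2 := (wp w t k).2
    generalize sv w t i = x at *
    generalize ((wp w t i : Fin n) : ℕ) = p at *
    generalize ((wp w t k : Fin n) : ℕ) = q at *
    generalize ((w t : Fin n) : ℕ) = s at *
    by_cases c1 : p = s
    · have hx := a1 c1
      right; left
      have h3 : ¬ p < q := by omega
      have h4 : q < p := by omega
      have h5 : ¬ x < 0 := by omega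
      simp [hx, h3, h4, h5, c1]; omega
    · right; right; right
      refine ⟨⟨by omega, by omega, by omega, fun h2 => ?_⟩, ?_⟩
      · split_ifs <;> omega
      · split_ifs <;> omega

/-- wire data -/
structure WD {N : ℕ} (up dn : Fin N → Fin n) (Z : Fin n → Fin N) : Prop where
  touch : ∀ i τ, up τ = i ∧ dn τ = i ↔ τ = Z i
  cross : ∀ i k, i < k → ∃ α β, (∀ τ, up τ = k ∧ dn τ = i ↔ τ = α) ∧ (∀ τ, up τ = i ∧ dn τ = k ↔ τ = β) ∧
    α < Z i ∧ Z i < β ∧ (Z k < α ∨ β < Z k)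

lemma touch_step (w : ℕ → Fin n) (i : Fin n) (t : ℕ) (ha : asc (w t) (st w t)) :
    ((upN w t = i ∧ dnN w t = i) ∧ 0 < sv w t i ∧ sv w (t + 1) i < 0) ∨
    (¬ (upN w t = i ∧ dnN w t = i) ∧ sv w (t + 1) i = sv w t i) := by
  simp only [upN_eq, dnN_eq]
  by_cases h : (w t : ℕ) + 1 < n
  · right
    have l3 := nx_val (w t) h
    rw [sv_succ, if_neg (by tauto)]
    refine ⟨fun hh => ?_, rfl⟩
    have := congrArg Fin.val (hh.1.trans hh.2.symm)
    omega
  · rw [asc_touch _ h] at ha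
    rw [sv_succ, nx_val' _ h]
    by_cases c : wp w t i = w t
    · left
      rw [if_pos ⟨h, c⟩]
      have : 0 < sv w t i := by rw [sv, c]; exact ha
      exact ⟨⟨c.symm, c.symm⟩, this, by omega⟩
    · right
      rw [if_neg (by tauto)]
      exact ⟨fun h => c h.1.symm, rfl⟩

theorem wd_exists (w : ℕ → Fin n) (N : ℕ) (ha : ∀ t < N, asc (w t) (st w t)) (hN : st w N = - start n) :
    wp w N = 1 ∧ ∃ Z : Fin n → Fin N, WD (fun t : Fin N => upN w t) (fun t : Fin N => dnN w t) Z := by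
  have h1 : ∀ i, wp w N i = i := by
    intro i
    have := sv_abs w N i
    rw [sv, hN, Pi.neg_apply, abs_neg, abs_of_pos (start_pos _), start_inj] at this
    exact this
  have hsv : ∀ i, sv w N i < 0 := by
    intro i
    have := start_pos (wp w N i)
    rw [sv, hN, Pi.neg_apply]; omega
  refine ⟨Equiv.ext h1, ?_⟩
  have hZ : ∀ i, ∃ Z : Fin N, ∀ τ : Fin N, upN w τ = i ∧ dnN w τ = i ↔ τ = Z := by
    intro i
    set f : ℕ → ℤ := fun t => if sv w t i < 0 then 1 else 0 with hf
    have hs : ∀ t < N, f (t + 1) = f t ∨ f (t + 1) = f t + 1 := by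
      intro t ht
      simp only [hf]
      rcases touch_step w i t (ha t ht) with h | h
      · split_ifs <;> omega
      · rw [h.2]; left; rfl
    obtain ⟨t, ht, h2, h3⟩ := step_once f N hs 0 (by
      simp only [hf, sv_zero]; have := start_pos i; split_ifs <;> omega) (by
      simp only [hf]; rw [if_pos (hsv i)]; omega)
    refine ⟨⟨t, ht⟩, fun τ => ⟨fun h => ?_, fun h => ?_⟩⟩
    · rcases touch_step w i τ (ha τ τ.2) with h4 | h4
      · have h5 : f τ = 0 := by simp only [hf]; rw [if_neg]; omega
        have h6 : f (τ + 1) = 1 := by simp only [hf]; rw [if_pos]; omega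
        ext
        simp only
        by_contra hne
        rcases Nat.lt_or_gt_of_ne hne with h7 | h7
        · have := step_mono f N hs (τ + 1) t (by omega) (by omega); omega
        · have := step_mono f N hs (t + 1) τ (by omega) (by omega); omega
      · exact absurd h h4.1
    · subst h
      rcases touch_step w i t (ha t ht) with h4 | h4
      · exact h4.1
      · exfalso; simp only [hf] at h2 h3; rw [h4.2] at h3; omega
  choose Z hZ using hZ
  refine ⟨Z, ⟨fun i τ => hZ i τ, fun i k hik => ?_⟩⟩
  have hstep := fun t ht => ph_step w i k hik t (ha t ht)
  have f0 : ph w i k 0 = 0 := by simp [ph, sv_zero, start_pos, wp, hik]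
  have fN : ph w i k N = 3 := by
    rw [ph, if_neg (by have := hsv i; omega), h1, h1, if_neg (by simpa using hik.le)]
  generalize ph w i k = f at hstep f0 fN
  have hs : ∀ t < N, f (t + 1) = f t ∨ f (t + 1) = f t + 1 := by
    intro t ht
    rcases hstep t ht with h | h | h | h
    · right; rw [h.2.2, h.2.1]; rfl
    · right; rw [h.2.2, h.2.1]; rfl
    · right; rw [h.2.2, h.2.1]; rfl
    · left; exact h.2
  obtain ⟨α, hα, α1, α2⟩ := step_once f N hs 0 (by omega) (by omega)
  obtain ⟨β, hβ, β1, β2⟩ := step_once f N hs 2 (by omega) (by omega)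
  have mono := fun s t => step_mono f N hs s t
  have uniq : ∀ s t, s < N → t < N → f s = f t → f (s + 1) = f s + 1 → f (t + 1) = f t + 1 → s = t := by
    intro s t h1 h2 h3 h4 h5
    by_contra hne
    rcases Nat.lt_or_gt_of_ne hne with h7 | h7
    · have := mono (s + 1) t (by omega) (by omega); omega
    · have := mono (t + 1) s (by omega) (by omega); omega
  have αi : ∀ τ : Fin N, upN w τ = k ∧ dnN w τ = i ↔ τ = ⟨α, hα⟩ := by
    intro τ
    constructor
    · intro h
      have hk : i ≠ k := hik.ne
      rcases hstep τ τ.2 with h2 | h2 | h2 | h2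
      · exact Fin.ext <| uniq _ α τ.2 hα (by omega) (by omega) (by omega)
      · exact absurd (h2.1.1.symm.trans h.1) hk
      · exact absurd (h2.1.1.symm.trans h.1) hk
      · exact absurd h h2.1.1
    · rintro rfl
      rcases hstep α hα with h2 | h2 | h2 | h2 <;> first | exact h2.1 | omega
  have βi : ∀ τ : Fin N, upN w τ = i ∧ dnN w τ = k ↔ τ = ⟨β, hβ⟩ := by
    intro τ
    constructor
    · intro h
      have hk : i ≠ k := hik.ne
      rcases hstep τ τ.2 with h2 | h2 | h2 | h2
      · exact absurd (h.1.symm.trans h2.1.1) hk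
      · exact absurd (h2.1.2.symm.trans h.2) hk
      · exact Fin.ext <| uniq _ β τ.2 hβ (by omega) (by omega) (by omega)
      · exact absurd h h2.1.2.2.1
    · rintro rfl
      rcases hstep β hβ with h2 | h2 | h2 | h2 <;> first | exact h2.1 | omega
  have zi := (hZ i (Z i)).mpr rfl
  have zi1 : f (Z i) = 1 ∧ f (Z i + 1) = 2 := by
    have hk : i ≠ k := hik.ne
    rcases hstep (Z i) (Z i).2 with h2 | h2 | h2 | h2
    · exact absurd (zi.1.symm.trans h2.1.1) hk
    · exact h2.2
    · exact absurd (zi.2.symm.trans h2.1.2) hk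
    · exact absurd zi h2.1.2.1
  have zk := (hZ k (Z k)).mpr rfl
  have zk1 : f (Z k) = 0 ∧ f (Z k + 1) = 0 ∨ f (Z k) = 3 := by
    have hk : i ≠ k := hik.ne
    rcases hstep (Z k) (Z k).2 with h2 | h2 | h2 | h2
    · exact absurd (h2.1.2.symm.trans zk.2) hk
    · exact absurd (h2.1.2.symm.trans zk.2) hk
    · exact absurd (h2.1.1.symm.trans zk.1) hk
    · rcases h2.1.2.2.2 zk with h3 | h3
      · left; refine ⟨h3, ?_⟩; rw [h2.2]; exact h3
      · right; exact h3
  refine ⟨⟨α, hα⟩, ⟨β, hβ⟩, αi, βi, ?_, ?_, ?_⟩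
  · rw [Fin.lt_def]; by_contra hc
    have := mono (Z i) α (by simpa using hc) (by omega); omega
  · rw [Fin.lt_def]; by_contra hc
    have := mono β (Z i) (by simpa using hc) (by omega); omega
  · rcases zk1 with h | h
    · left; rw [Fin.lt_def]; by_contra hc
      have h3 : α ≤ (Z k : ℕ) := by simpa using hc
      rcases Nat.lt_or_ge α (Z k) with h4 | h4
      · have := mono (α + 1) (Z k) (by omega) (by omega); omega
      · have : α = (Z k : ℕ) := le_antisymm h3 h4
        rw [this] at α2; omega
    · right; rw [Fin.lt_def]; by_contra hc
      have := mono (Z k) β (by simpa using hc) (by omega); omega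

end

end BnCSP

namespace BnCSP

/-! ### Part E : independence -/

section
variable {n N : ℕ}

lemma WD.inj {up dn : Fin N → Fin n} {Z : Fin n → Fin N} (h : WD up dn Z) (s t : Fin N)
    (h1 : up s = up t) (h2 : dn s = dn t) : s = t := by
  rcases lt_trichotomy (up t) (dn t) with h3 | h3 | h3
  · obtain ⟨α, β, ha, hb, -⟩ := h.cross _ _ h3
    rw [(hb s).mp ⟨h1, h2⟩, (hb t).mp ⟨rfl, rfl⟩]
  · exact ((h.touch (up t) s).mp ⟨h1, h2.trans h3.symm⟩).trans ((h.touch (up t) t).mp ⟨rfl, h3.symm⟩).symm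
  · obtain ⟨α, β, ha, hb, -⟩ := h.cross _ _ h3
    rw [(ha s).mp ⟨h1, h2⟩, (ha t).mp ⟨rfl, rfl⟩]

lemma WD.surj {up dn : Fin N → Fin n} {Z : Fin n → Fin N} (h : WD up dn Z) (i k : Fin n) :
    ∃ t, up t = i ∧ dn t = k := by
  rcases lt_trichotomy i k with h3 | h3 | h3
  · obtain ⟨α, β, ha, hb, -⟩ := h.cross _ _ h3
    exact ⟨β, (hb β).mpr rfl⟩
  · subst h3; exact ⟨Z i, (h.touch i _).mpr rfl⟩
  · obtain ⟨α, β, ha, hb, -⟩ := h.cross _ _ h3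
    exact ⟨α, (ha α).mpr rfl⟩

/-- the pairing relation -/
def Edge (u w : Fin N → Fin n) : Prop := Function.Bijective (fun t => (u t, w t))

lemma WD.edge {up dn : Fin N → Fin n} {Z : Fin n → Fin N} (h : WD up dn Z) : Edge up dn := by
  constructor
  · intro s t hst
    simp only [Prod.mk.injEq] at hst
    exact h.inj s t hst.1 hst.2
  · rintro ⟨i, k⟩
    obtain ⟨t, h1, h2⟩ := h.surj i k
    exact ⟨t, by simp [h1, h2]⟩

lemma edge_lemma {up dn up' dn' : Fin N → Fin n} {Z Z' : Fin n → Fin N} (h : WD up dn Z)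
    (h' : WD up' dn' Z') (hE : Edge up dn') (j : Fin n) (hj : ∀ l < j, Z' l = Z l) (hlt : Z' j < Z j) :
    False := by
  have key : ∀ p : {p : Fin n × Fin n // p.1 ≤ j ∧ p.2 ≤ j ∧ Z' p.2 < Z p.1},
      ∃ q : {p : Fin n × Fin n // p.1 ≤ j ∧ p.2 ≤ j ∧ Z' p.2 < Z p.1},
        (q.1.2 < q.1.1 ∧ ∃ τ, up τ = p.1.1 ∧ dn' τ = p.1.2 ∧ up τ = q.1.1 ∧ dn τ = q.1.2) ∨
        (q.1.1 < q.1.2 ∧ ∃ τ, up τ = p.1.1 ∧ dn' τ = p.1.2 ∧ up' τ = q.1.1 ∧ dn' τ = q.1.2) := by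
    rintro ⟨⟨i, k⟩, hi, hk, hik⟩
    simp only at hi hk hik
    obtain ⟨τ, hτ⟩ := hE.2 (i, k)
    simp only [Prod.mk.injEq] at hτ
    obtain ⟨h1, h2⟩ := hτ
    by_cases hc : τ < Z i
    · rcases lt_trichotomy (dn τ) i with h3 | h3 | h3
      · obtain ⟨α, β, ha, hb, c1, c2, c3⟩ := h.cross _ _ h3
        have e1 := (ha τ).mp ⟨h1, rfl⟩
        have c4 : Z (dn τ) < Z i := by
          rcases c3 with c3 | c3
          · rw [← e1] at c3; exact absurd c3 (not_lt.mpr hc.le)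
          · exact c2.trans c3
        refine ⟨⟨(i, dn τ), hi, h3.le.trans hi, ?_⟩, Or.inl ⟨h3, τ, h1, h2, h1, rfl⟩⟩
        show Z' (dn τ) < Z i
        rw [hj _ (h3.trans_le hi)]; exact c4
      · have := (h.touch i τ).mp ⟨h1, h3⟩
        exact absurd hc (by rw [this]; exact lt_irrefl _)
      · obtain ⟨α, β, ha, hb, c1, c2, c3⟩ := h.cross _ _ h3
        have e1 := (hb τ).mp ⟨h1, rfl⟩
        rw [e1] at hc
        exact absurd (hc.trans c2) (lt_irrefl _)
    · rw [not_lt] at hc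
      have hc2 : Z' k < τ := hik.trans_le hc
      rcases lt_trichotomy (up' τ) k with h3 | h3 | h3
      · obtain ⟨α, β, ha, hb, c1, c2, c3⟩ := h'.cross _ _ h3
        have e1 := (hb τ).mp ⟨rfl, h2⟩
        have c4 : Z' k < Z' (up' τ) := by
          rcases c3 with c3 | c3
          · exact c3.trans c1
          · rw [← e1] at c3; exact absurd c3 (not_lt.mpr hc2.le)
        refine ⟨⟨(up' τ, k), h3.le.trans hk, hk, ?_⟩, Or.inr ⟨h3, τ, h1, h2, rfl, h2⟩⟩
        show Z' k < Z (up' τ)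
        rw [← hj _ (h3.trans_le hk)]; exact c4
      · have := (h'.touch k τ).mp ⟨h3, h2⟩
        exact absurd hc2 (by rw [this]; exact lt_irrefl _)
      · obtain ⟨α, β, ha, hb, c1, c2, c3⟩ := h'.cross _ _ h3
        have e1 := (ha τ).mp ⟨rfl, h2⟩
        rw [e1] at hc2
        exact absurd (hc2.trans c1) (lt_irrefl _)
  choose F hF using key
  have hinj : Function.Injective F := by
    intro p p' hpp
    have a := hF p
    have b := hF p'
    rw [← hpp] at b
    rcases a with ⟨a0, τ, a1, a2, a3, a4⟩ | ⟨a0, τ, a1, a2, a3, a4⟩ <;>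
    rcases b with ⟨b0, σ, b1, b2, b3, b4⟩ | ⟨b0, σ, b1, b2, b3, b4⟩
    · have : τ = σ := h.inj _ _ (a3.trans b3.symm) (a4.trans b4.symm)
      subst this
      exact Subtype.ext (Prod.ext (a1.symm.trans b1) (a2.symm.trans b2))
    · exact absurd (a0.trans b0) (lt_irrefl _)
    · exact absurd (a0.trans b0) (lt_irrefl _)
    · have : τ = σ := h'.inj _ _ (a3.trans b3.symm) (a4.trans b4.symm)
      subst this
      exact Subtype.ext (Prod.ext (a1.symm.trans b1) (a2.symm.trans b2))
  have hsurj := Finite.surjective_of_injective hinj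
  obtain ⟨p, hp⟩ := hsurj ⟨(j, j), le_rfl, le_rfl, hlt⟩
  have := hF p
  rw [hp] at this
  rcases this with ⟨h1, -⟩ | ⟨h1, -⟩ <;> exact lt_irrefl _ h1

/-! shifts -/

lemma wp_shift (w : ℕ → Fin n) (x t : ℕ) : wp (fun s => w (s + x)) t * wp w x = wp w (t + x) := by
  induction t with
  | zero => simp [wp]
  | succ t ih => rw [show t + 1 + x = (t + x) + 1 by ring, wp, wp, ← ih, mul_assoc]

lemma upN_shift (w : ℕ → Fin n) (x t : ℕ) : upN (fun s => w (s + x)) t = wp w x (upN w (t + x)) := by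
  rw [upN, upN, ← wp_shift, Equiv.symm_apply_eq]
  exact (Equiv.apply_symm_apply (wp (fun s => w (s + x)) t * wp w x) _).symm

lemma dnN_shift (w : ℕ → Fin n) (x t : ℕ) : dnN (fun s => w (s + x)) t = wp w x (dnN w (t + x)) := by
  rw [dnN, dnN, ← wp_shift, Equiv.symm_apply_eq]
  exact (Equiv.apply_symm_apply (wp (fun s => w (s + x)) t * wp w x) _).symm

variable [NeZero N]

/-- periodic extension -/
def pe (u : Fin N → Fin n) (t : ℕ) : Fin n := u (Fin.ofNat N t)

/-- rotation of words -/
def rot (u : Fin N → Fin n) : Fin N → Fin n := fun t => u (t + 1)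

lemma pe_rot (u : Fin N → Fin n) : pe (rot u) = fun t => pe u (t + 1) := by
  funext t
  simp only [pe, rot]
  congr 1
  ext
  simp [Fin.val_add]

lemma pe_per (u : Fin N → Fin n) (t : ℕ) : pe u (t + N) = pe u t := by
  simp only [pe]; congr 1; ext; simp

lemma pe_val (u : Fin N → Fin n) (t : Fin N) : pe u t = u t := by
  simp only [pe]; congr 1; ext; simp [Nat.mod_eq_of_lt t.2]

/-- wires as functions on `Fin N` -/
def upF (u : Fin N → Fin n) : Fin N → Fin n := fun t => upN (pe u) t
/-- wires as functions on `Fin N` -/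
def dnF (u : Fin N → Fin n) : Fin N → Fin n := fun t => dnN (pe u) t

lemma ofFn_rot (u : Fin N → Fin n) : List.ofFn (rot u) = (List.ofFn u).rotate 1 := by
  apply List.ext_getElem
  · simp
  · intro i h1 h2
    rw [List.getElem_rotate]
    simp only [List.getElem_ofFn, rot]
    congr 1
    ext
    simp [Fin.val_add]

end

section
variable {n : ℕ} [NeZero n]

lemma RF_wd (u : Fin (n ^ 2) → Fin n) (hu : u ∈ RF n) :
    wp (pe u) (n ^ 2) = 1 ∧ ∃ Z, WD (upF u) (dnF u) Z := by
  have h : List.ofFn u ∈ RW n := by simpa [RF] using hu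
  have he : List.ofFn u = List.ofFn (fun i : Fin (n ^ 2) => pe u i) := by
    congr 1; funext t; rw [pe_val]
  refine wd_exists (pe u) (n ^ 2) ?_ ?_
  · have := h.2; rw [he, path_ofFn] at this; exact this
  · have := ((mem_RW _).mp h).2; rw [he, run_ofFn] at this; exact this

lemma RF_rot (u : Fin (n ^ 2) → Fin n) (hu : u ∈ RF n) : rot u ∈ RF n := by
  have h : List.ofFn u ∈ RW n := by simpa [RF] using hu
  have : List.ofFn (rot u) ∈ RW n := by rw [ofFn_rot]; exact RW_rotate _ h 1
  simpa [RF] using this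

lemma RF_rot_iter (u : Fin (n ^ 2) → Fin n) (hu : u ∈ RF n) (x : ℕ) : rot^[x] u ∈ RF n := by
  induction x with
  | zero => exact hu
  | succ x ih => rw [Function.iterate_succ_apply']; exact RF_rot _ ih

lemma wp_per (u : Fin (n ^ 2) → Fin n) (hu : u ∈ RF n) (t : ℕ) :
    wp (pe u) (t + n ^ 2) = wp (pe u) t := by
  have := wp_shift (pe u) (n ^ 2) t
  rw [(RF_wd u hu).1, mul_one] at this
  rw [← this]; congr 1; funext s; exact pe_per u s

lemma succ_cases (t : Fin (n ^ 2)) : (((t + 1 : Fin (n ^ 2)) : ℕ) = t + 1) ∨ ((t : ℕ) + 1 = ((t + 1 : Fin (n ^ 2)) : ℕ) + n ^ 2) := by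
  rw [Fin.val_add]
  have h1 := t.2
  have h2 : ((t : ℕ) + ((1 : Fin (n ^ 2)) : ℕ)) % n ^ 2 = (t + 1) % n ^ 2 := by simp
  rw [h2]
  rcases Nat.lt_or_ge (t + 1) (n ^ 2) with h | h
  · left; exact Nat.mod_eq_of_lt h
  · right; have : (t : ℕ) + 1 = n ^ 2 := by omega
    rw [this]; simp

lemma upF_rot (u : Fin (n ^ 2) → Fin n) (hu : u ∈ RF n) (t : Fin (n ^ 2)) :
    upF (rot u) t = lp (u 0) (upF u (t + 1)) := by
  rw [upF, pe_rot, upN_shift]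
  have h1 : wp (pe u) 1 = lp (u 0) := by
    have := pe_val u 0
    simp only [Fin.val_zero] at this
    simp [wp, this]
  rw [h1, upF]
  congr 1
  rcases succ_cases t with h | h
  · rw [h]
  · rw [h, upN, upN, wp_per u hu, pe_per]

lemma dnF_rot (u : Fin (n ^ 2) → Fin n) (hu : u ∈ RF n) (t : Fin (n ^ 2)) :
    dnF (rot u) t = lp (u 0) (dnF u (t + 1)) := by
  rw [dnF, pe_rot, dnN_shift]
  have h1 : wp (pe u) 1 = lp (u 0) := by
    have := pe_val u 0
    simp only [Fin.val_zero] at this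
    simp [wp, this]
  rw [h1, dnF]
  congr 1
  rcases succ_cases t with h | h
  · rw [h]
  · rw [h, dnN, dnN, wp_per u hu, pe_per]

lemma edge_rot (u v : Fin (n ^ 2) → Fin n) (hu : u ∈ RF n) (hv : v ∈ RF n) (h : Edge (upF u) (dnF v)) :
    Edge (upF (rot u)) (dnF (rot v)) := by
  have : (fun t => (upF (rot u) t, dnF (rot v) t)) =
      (Equiv.prodCongr (lp (u 0)) (lp (v 0))) ∘ (fun t => (upF u t, dnF v t)) ∘ (Equiv.addRight (1 : Fin (n ^ 2))) := by
    funext t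
    simp [upF_rot u hu, dnF_rot v hv]
  unfold Edge
  rw [this]
  exact (Equiv.bijective _).comp (h.comp (Equiv.bijective _))

lemma lp_inj (i j : Fin n) (h : lp i = lp j) : i = j := by
  have key : ∀ i j : Fin n, i < j → lp i ≠ lp j := by
    intro i j hij h
    have h1 : (i : ℕ) + 1 < n := by have := j.2; rw [Fin.lt_def] at hij; omega
    have h2 := congrArg (fun e : Equiv.Perm (Fin n) => ((e i : Fin n) : ℕ)) h
    simp only [lp_val i i h1, if_true] at h2
    rw [Fin.lt_def] at hij
    by_cases h3 : (j : ℕ) + 1 < n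
    · rw [lp_val j i h3, if_neg (by omega), if_neg (by omega)] at h2
      omega
    · rw [show lp j = 1 by rw [lp, dif_neg h3]] at h2
      simp at h2
  rcases lt_trichotomy i j with h1 | h1 | h1
  · exact absurd h (key i j h1)
  · exact h1
  · exact absurd h.symm (key j i h1)

open Classical in
/-- touching times -/
noncomputable def Zf (u : Fin (n ^ 2) → Fin n) : Fin n → Fin (n ^ 2) :=
  if h : u ∈ RF n then (RF_wd u h).2.choose else fun _ => 0

lemma Zf_wd (u : Fin (n ^ 2) → Fin n) (hu : u ∈ RF n) : WD (upF u) (dnF u) (Zf u) := by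
  rw [Zf, dif_pos hu]; exact (RF_wd u hu).2.choose_spec

lemma Zf_rot (u : Fin (n ^ 2) → Fin n) (hu : u ∈ RF n) (i : Fin n) :
    Zf (rot u) (lp (u 0) i) + 1 = Zf u i := by
  have h1 := ((Zf_wd _ (RF_rot u hu)).touch (lp (u 0) i) (Zf (rot u) (lp (u 0) i))).mpr rfl
  rw [upF_rot u hu, dnF_rot u hu] at h1
  exact ((Zf_wd u hu).touch i _).mp ⟨(lp (u 0)).injective h1.1, (lp (u 0)).injective h1.2⟩

lemma Zf_inj (u : Fin (n ^ 2) → Fin n) (hu : u ∈ RF n) : Function.Injective (Zf u) := by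
  intro i j h
  have h1 := ((Zf_wd u hu).touch i _).mpr rfl
  have h2 := ((Zf_wd u hu).touch j _).mpr rfl
  rw [h] at h1
  exact h1.1.symm.trans h2.1

lemma Zf_first (u v : Fin (n ^ 2) → Fin n) (hu : u ∈ RF n) (hv : v ∈ RF n) (h0 : Zf u = Zf v)
    (h1 : Zf (rot u) = Zf (rot v)) : u 0 = v 0 := by
  apply lp_inj
  ext1 i
  have a := Zf_rot u hu i
  have b := Zf_rot v hv i
  rw [← h0, ← h1, ← a] at b
  exact (Zf_inj _ (RF_rot u hu) (add_right_cancel b)).symm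

/-- potential -/
noncomputable def Th (u : Fin (n ^ 2) → Fin n) : ℕ → Lex (Fin n → Fin (n ^ 2)) :=
  fun x => toLex (Zf (rot^[x] u))

lemma rot_iter (u : Fin (n ^ 2) → Fin n) (x : ℕ) (t : Fin (n ^ 2)) : rot^[x] u t = u (t + Fin.ofNat (n ^ 2) x) := by
  induction x generalizing t with
  | zero => simp
  | succ x ih =>
    rw [Function.iterate_succ_apply', rot, ih]; congr 1
    rw [add_assoc]; congr 1
    ext; simp [Fin.val_add, add_comm]

lemma Th_inj (u v : Fin (n ^ 2) → Fin n) (hu : u ∈ RF n) (hv : v ∈ RF n) (h : Th u = Th v) : u = v := by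
  have h0 : ∀ x, Zf (rot^[x] u) = Zf (rot^[x] v) := fun x => toLex.injective (congrFun h x)
  funext t
  have := Zf_first _ _ (RF_rot_iter u hu t) (RF_rot_iter v hv t) (h0 t) (by
    have := h0 (t + 1)
    rwa [Function.iterate_succ_apply', Function.iterate_succ_apply'] at this)
  rw [rot_iter, rot_iter] at this
  simpa using this

lemma Th_le (u v : Fin (n ^ 2) → Fin n) (hu : u ∈ RF n) (hv : v ∈ RF n) (h : Edge (upF u) (dnF v)) :
    Th u ≤ Th v := by
  have hx : ∀ x, Edge (upF (rot^[x] u)) (dnF (rot^[x] v)) := by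
    intro x
    induction x with
    | zero => exact h
    | succ x ih =>
      rw [Function.iterate_succ_apply', Function.iterate_succ_apply']
      exact edge_rot _ _ (RF_rot_iter u hu x) (RF_rot_iter v hv x) ih
  intro x
  rw [← not_lt]
  intro hl
  obtain ⟨j, h1, h2⟩ := hl
  exact edge_lemma (Zf_wd _ (RF_rot_iter u hu x)) (Zf_wd _ (RF_rot_iter v hv x)) (hx x) j h1 h2

end

section
variable {n N : ℕ}

/-- the pairing determinant -/
def Phi (e0 : Fin N ≃ Fin n × Fin n) (u w : Fin N → Fin n) : ℚ :=
  Matrix.det (Matrix.of fun t s : Fin N => if (u t, w t) = e0 s then (1 : ℚ) else 0)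

lemma Phi_edge (e0 : Fin N ≃ Fin n × Fin n) (u w : Fin N → Fin n) : Phi e0 u w ≠ 0 ↔ Edge u w := by
  constructor
  · intro h
    have hinj : Function.Injective (fun t => (u t, w t)) := by
      intro s t hst
      by_contra hne
      apply h
      apply Matrix.det_zero_of_row_eq hne
      funext x
      simp only [Matrix.of_apply]
      simp only at hst
      rw [hst]
    rw [Edge, Fintype.bijective_iff_injective_and_card]
    exact ⟨hinj, Fintype.card_congr e0⟩
  · intro h
    have : (Matrix.of fun t s : Fin N => if (u t, w t) = e0 s then (1 : ℚ) else 0) =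
        ((Equiv.ofBijective _ h).trans e0.symm).toPEquiv.toMatrix := by
      ext t s
      simp [PEquiv.toMatrix_apply, Equiv.toPEquiv_apply, Equiv.symm_apply_eq, Equiv.ofBijective_apply]
      rfl
    rw [Phi, this, Matrix.det_permutation]
    rcases Int.units_eq_one_or (Equiv.Perm.sign ((Equiv.ofBijective _ h).trans e0.symm)) with h1 | h1 <;> simp [h1]

end

theorem indep {n : ℕ} [NeZero n] (e0 : Fin (n ^ 2) ≃ Fin n × Fin n) :
    LinearIndependent ℚ (fun u : RF n => (Phi e0 (upF u.1) : (Fin (n ^ 2) → Fin n) → ℚ)) := by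
  rw [Fintype.linearIndependent_iff]
  intro c hc
  by_contra hne
  push Not at hne
  obtain ⟨i, hi⟩ := hne
  obtain ⟨v, hv⟩ := (Finset.univ.filter (fun u : RF n => c u ≠ 0)).exists_minimalFor (fun u => Th u.1)
    ⟨i, by simpa using hi⟩
  have hv0 : c v ≠ 0 := by have := hv.1; simpa using this
  have h1 := congrFun hc (dnF v.1)
  rw [Finset.sum_apply, Finset.sum_eq_single v] at h1
  · simp only [Pi.smul_apply, smul_eq_mul, Pi.zero_apply, mul_eq_zero] at h1
    rcases h1 with h1 | h1
    · exact hv0 h1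
    · exact (Phi_edge e0 _ _).mpr (Zf_wd v.1 v.2).edge h1
  · intro u _ huv
    simp only [Pi.smul_apply, smul_eq_mul, mul_eq_zero]
    by_contra hh
    push Not at hh
    have h2 := Th_le u.1 v.1 u.2 v.2 ((Phi_edge e0 _ _).mp hh.2)
    have h3 := hv.2 (by simpa using hh.1) h2
    exact huv (Subtype.ext (Th_inj _ _ u.2 v.2 (le_antisymm h2 h3)))
  · simp

end BnCSP

namespace BnCSP

/-! ### Part F1 : the virtual character has norm one -/

section
variable {A : Type*} [Fintype A] [DecidableEq A] {N : ℕ}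

/-- content -/
def cntA (p : Fin N → A) (a : A) : ℕ := (Finset.univ.filter fun t => p t = a).card

lemma cntA_perm (p q : Fin N → A) (h : cntA p = cntA q) : ∃ g : Equiv.Perm (Fin N), q ∘ g = p := by
  have h1 : ∀ a, Nonempty ({t // p t = a} ≃ {t // q t = a}) := by
    intro a
    have := congrFun h a
    refine ⟨Fintype.equivOfCardEq ?_⟩
    simpa [cntA, Fintype.card_subtype] using this
  exact ⟨Equiv.ofFiberEquiv (fun a => (h1 a).some), funext fun t => Equiv.ofFiberEquiv_map _ _⟩

lemma cntA_exists (c : A → ℕ) (hc : ∑ a, c a = N) : ∃ p : Fin N → A, cntA p = c := by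
  have e : (Σ a, Fin (c a)) ≃ Fin N := Fintype.equivOfCardEq (by simp [hc])
  refine ⟨fun t => (e.symm t).1, funext fun a => ?_⟩
  rw [cntA, ← Fintype.card_subtype, ← Fintype.card_fin (c a)]
  refine Fintype.card_congr ?_
  exact (e.symm.subtypeEquiv (q := fun x => x.1 = a) (fun t => Iff.rfl)).trans (Equiv.sigmaSubtype a)

lemma cntA_comp (p : Fin N → A) (g : Equiv.Perm (Fin N)) : cntA (p ∘ g) = cntA p := by
  funext a
  rw [cntA, cntA, ← Fintype.card_subtype, ← Fintype.card_subtype]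
  exact Fintype.card_congr (g.subtypeEquiv fun t => Iff.rfl)

lemma stab_sum (c : A → ℕ) (hc : ∑ a, c a = N) :
    ∑ p ∈ Finset.univ.filter (fun p : Fin N → A => cntA p = c),
      (Finset.univ.filter fun g : Equiv.Perm (Fin N) => p ∘ g = p).card = N.factorial := by
  obtain ⟨p0, h0⟩ := cntA_exists c hc
  have h1 : ∀ p ∈ Finset.univ.filter (fun p : Fin N → A => cntA p = c),
      (Finset.univ.filter fun g : Equiv.Perm (Fin N) => p ∘ g = p).card =
      (Finset.univ.filter fun g : Equiv.Perm (Fin N) => p0 ∘ g = p).card := by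
    intro p hp
    have hp : cntA p = c := by simpa using hp
    obtain ⟨h, hh⟩ := cntA_perm p p0 (hp.trans h0.symm)
    refine Finset.card_bij' (fun g _ => h * g) (fun g _ => h⁻¹ * g) ?_ ?_ ?_ ?_
    · intro g hg
      simp only [Finset.mem_filter, Finset.mem_univ, true_and] at hg ⊢
      rw [Equiv.Perm.coe_mul, ← Function.comp_assoc, hh, hg]
    · intro g hg
      simp only [Finset.mem_filter, Finset.mem_univ, true_and] at hg ⊢
      have e1 : p ∘ (h⁻¹ : Equiv.Perm (Fin N)) = p0 := by rw [← hh]; funext t; simp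
      rw [Equiv.Perm.coe_mul, ← Function.comp_assoc, e1, hg]
    · intro g _; simp
    · intro g _; simp
  rw [Finset.sum_congr rfl h1]
  have h2 := Finset.card_eq_sum_card_fiberwise (f := fun g : Equiv.Perm (Fin N) => p0 ∘ g)
    (s := Finset.univ) (t := Finset.univ.filter (fun p : Fin N → A => cntA p = c)) (by
      intro g _; simp [cntA_comp, h0])
  rw [← h2, Finset.card_univ, Fintype.card_perm, Fintype.card_fin]

end

section
variable (k : ℕ)

/-- variables -/
noncomputable abbrev RR := MvPolynomial (Fin (k + 1)) ℤ

/-- generating polynomial of elementary symmetric functions -/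
noncomputable def Egen : Polynomial (RR k) :=
  ∏ i : Fin (k + 1), (1 - Polynomial.C (MvPolynomial.X i) * Polynomial.X)

/-- generating series of complete functions -/
noncomputable def Hgen : PowerSeries (RR k) :=
  ∏ i : Fin (k + 1), PowerSeries.mk (fun m => (MvPolynomial.X i : RR k) ^ m)

lemma geo {R : Type*} [CommRing R] (x : R) :
    (1 - PowerSeries.C x * PowerSeries.X) * PowerSeries.mk (fun m => x ^ m) = 1 := by
  ext m
  rw [sub_mul, one_mul, mul_assoc, map_sub, PowerSeries.coeff_C_mul]
  cases m with
  | zero => simp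
  | succ m => rw [PowerSeries.coeff_succ_X_mul]; simp [pow_succ']

lemma EH : (Egen k : PowerSeries (RR k)) * Hgen k = 1 := by
  have : (Egen k : PowerSeries (RR k)) = ∏ i : Fin (k + 1), (1 - PowerSeries.C (MvPolynomial.X i : RR k) * PowerSeries.X) := by
    rw [Egen, ← Polynomial.coeToPowerSeries.ringHom_apply, map_prod]
    simp
  rw [this, Hgen, ← Finset.prod_mul_distrib]
  exact Finset.prod_eq_one fun i _ => geo _

lemma Egen_deg : (Egen k).natDegree ≤ k + 1 := by
  refine (Polynomial.natDegree_prod_le _ _).trans ?_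
  refine (Finset.sum_le_card_nsmul _ _ 1 fun i _ => ?_).trans (by simp)
  compute_degree

lemma Egen_top : (Egen k).coeff (k + 1) = (-1) ^ (k + 1) * ∏ i : Fin (k + 1), (MvPolynomial.X i : RR k) := by
  have := Polynomial.coeff_prod_of_natDegree_le (s := (Finset.univ : Finset (Fin (k + 1))))
    (fun i => (1 - Polynomial.C (MvPolynomial.X i : RR k) * Polynomial.X)) 1 (fun i _ => by compute_degree)
  simp only [Finset.card_univ, Fintype.card_fin, mul_one] at this
  rw [Egen, this]
  simp [Polynomial.coeff_one, Finset.prod_neg]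

/-- complete functions -/
noncomputable def hC (m : ℤ) : RR k := if m < 0 then 0 else PowerSeries.coeff m.toNat (Hgen k)

lemma hC_data : HData k (fun l => (-1) ^ l * (Egen k).coeff l) (hC k) := by
  constructor
  · intro m hm; simp [hC, hm]
  · have : PowerSeries.coeff 0 (Hgen k) = 1 := by
      rw [PowerSeries.coeff_zero_eq_constantCoeff, Hgen, map_prod]; simp
    simp [hC, this]
  · intro m hm
    by_cases h0 : m < 0
    · rw [hC, if_pos h0, Finset.sum_eq_zero]
      intro j _
      rw [hC, if_pos, mul_zero]
      have := j.2; omega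
    · have h1 := congrArg (PowerSeries.coeff m.toNat) (EH k)
      have hc : (Egen k).coeff 0 = 1 := by
        rw [Egen, Polynomial.coeff_zero_eq_eval_zero, Polynomial.eval_prod]; simp
      rw [PowerSeries.coeff_one, if_neg (by omega)] at h1
      conv_lhs at h1 => rw [Polynomial.as_sum_range' (Egen k) (k + 2) (by have := Egen_deg k; omega)]
      rw [← Polynomial.coeToPowerSeries.ringHom_apply, map_sum, Finset.sum_mul, map_sum] at h1
      have h2 : ∀ a : ℕ, PowerSeries.coeff m.toNat (Polynomial.coeToPowerSeries.ringHom
          (Polynomial.monomial a ((Egen k).coeff a)) * Hgen k) = (Egen k).coeff a * hC k (m - a) := by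
        intro a
        rw [← Polynomial.C_mul_X_pow_eq_monomial, Polynomial.coeToPowerSeries.ringHom_apply, Polynomial.coe_mul,
          Polynomial.coe_C, Polynomial.coe_pow, Polynomial.coe_X, mul_assoc, PowerSeries.coeff_C_mul, PowerSeries.coeff_X_pow_mul', hC]
        split_ifs with h3 h4 h4
        · omega
        · congr 3; omega
        · rfl
        · omega
      rw [Finset.sum_congr rfl (fun a _ => h2 a), Finset.sum_range_succ'] at h1
      rw [hc] at h1
      have h3 : hC k m = - ∑ a ∈ Finset.range (k + 1), (Egen k).coeff (a + 1) * hC k (m - (a + 1 : ℕ)) := by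
        rw [eq_neg_iff_add_eq_zero, ← h1]; simp [add_comm]
      rw [h3, ← Finset.sum_range_reflect, ← Fin.sum_univ_eq_sum_range (fun j => (Egen k).coeff (k + 1 - 1 - j + 1) * hC k (m - (k + 1 - 1 - j + 1 : ℕ))), ← Finset.sum_neg_distrib]
      refine Finset.sum_congr rfl fun j _ => ?_
      have hj := j.2
      have e1 : k + 1 - 1 - (j : ℕ) + 1 = k - j + 1 := by omega
      have e2 : k + 1 - (j : ℕ) = k - j + 1 := by omega
      rw [e1, e2]
      have e3 : m - ((k - j + 1 : ℕ) : ℤ) = m - (k + 1) + (j : ℕ) := by omega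
      rw [e3, pow_succ]
      have e4 : ((-1 : RR k) ^ (k - (j : ℕ))) * (-1) ^ (k - (j : ℕ)) = 1 := by
        rw [← mul_pow]; simp
      linear_combination ((Egen k).coeff (k - j + 1) * hC k (m - (k + 1) + (j : ℕ))) * e4

end

end BnCSP

namespace BnCSP

section
variable (k : ℕ)

/-- shifted contents -/
def mu (σ : Equiv.Perm (Fin (k + 1))) (i : Fin (k + 1)) : ℕ := k + 1 + i - σ i

lemma mu_sum (σ : Equiv.Perm (Fin (k + 1))) : ∑ i, mu k σ i = (k + 1) ^ 2 := by
  have h1 : ∀ i, mu k σ i + (σ i : ℕ) = k + 1 + i := fun i => by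
    have := (σ i).2; simp only [mu]; omega
  have h2 : ∑ i, (mu k σ i + (σ i : ℕ)) = ∑ i : Fin (k + 1), (k + 1 + (i : ℕ)) :=
    Finset.sum_congr rfl fun i _ => h1 i
  rw [Finset.sum_add_distrib, Finset.sum_add_distrib, Equiv.sum_comp σ (fun i => (i : ℕ))] at h2
  have h3 := Nat.add_right_cancel h2
  rw [h3]; simp [sq]

lemma mu_one (σ : Equiv.Perm (Fin (k + 1))) : (∀ i, mu k σ i ≤ k + 1) ↔ σ = 1 := by
  constructor
  · intro h
    have h1 : ∀ i : Fin (k + 1), (i : ℕ) ≤ σ i := fun i => by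
      have := h i; have := (σ i).2; simp only [mu] at *; omega
    have h2 : ∑ i : Fin (k + 1), (i : ℕ) = ∑ i, (σ i : ℕ) := (Equiv.sum_comp σ (fun i => (i : ℕ))).symm
    have h3 := (Finset.sum_eq_sum_iff_of_le (fun i _ => h1 i)).mp h2
    ext i
    exact (h3 i (Finset.mem_univ i)).symm
  · rintro rfl i; simp [mu]

lemma hC_nat (m : ℕ) : hC k m = ∑ l ∈ (Finset.univ : Finset (Fin (k + 1))).finsuppAntidiag m,
    MvPolynomial.monomial l (1 : ℤ) := by
  rw [hC, if_neg (by omega), Int.toNat_natCast, Hgen, PowerSeries.coeff_prod]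
  refine Finset.sum_congr rfl fun l _ => ?_
  simp only [PowerSeries.coeff_mk]
  rw [MvPolynomial.monomial_eq, Finsupp.prod_fintype _ _ (by simp)]
  simp

/-- matrices with given margins -/
def Mset (σ τ : Equiv.Perm (Fin (k + 1))) : Finset (Fin (k + 1) × Fin (k + 1) → ℕ) :=
  (Fintype.piFinset (fun _ => Finset.range ((k + 1) ^ 2 + 1))).filter
    (fun M => (∀ i, ∑ j, M (i, j) = mu k σ i) ∧ (∀ j, ∑ i, M (i, j) = mu k τ j))

lemma mem_Mset (σ τ : Equiv.Perm (Fin (k + 1))) (M : Fin (k + 1) × Fin (k + 1) → ℕ) :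
    M ∈ Mset k σ τ ↔ (∀ i, ∑ j, M (i, j) = mu k σ i) ∧ (∀ j, ∑ i, M (i, j) = mu k τ j) := by
  rw [Mset, Finset.mem_filter, and_iff_right_iff_imp]
  rintro ⟨h1, -⟩
  rw [Fintype.mem_piFinset]
  rintro ⟨i, j⟩
  rw [Finset.mem_range]
  have h2 : M (i, j) ≤ ∑ j, M (i, j) := Finset.single_le_sum (f := fun j => M (i, j)) (fun _ _ => Nat.zero_le _) (Finset.mem_univ j)
  have h3 : mu k σ i ≤ ∑ i, mu k σ i := Finset.single_le_sum (f := fun i => mu k σ i) (fun _ _ => Nat.zero_le _) (Finset.mem_univ i)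
  rw [mu_sum] at h3
  have := h1 i
  omega

lemma coeff_prod_h (σ τ : Equiv.Perm (Fin (k + 1))) :
    MvPolynomial.coeff (Finsupp.equivFunOnFinite.symm (mu k σ)) (∏ j, hC k (mu k τ j)) = ((Mset k σ τ).card : ℤ) := by
  simp only [hC_nat]
  rw [Finset.prod_univ_sum, MvPolynomial.coeff_sum]
  have h1 : ∀ L : Fin (k + 1) → (Fin (k + 1) →₀ ℕ), ∏ j, MvPolynomial.monomial (L j) (1 : ℤ) =
      MvPolynomial.monomial (∑ j, L j) 1 := by
    intro L
    rw [MvPolynomial.monomial_sum_one]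
  simp only [h1, MvPolynomial.coeff_monomial]
  rw [← Finset.sum_filter, Finset.sum_const, nsmul_eq_mul, mul_one]
  congr 1
  refine Finset.card_bij' (fun L _ => fun p => L p.2 p.1)
    (fun M _ => fun j => Finsupp.equivFunOnFinite.symm (fun i => M (i, j))) ?_ ?_ ?_ ?_
  · intro L hL
    rw [Finset.mem_filter, Fintype.mem_piFinset] at hL
    rw [mem_Mset]
    refine ⟨fun i => ?_, fun j => ?_⟩
    · have := DFunLike.congr_fun hL.2 i
      simpa [Finsupp.finsetSum_apply] using this
    · exact (Finset.mem_finsuppAntidiag.mp (hL.1 j)).1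
  · intro M hM
    rw [mem_Mset] at hM
    rw [Finset.mem_filter, Fintype.mem_piFinset]
    refine ⟨fun j => ?_, ?_⟩
    · rw [Finset.mem_finsuppAntidiag]
      exact ⟨hM.2 j, Finset.subset_univ _⟩
    · ext i
      simp [Finsupp.finsetSum_apply, hM.1 i]
  · intro L _; funext j; ext i; simp
  · intro M _; funext p; simp

lemma mat_alt (σ : Equiv.Perm (Fin (k + 1))) :
    ∑ τ : Equiv.Perm (Fin (k + 1)), (Equiv.Perm.sign τ : ℤ) * ((Mset k σ τ).card : ℤ) = if σ = 1 then 1 else 0 := by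
  have h1 := sDet_rect (hC_data k) (k + 1)
  rw [sDet, Matrix.det_apply'] at h1
  have h2 := congrArg (MvPolynomial.coeff (Finsupp.equivFunOnFinite.symm (mu k σ))) h1
  rw [MvPolynomial.coeff_sum] at h2
  have h3 : ∀ τ : Equiv.Perm (Fin (k + 1)), MvPolynomial.coeff (Finsupp.equivFunOnFinite.symm (mu k σ))
      (((Equiv.Perm.sign τ : ℤ) : RR k) * ∏ i, sMat k (hC k) (fun i => delta k i + ((k + 1 : ℕ) : ℤ)) (τ i) i) =
      (Equiv.Perm.sign τ : ℤ) * ((Mset k σ τ).card : ℤ) := by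
    intro τ
    rw [← coeff_prod_h, ← MvPolynomial.coeff_C_mul]
    congr 2
    refine Finset.prod_congr rfl fun i _ => ?_
    simp only [sMat, Matrix.of_apply, delta, mu]
    congr 1
    have := (τ i).2
    omega
  rw [Finset.sum_congr rfl fun τ _ => h3 τ] at h2
  rw [h2, Egen_top, ← mul_assoc, ← mul_pow]
  have h4 : ((-1 : RR k) * -1) ^ (k + 1) * ∏ i : Fin (k + 1), MvPolynomial.X i = 
      MvPolynomial.monomial (∑ i : Fin (k + 1), Finsupp.single i 1) 1 := by
    rw [MvPolynomial.monomial_sum_one]; simp [MvPolynomial.X]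
  rw [h4, MvPolynomial.monomial_pow, MvPolynomial.coeff_monomial, one_pow]
  congr 1
  rw [eq_iff_iff, ← mu_one]
  constructor
  · intro h i
    have := DFunLike.congr_fun h i
    simp [Finsupp.finsetSum_apply, Finsupp.single_apply] at this
    omega
  · intro h
    rw [mu_one] at h; subst h
    ext i
    simp [Finsupp.finsetSum_apply, Finsupp.single_apply, mu]

/-- contents -/
def Cont (σ : Equiv.Perm (Fin (k + 1))) (u : Fin ((k + 1) ^ 2) → Fin (k + 1)) : Prop :=
  ∀ i, cntA u i = mu k σ i

instance (σ : Equiv.Perm (Fin (k + 1))) (u : Fin ((k + 1) ^ 2) → Fin (k + 1)) : Decidable (Cont k σ u) := by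
  unfold Cont; infer_instance

/-- the virtual character -/
def chiG (g : Equiv.Perm (Fin ((k + 1) ^ 2))) : ℤ := ∑ σ : Equiv.Perm (Fin (k + 1)), (Equiv.Perm.sign σ : ℤ) *
  ((Finset.univ.filter fun u : Fin ((k + 1) ^ 2) → Fin (k + 1) => Cont k σ u ∧ u ∘ g = u).card : ℤ)

lemma chiG_one : chiG k 1 = chiOne k ((k + 1) ^ 2) := by
  rw [chiG, chiOne]
  refine Finset.sum_congr rfl fun σ _ => ?_
  congr 2
  refine congrArg _ (Finset.filter_congr fun u _ => ?_)
  simp only [Cont, Equiv.Perm.coe_one, Function.comp_id, and_true]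
  refine forall_congr' fun i => ?_
  have := (σ i).2
  simp only [mu]
  change (cnt u i = _) ↔ _
  omega

lemma cntA_fst {A B : Type*} [Fintype A] [DecidableEq A] [Fintype B] [DecidableEq B] {N : ℕ} (p : Fin N → A × B) (a : A) :
    ∑ b, cntA p (a, b) = cntA (fun t => (p t).1) a := by
  rw [cntA, Finset.card_eq_sum_card_fiberwise (f := fun t => (p t).2) (t := Finset.univ) (by simp)]
  refine Finset.sum_congr rfl fun b _ => ?_
  rw [cntA, Finset.filter_filter]
  exact congrArg _ (Finset.filter_congr fun t _ => Prod.ext_iff)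

lemma cntA_snd {A B : Type*} [Fintype A] [DecidableEq A] [Fintype B] [DecidableEq B] {N : ℕ} (p : Fin N → A × B) (b : B) :
    ∑ a, cntA p (a, b) = cntA (fun t => (p t).2) b := by
  rw [cntA, Finset.card_eq_sum_card_fiberwise (f := fun t => (p t).1) (t := Finset.univ) (by simp)]
  refine Finset.sum_congr rfl fun a _ => ?_
  rw [cntA, Finset.filter_filter]
  exact congrArg _ (Finset.filter_congr fun t _ => by rw [Prod.ext_iff, and_comm])

lemma pair_sum (σ τ : Equiv.Perm (Fin (k + 1))) : ∑ g : Equiv.Perm (Fin ((k + 1) ^ 2)),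
    (Finset.univ.filter fun u : Fin ((k + 1) ^ 2) → Fin (k + 1) => Cont k σ u ∧ u ∘ g = u).card *
    (Finset.univ.filter fun u : Fin ((k + 1) ^ 2) → Fin (k + 1) => Cont k τ u ∧ u ∘ g = u).card =
    (Mset k σ τ).card * ((k + 1) ^ 2).factorial := by
  have h1 : ∀ g : Equiv.Perm (Fin ((k + 1) ^ 2)),
    (Finset.univ.filter fun u : Fin ((k + 1) ^ 2) → Fin (k + 1) => Cont k σ u ∧ u ∘ g = u).card *
    (Finset.univ.filter fun u : Fin ((k + 1) ^ 2) → Fin (k + 1) => Cont k τ u ∧ u ∘ g = u).card =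
    ∑ M ∈ Mset k σ τ, ∑ p : Fin ((k + 1) ^ 2) → Fin (k + 1) × Fin (k + 1),
      if cntA p = M ∧ p ∘ g = p then 1 else 0 := by
    intro g
    rw [← Finset.card_product, Finset.sum_comm]
    have h2 : ∀ p : Fin ((k + 1) ^ 2) → Fin (k + 1) × Fin (k + 1),
        (∑ M ∈ Mset k σ τ, if cntA p = M ∧ p ∘ g = p then 1 else 0) =
        if cntA p ∈ Mset k σ τ ∧ p ∘ g = p then 1 else 0 := by
      intro p
      by_cases hp : p ∘ g = p
      · simp [hp]
      · simp [hp]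
    rw [Finset.sum_congr rfl fun p _ => h2 p, ← Finset.card_filter]
    refine Finset.card_bij' (fun x _ => fun t => (x.1 t, x.2 t)) (fun p _ => (fun t => (p t).1, fun t => (p t).2)) ?_ ?_ ?_ ?_
    · rintro ⟨u, v⟩ hx
      simp only [Finset.mem_product, Finset.mem_filter, Finset.mem_univ, true_and] at hx ⊢
      rw [mem_Mset]
      simp only [cntA_fst, cntA_snd]
      refine ⟨⟨hx.1.1, hx.2.1⟩, ?_⟩
      funext t
      exact Prod.ext (congrFun hx.1.2 t) (congrFun hx.2.2 t)
    · intro p hp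
      simp only [Finset.mem_product, Finset.mem_filter, Finset.mem_univ, true_and] at hp ⊢
      rw [mem_Mset] at hp
      simp only [cntA_fst, cntA_snd] at hp
      exact ⟨⟨hp.1.1, funext fun t => congrArg Prod.fst (congrFun hp.2 t)⟩,
        ⟨hp.1.2, funext fun t => congrArg Prod.snd (congrFun hp.2 t)⟩⟩
    · intro x _; rfl
    · intro p _; rfl
  rw [Finset.sum_congr rfl fun g _ => h1 g, Finset.sum_comm, ← smul_eq_mul, ← Finset.sum_const]
  refine Finset.sum_congr rfl fun M hM => ?_
  rw [Finset.sum_comm]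
  have hs : ∑ a, M a = (k + 1) ^ 2 := by
    rw [mem_Mset] at hM
    rw [Fintype.sum_prod_type, Finset.sum_congr rfl fun i _ => hM.1 i, mu_sum]
  rw [← stab_sum M hs, Finset.sum_filter]
  refine Finset.sum_congr rfl fun p _ => ?_
  by_cases hp : cntA p = M
  · simp [hp]
  · simp [hp]

theorem chiG_norm : ∑ g, chiG k g * chiG k g = (((k + 1) ^ 2).factorial : ℤ) := by
  simp only [chiG, Finset.sum_mul_sum]
  rw [Finset.sum_comm]
  have h1 : ∀ σ : Equiv.Perm (Fin (k + 1)), (∑ g : Equiv.Perm (Fin ((k + 1) ^ 2)), ∑ τ : Equiv.Perm (Fin (k + 1)),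
      ((Equiv.Perm.sign σ : ℤ) *
  ((Finset.univ.filter fun u : Fin ((k + 1) ^ 2) → Fin (k + 1) => Cont k σ u ∧ u ∘ g = u).card : ℤ)) *
      ((Equiv.Perm.sign τ : ℤ) *
  ((Finset.univ.filter fun u : Fin ((k + 1) ^ 2) → Fin (k + 1) => Cont k τ u ∧ u ∘ g = u).card : ℤ))) =
    (Equiv.Perm.sign σ : ℤ) * ((if σ = 1 then 1 else 0) * (((k + 1) ^ 2).factorial : ℤ)) := by
    intro σ
    rw [Finset.sum_comm, ← mat_alt, Finset.sum_mul, Finset.mul_sum]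
    refine Finset.sum_congr rfl fun τ _ => ?_
    have := congrArg (fun x : ℕ => (x : ℤ)) (pair_sum k σ τ)
    push_cast at this
    rw [mul_assoc (Equiv.Perm.sign τ : ℤ), ← this, Finset.mul_sum, Finset.mul_sum]
    refine Finset.sum_congr rfl fun g _ => by ring
  rw [Finset.sum_congr rfl fun σ _ => h1 σ, Finset.sum_eq_single 1]
  · simp
  · intro σ _ h; simp [h]
  · simp

end

end BnCSP

namespace BnCSP

/-! ### Part F3 : the representation -/

section
variable {n N : ℕ}

/-- signed action on functions -/
def rhoV (n N : ℕ) : Representation ℚ (Equiv.Perm (Fin N)) ((Fin N → Fin n) → ℚ) where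
  toFun g :=
    { toFun := fun f w => ((Equiv.Perm.sign g : ℤ) : ℚ) * f (w ∘ g)
      map_add' := fun f f' => by funext w; simp [mul_add]
      map_smul' := fun c f => by funext w; simp; ring }
  map_one' := by ext f w; simp
  map_mul' g h := by
    apply LinearMap.ext; intro f; funext w
    simp [Equiv.Perm.coe_mul, Function.comp_assoc, mul_assoc]

lemma rhoV_apply (g : Equiv.Perm (Fin N)) (f : (Fin N → Fin n) → ℚ) (w : Fin N → Fin n) :
    rhoV n N g f w = ((Equiv.Perm.sign g : ℤ) : ℚ) * f (w ∘ g) := rfl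

lemma sgn_sq {α : Type*} [Fintype α] [DecidableEq α] (g : Equiv.Perm α) :
    ((Equiv.Perm.sign g : ℤ) : ℚ) * ((Equiv.Perm.sign g : ℤ) : ℚ) = 1 := by
  rcases Int.units_eq_one_or (Equiv.Perm.sign g) with h | h <;> simp [h]

lemma Phi_comp (e0 : Fin N ≃ Fin n × Fin n) (u w : Fin N → Fin n) (g : Equiv.Perm (Fin N)) :
    Phi e0 (u ∘ g) (w ∘ g) = ((Equiv.Perm.sign g : ℤ) : ℚ) * Phi e0 u w := by
  have := Matrix.det_permute g (Matrix.of fun t s : Fin N => if (u t, w t) = e0 s then (1 : ℚ) else 0)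
  exact this

lemma rhoV_Phi (e0 : Fin N ≃ Fin n × Fin n) (u : Fin N → Fin n) (g : Equiv.Perm (Fin N)) :
    rhoV n N g (Phi e0 u) = Phi e0 (u ∘ (g⁻¹ : Equiv.Perm (Fin N))) := by
  funext w
  rw [rhoV_apply]
  have h := Phi_comp e0 (u ∘ (g⁻¹ : Equiv.Perm (Fin N))) w g
  have e : (u ∘ (g⁻¹ : Equiv.Perm (Fin N))) ∘ g = u := by funext t; simp
  rw [e] at h
  rw [h, ← mul_assoc, sgn_sq, one_mul]

/-- the span -/
def YY (e0 : Fin N ≃ Fin n × Fin n) : Subrepresentation (rhoV n N) where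
  toSubmodule := Submodule.span ℚ (Set.range (Phi e0))
  apply_mem_toSubmodule g v hv := by
    induction hv using Submodule.span_induction with
    | mem x hx =>
      obtain ⟨u, rfl⟩ := hx
      rw [rhoV_Phi]
      exact Submodule.subset_span ⟨_, rfl⟩
    | zero => simp
    | add x y _ _ hx hy => rw [map_add]; exact Submodule.add_mem _ hx hy
    | smul c x _ hx => rw [map_smul]; exact Submodule.smul_mem _ _ hx

/-- the representation on the span -/
def rhoY (e0 : Fin N ≃ Fin n × Fin n) : Representation ℚ (Equiv.Perm (Fin N)) (YY e0).toSubmodule :=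
  (YY e0).toRepresentation

lemma rhoY_coe (e0 : Fin N ≃ Fin n × Fin n) (g : Equiv.Perm (Fin N)) (f : (YY e0).toSubmodule) :
    ((rhoY e0 g f : (YY e0).toSubmodule) : (Fin N → Fin n) → ℚ) = rhoV n N g f.1 := rfl

/-- invariance under the stabilizer -/
def SInv (u : Fin N → Fin n) (f : (Fin N → Fin n) → ℚ) : Prop :=
  ∀ g : Equiv.Perm (Fin N), u ∘ g = u → rhoV n N g f = f

lemma SInv_supp (u : Fin N → Fin n) (f : (Fin N → Fin n) → ℚ) (hf : SInv u f) (w : Fin N → Fin n) (hw : f w ≠ 0) :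
    Function.Injective (fun t => (u t, w t)) := by
  intro s t hst
  simp only [Prod.mk.injEq] at hst
  by_contra hne
  have key : ∀ v : Fin N → Fin n, v s = v t → v ∘ Equiv.swap s t = v := by
    intro v hv
    funext x
    simp only [Function.comp_apply, Equiv.swap_apply_def]
    split_ifs with h1 h2
    · rw [h1, hv]
    · rw [h2, hv]
    · rfl
  have h := congrFun (hf (Equiv.swap s t) (key u hst.1)) w
  rw [rhoV_apply, key w hst.2, Equiv.Perm.sign_swap hne] at h
  apply hw
  simp at h
  linarith

lemma SInv_zero (u : Fin N → Fin n) (f : (Fin N → Fin n) → ℚ) (hf : SInv u f) (i : Fin n) (hi : n < cntA u i) :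
    f = 0 := by
  funext w
  by_contra hw
  have hinj := SInv_supp u f hf w hw
  have : (Finset.univ.filter fun t => u t = i).card ≤ (Finset.univ : Finset (Fin n)).card := by
    refine Finset.card_le_card_of_injOn w (by simp) ?_
    intro s hs t ht hst
    simp only [Finset.coe_filter, Finset.mem_univ, true_and, Set.mem_ofPred_eq] at hs ht
    exact hinj (by simp [hs, ht, hst])
  rw [Finset.card_univ, Fintype.card_fin] at this
  exact absurd hi (not_lt.mpr this)

lemma edge_exists (e0 : Fin N ≃ Fin n × Fin n) (u : Fin N → Fin n) (hu : ∀ i, cntA u i = n) :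
    ∃ w, Edge u w := by
  have h1 : cntA u = cntA (fun t => (e0 t).1) := by
    funext i
    rw [hu, ← cntA_fst]
    have : ∀ p, cntA (e0 : Fin N → Fin n × Fin n) p = 1 := by
      intro p
      rw [cntA, Finset.card_eq_one]
      exact ⟨e0.symm p, by ext t; simp [Equiv.eq_symm_apply]⟩
    simp [this]
  obtain ⟨g, hg⟩ := cntA_perm _ _ h1
  refine ⟨fun t => (e0 (g t)).2, ?_⟩
  have : (fun t => (u t, (e0 (g t)).2)) = e0 ∘ g := by
    funext t
    exact Prod.ext (congrFun hg t).symm rfl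
  rw [Edge, this]
  exact e0.bijective.comp g.bijective

lemma edge_cnt (u w : Fin N → Fin n) (h : Edge u w) (i : Fin n) : cntA u i = n := by
  have h1 : cntA u i = ∑ b, cntA (fun t => (u t, w t)) (i, b) := (cntA_fst (fun t => (u t, w t)) i).symm
  rw [h1]
  have : ∀ p, cntA (fun t => (u t, w t)) p = 1 := by
    intro p
    rw [cntA, Finset.card_eq_one]
    obtain ⟨t, ht⟩ := h.2 p
    refine ⟨t, ?_⟩
    ext s
    simp only [Finset.mem_filter, Finset.mem_univ, true_and, Finset.mem_singleton]
    rw [← ht]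
    exact h.1.eq_iff
  simp [this]

lemma Phi_SInv (e0 : Fin N ≃ Fin n × Fin n) (u : Fin N → Fin n) : SInv u (Phi e0 u) := by
  intro g hg
  rw [rhoV_Phi]
  congr 1
  funext t
  have := congrFun hg (g⁻¹ t)
  simpa using this.symm

lemma SInv_line (e0 : Fin N ≃ Fin n × Fin n) (u : Fin N → Fin n) (hu : ∀ i, cntA u i = n)
    (f : (Fin N → Fin n) → ℚ) (hf : SInv u f) : ∃ c : ℚ, c • Phi e0 u = f := by
  obtain ⟨w0, h0⟩ := edge_exists e0 u hu
  have hP : Phi e0 u w0 ≠ 0 := (Phi_edge e0 u w0).mpr h0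
  refine ⟨f w0 / Phi e0 u w0, ?_⟩
  funext w
  by_cases hw : Edge u w
  · set g : Equiv.Perm (Fin N) := (Equiv.ofBijective _ hw).trans (Equiv.ofBijective _ h0).symm with hgdef
    have hg : ∀ t, (u (g t), w0 (g t)) = (u t, w t) := by
      intro t
      have := (Equiv.ofBijective _ h0).apply_symm_apply (Equiv.ofBijective _ hw t)
      exact this
    have hgu : u ∘ g = u := funext fun t => congrArg Prod.fst (hg t)
    have hgw : w0 ∘ g = w := funext fun t => congrArg Prod.snd (hg t)
    have h1 := congrFun (hf g hgu) w0
    have h2 := congrFun (Phi_SInv e0 u g hgu) w0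
    rw [rhoV_apply, hgw] at h1 h2
    have h3 := sgn_sq g
    rw [Pi.smul_apply, smul_eq_mul, div_mul_eq_mul_div, div_eq_iff hP, ← h1, ← h2]
    ring
  · have h1 : Phi e0 u w = 0 := by
      by_contra h; exact hw ((Phi_edge e0 u w).mp h)
    have h2 : f w = 0 := by
      by_contra h
      apply hw
      rw [Edge, Fintype.bijective_iff_injective_and_card]
      exact ⟨SInv_supp u f hf w h, Fintype.card_congr e0⟩
    simp [h1, h2]

/-- stabilizer -/
def Stab (u : Fin N → Fin n) : Subgroup (Equiv.Perm (Fin N)) where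
  carrier := {g | u ∘ g = u}
  mul_mem' {a b} ha hb := by
    simp only [Set.mem_ofPred_eq] at *
    rw [Equiv.Perm.coe_mul, ← Function.comp_assoc, ha, hb]
  one_mem' := by simp
  inv_mem' {a} ha := by
    simp only [Set.mem_ofPred_eq] at *
    funext t
    have := congrFun ha (a⁻¹ t)
    simpa using this.symm

instance (u : Fin N → Fin n) : DecidablePred (· ∈ Stab u) := fun g => 
  inferInstanceAs (Decidable (u ∘ g = u))

/-- character of the span -/
noncomputable def chiY (e0 : Fin N ≃ Fin n × Fin n) (g : Equiv.Perm (Fin N)) : ℚ := (rhoY e0).character g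

lemma chiY_stab (e0 : Fin N ≃ Fin n × Fin n) (u : Fin N → Fin n) :
    ∑ g ∈ Finset.univ.filter (fun g : Equiv.Perm (Fin N) => u ∘ g = u), chiY e0 g =
    (Finset.univ.filter (fun g : Equiv.Perm (Fin N) => u ∘ g = u)).card *
      (Module.finrank ℚ (Representation.invariants ((rhoY e0).comp (Stab u).subtype)) : ℚ) := by
  have hc : (Nat.card (Stab u) : ℚ) ≠ 0 := by
    have : 0 < Nat.card (Stab u) := Nat.card_pos
    positivity
  have : Invertible (Nat.card (Stab u) : ℚ) := invertibleOfNonzero hc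
  have h := Representation.card_inv_mul_sum_char_eq_finrank ((rhoY e0).comp (Stab u).subtype)
  rw [inv_mul_eq_iff_eq_mul₀ hc] at h
  have h1 : (Finset.univ.filter (fun g : Equiv.Perm (Fin N) => u ∘ g = u)).card = Nat.card (Stab u) := by
    rw [← Fintype.card_subtype, Nat.card_eq_fintype_card]
    exact Fintype.card_congr (Equiv.refl _)
  rw [h1, ← h]
  exact Finset.sum_subtype _ (fun g => by simp [Stab]) _

lemma invariants_SInv (e0 : Fin N ≃ Fin n × Fin n) (u : Fin N → Fin n) (f : (YY e0).toSubmodule) :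
    f ∈ Representation.invariants ((rhoY e0).comp (Stab u).subtype) ↔ SInv u f.1 := by
  rw [Representation.mem_invariants]
  constructor
  · intro h g hg
    exact congrArg Subtype.val (h ⟨g, hg⟩)
  · intro h g
    exact Subtype.ext (h g.1 g.2)

lemma finrank_zero (e0 : Fin N ≃ Fin n × Fin n) (u : Fin N → Fin n) (i : Fin n) (hi : n < cntA u i) :
    Module.finrank ℚ (Representation.invariants ((rhoY e0).comp (Stab u).subtype)) = 0 := by
  have : Representation.invariants ((rhoY e0).comp (Stab u).subtype) = ⊥ := by
    rw [Submodule.eq_bot_iff]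
    intro f hf
    rw [invariants_SInv] at hf
    exact Subtype.ext (SInv_zero u _ hf i hi)
  rw [this, finrank_bot]

lemma finrank_one (e0 : Fin N ≃ Fin n × Fin n) (u : Fin N → Fin n) (hu : ∀ i, cntA u i = n) :
    Module.finrank ℚ (Representation.invariants ((rhoY e0).comp (Stab u).subtype)) = 1 := by
  have hm : Phi e0 u ∈ (YY e0).toSubmodule := Submodule.subset_span ⟨u, rfl⟩
  have hv : (⟨Phi e0 u, hm⟩ : (YY e0).toSubmodule) ∈ Representation.invariants ((rhoY e0).comp (Stab u).subtype) :=
    (invariants_SInv e0 u _).mpr (Phi_SInv e0 u)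
  obtain ⟨w0, h0⟩ := edge_exists e0 u hu
  have hP : Phi e0 u w0 ≠ 0 := (Phi_edge e0 u w0).mpr h0
  refine (finrank_eq_one_iff_of_nonzero' (⟨_, hv⟩ : Representation.invariants ((rhoY e0).comp (Stab u).subtype)) ?_).mpr ?_
  · intro h
    apply hP
    have := congrArg (fun x => (x.1.1 : (Fin N → Fin n) → ℚ) w0) h
    simpa using this
  · rintro ⟨f, hf⟩
    obtain ⟨c, hc⟩ := SInv_line e0 u hu f.1 ((invariants_SInv e0 u f).mp hf)
    exact ⟨c, Subtype.ext (Subtype.ext hc)⟩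

lemma finrank_end (e0 : Fin N ≃ Fin n × Fin n) :
    Module.finrank ℚ (Representation.IntertwiningMap (rhoY e0) (rhoY e0)) = 1 := by
  obtain ⟨u, hu⟩ : ∃ u : Fin N → Fin n, ∀ i, cntA u i = n := by
    obtain ⟨p, hp⟩ := cntA_exists (N := N) (fun _ : Fin n => n) (by
      have := Fintype.card_congr e0; simp at this; simp [this])
    exact ⟨p, fun i => congrFun hp i⟩
  have hm : ∀ u, Phi e0 u ∈ (YY e0).toSubmodule := fun u => Submodule.subset_span ⟨u, rfl⟩
  obtain ⟨w0, h0⟩ := edge_exists e0 u hu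
  have hP : Phi e0 u w0 ≠ 0 := (Phi_edge e0 u w0).mpr h0
  refine (finrank_eq_one_iff_of_nonzero' (⟨LinearMap.id, fun g => rfl⟩ : Representation.IntertwiningMap (rhoY e0) (rhoY e0)) ?_).mpr ?_
  · intro h
    apply hP
    have h1 := congrArg Representation.IntertwiningMap.toLinearMap h
    have h2 := LinearMap.congr_fun h1 ⟨Phi e0 u, hm u⟩
    have h3 := congrFun (congrArg Subtype.val h2) w0
    exact h3
  · rintro ⟨φ, hφ⟩
    have hcomm : ∀ g f, rhoY e0 g (φ f) = φ (rhoY e0 g f) := by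
      intro g f
      exact (LinearMap.congr_fun (hφ g) f).symm
    have hs : SInv u (φ ⟨Phi e0 u, hm u⟩).1 := by
      intro g hg
      rw [← rhoY_coe, hcomm]
      congr 2
      exact Subtype.ext (Phi_SInv e0 u g hg)
    obtain ⟨c, hc⟩ := SInv_line e0 u hu _ hs
    have hc : c • (⟨Phi e0 u, hm u⟩ : (YY e0).toSubmodule) = φ ⟨Phi e0 u, hm u⟩ := Subtype.ext hc
    refine ⟨c, Representation.IntertwiningMap.ext ?_⟩
    show c • LinearMap.id = φ
    have key : ∀ v, φ ⟨Phi e0 v, hm v⟩ = c • ⟨Phi e0 v, hm v⟩ := by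
      intro v
      by_cases hz : Phi e0 v = 0
      · have : (⟨Phi e0 v, hm v⟩ : (YY e0).toSubmodule) = 0 := Subtype.ext hz
        rw [this]; simp
      · obtain ⟨w, hw⟩ := Function.ne_iff.mp hz
        have hv := edge_cnt v w ((Phi_edge e0 v w).mp hw)
        obtain ⟨g, hg⟩ := cntA_perm v u (funext fun i => by rw [hv, hu])
        have e1 : (⟨Phi e0 v, hm v⟩ : (YY e0).toSubmodule) = rhoY e0 g⁻¹ ⟨Phi e0 u, hm u⟩ := by
          apply Subtype.ext
          rw [rhoY_coe, rhoV_Phi, inv_inv, hg]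
        rw [e1, ← hcomm, ← hc, map_smul]
    ext1 ⟨f, hf⟩
    induction hf using Submodule.span_induction with
    | mem x hx =>
      obtain ⟨v, rfl⟩ := hx
      exact (key v).symm
    | zero => 
      have : (⟨0, Submodule.zero_mem _⟩ : (YY e0).toSubmodule) = 0 := rfl
      rw [this]; simp
    | add x y hx hy h1 h2 =>
      have : (⟨x + y, Submodule.add_mem _ hx hy⟩ : (YY e0).toSubmodule) = ⟨x, hx⟩ + ⟨y, hy⟩ := rfl
      rw [this, map_add, map_add, h1, h2]
    | smul a x hx h1 =>
      have : (⟨a • x, Submodule.smul_mem _ a hx⟩ : (YY e0).toSubmodule) = a • ⟨x, hx⟩ := rfl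
      rw [this, map_smul, map_smul, h1]

lemma chiY_inv (e0 : Fin N ≃ Fin n × Fin n) (g : Equiv.Perm (Fin N)) : chiY e0 g⁻¹ = chiY e0 g := by
  have : IsConj g g⁻¹ := by rw [Equiv.Perm.isConj_iff_cycleType_eq, Equiv.Perm.cycleType_inv]
  obtain ⟨h, hh⟩ := isConj_iff.mp this
  rw [← hh, chiY, Representation.char_conj, chiY]

lemma chiY_norm (e0 : Fin N ≃ Fin n × Fin n) : ∑ g, chiY e0 g * chiY e0 g = (N.factorial : ℚ) := by
  have hc : (Nat.card (Equiv.Perm (Fin N)) : ℚ) = N.factorial := by simp [Nat.card_eq_fintype_card, Fintype.card_perm]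
  have hc0 : (Nat.card (Equiv.Perm (Fin N)) : ℚ) ≠ 0 := by rw [hc]; exact_mod_cast N.factorial_ne_zero
  have : Invertible (Nat.card (Equiv.Perm (Fin N)) : ℚ) := invertibleOfNonzero hc0
  have h := Representation.card_inv_mul_sum_char_mul_char_eq_finrank (rhoY e0) (rhoY e0)
  rw [finrank_end, inv_mul_eq_iff_eq_mul₀ hc0, hc] at h
  rw [Nat.cast_one, mul_one] at h
  rw [← h]
  refine Finset.sum_congr rfl fun g _ => ?_
  change _ = chiY e0 g * chiY e0 g⁻¹
  rw [chiY_inv]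

end

section
variable (k : ℕ)

lemma chiY_chiG (e0 : Fin ((k + 1) ^ 2) ≃ Fin (k + 1) × Fin (k + 1)) :
    ∑ g, chiY e0 g * (chiG k g : ℚ) = (((k + 1) ^ 2).factorial : ℚ) := by
  have h1 : ∀ σ : Equiv.Perm (Fin (k + 1)), ∑ g : Equiv.Perm (Fin ((k + 1) ^ 2)), chiY e0 g *
      ((Finset.univ.filter fun u : Fin ((k + 1) ^ 2) → Fin (k + 1) => Cont k σ u ∧ u ∘ g = u).card : ℚ) =
      if σ = 1 then (((k + 1) ^ 2).factorial : ℚ) else 0 := by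
    intro σ
    have h2 : ∀ g : Equiv.Perm (Fin ((k + 1) ^ 2)), chiY e0 g *
      ((Finset.univ.filter fun u : Fin ((k + 1) ^ 2) → Fin (k + 1) => Cont k σ u ∧ u ∘ g = u).card : ℚ) =
      ∑ u ∈ Finset.univ.filter (fun u : Fin ((k + 1) ^ 2) → Fin (k + 1) => Cont k σ u), 
        if u ∘ g = u then chiY e0 g else 0 := by
      intro g
      rw [← Finset.sum_filter, Finset.filter_filter, Finset.sum_const, nsmul_eq_mul, mul_comm]
    rw [Finset.sum_congr rfl fun g _ => h2 g, Finset.sum_comm]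
    have h3 : ∀ u : Fin ((k + 1) ^ 2) → Fin (k + 1), (∑ g : Equiv.Perm (Fin ((k + 1) ^ 2)), if u ∘ g = u then chiY e0 g else 0) =
        (Finset.univ.filter (fun g : Equiv.Perm (Fin ((k + 1) ^ 2)) => u ∘ g = u)).card *
      (Module.finrank ℚ (Representation.invariants ((rhoY e0).comp (Stab u).subtype)) : ℚ) := by
      intro u
      rw [← chiY_stab, Finset.sum_filter]
    rw [Finset.sum_congr rfl fun u _ => h3 u]
    split_ifs with hσ
    · subst hσ
      rw [← stab_sum (A := Fin (k + 1)) (fun _ => k + 1) (by simp [sq])]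
      push_cast
      have e : (Finset.univ.filter (fun u : Fin ((k + 1) ^ 2) → Fin (k + 1) => Cont k 1 u)) =
          Finset.univ.filter (fun u => cntA u = fun _ => k + 1) := by
        refine Finset.filter_congr fun u _ => ?_
        rw [funext_iff]
        refine forall_congr' fun i => ?_
        simp [mu]
      rw [e]
      refine Finset.sum_congr rfl fun u hu => ?_
      rw [finrank_one]
      · simp
      · simp only [Finset.mem_filter, Finset.mem_univ, true_and] at hu
        exact fun i => congrFun hu i
    · refine Finset.sum_eq_zero fun u hu => ?_
      simp only [Finset.mem_filter, Finset.mem_univ, true_and] at hu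
      rw [← mu_one] at hσ
      push Not at hσ
      obtain ⟨i, hi⟩ := hσ
      rw [finrank_zero e0 u i (by rw [hu i]; exact hi)]
      simp
  have h4 : ∀ g, chiY e0 g * (chiG k g : ℚ) = ∑ σ : Equiv.Perm (Fin (k + 1)), ((Equiv.Perm.sign σ : ℤ) : ℚ) * (chiY e0 g *
      ((Finset.univ.filter fun u : Fin ((k + 1) ^ 2) → Fin (k + 1) => Cont k σ u ∧ u ∘ g = u).card : ℚ)) := by
    intro g
    rw [chiG]; push_cast
    rw [Finset.mul_sum]
    refine Finset.sum_congr rfl fun σ _ => by ring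
  rw [Finset.sum_congr rfl fun g _ => h4 g, Finset.sum_comm]
  simp only [← Finset.mul_sum]
  rw [Finset.sum_congr rfl fun σ _ => by rw [h1 σ]]
  simp

theorem chiY_eq (e0 : Fin ((k + 1) ^ 2) ≃ Fin (k + 1) × Fin (k + 1)) (g : Equiv.Perm (Fin ((k + 1) ^ 2))) :
    chiY e0 g = chiG k g := by
  have h1 : ∑ g, (chiG k g : ℚ) * (chiG k g : ℚ) = (((k + 1) ^ 2).factorial : ℚ) := by
    exact_mod_cast chiG_norm k
  have h2 : ∑ g, (chiY e0 g - chiG k g) ^ 2 = 0 := by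
    have : ∀ g, (chiY e0 g - chiG k g) ^ 2 = chiY e0 g * chiY e0 g - 2 * (chiY e0 g * chiG k g) + chiG k g * chiG k g :=
      fun g => by ring
    rw [Finset.sum_congr rfl fun g _ => this g, Finset.sum_add_distrib, Finset.sum_sub_distrib, ← Finset.mul_sum,
      h1, chiY_norm, chiY_chiG]
    ring
  rw [Finset.sum_eq_zero_iff_of_nonneg (fun _ _ => sq_nonneg _)] at h2
  have := h2 g (Finset.mem_univ g)
  rw [sq_eq_zero_iff, sub_eq_zero] at this
  exact this

end

end BnCSP

namespace BnCSP

/-! ### Part F4 : rotation -/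

section
variable {n N : ℕ}

lemma Phi_renumber (e0 : Fin N ≃ Fin n × Fin n) (σ : Equiv.Perm (Fin n)) (u w : Fin N → Fin n) :
    Phi e0 (σ ∘ u) w = ((Equiv.Perm.sign σ : ℤ) : ℚ) ^ n * Phi e0 u w := by
  set τ : Equiv.Perm (Fin N) := (e0.trans (Equiv.prodCongrLeft (fun _ : Fin n => σ⁻¹))).trans e0.symm with hτ
  have h := Matrix.det_permute' τ (Matrix.of fun t s : Fin N => if (u t, w t) = e0 s then (1 : ℚ) else 0)
  have hs : Equiv.Perm.sign τ = Equiv.Perm.sign σ ^ n := by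
    have h1 : τ = (e0.symm).permCongr (Equiv.prodCongrLeft (fun _ : Fin n => σ⁻¹)) := by
      ext t; simp [hτ, Equiv.permCongr_apply]
    rw [h1, Equiv.Perm.sign_permCongr, Equiv.Perm.sign_prodCongrLeft]
    simp
  rw [hs] at h
  rw [Phi, Phi]
  push_cast at h
  rw [← h]
  congr 1
  ext t s
  simp only [Matrix.of_apply, Matrix.submatrix_apply, id, Function.comp]
  have : (σ (u t), w t) = e0 s ↔ (u t, w t) = e0 (τ s) := by
    rw [hτ]
    simp only [Equiv.trans_apply, Equiv.apply_symm_apply]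
    rw [← Equiv.symm_apply_eq (Equiv.prodCongrLeft fun _ : Fin n => σ⁻¹)]
    constructor
    · intro h; rw [← h]; rfl
    · intro h; rw [← h]; rfl
  simp only [this]

end

section
variable {n : ℕ} [NeZero n]

/-- cyclic shift -/
def cp (n : ℕ) [NeZero n] (d : ℕ) : Equiv.Perm (Fin (n ^ 2)) := Equiv.addRight (Fin.ofNat (n ^ 2) d)

lemma cp_apply (d : ℕ) (t : Fin (n ^ 2)) : cp n d t = t + Fin.ofNat (n ^ 2) d := rfl

lemma ofNat_succ' (d : ℕ) : Fin.ofNat (n ^ 2) (d + 1) = 1 + Fin.ofNat (n ^ 2) d := by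
  ext; simp [Fin.val_add, add_comm]

lemma upF_iter (u : Fin (n ^ 2) → Fin n) (hu : u ∈ RF n) (d : ℕ) :
    upF (rot^[d] u) = wp (pe u) d ∘ upF u ∘ cp n d := by
  induction d with
  | zero => funext t; simp [wp, cp]
  | succ d ih =>
    funext t
    rw [Function.iterate_succ_apply', upF_rot _ (RF_rot_iter u hu d), ih, rot_iter]
    simp only [Function.comp, wp, Equiv.Perm.coe_mul, cp_apply, zero_add, ofNat_succ', add_assoc]
    rfl

lemma wp_mul (u : Fin (n ^ 2) → Fin n) (d : ℕ) (hd : rot^[d] u = u) (m : ℕ) :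
    wp (pe u) (m * d) = wp (pe u) d ^ m := by
  induction m with
  | zero => simp [wp]
  | succ m ih =>
    have h := wp_shift (pe u) d (m * d)
    have e : (fun s => pe u (s + d)) = pe u := by
      funext s
      have := congrFun hd (Fin.ofNat (n ^ 2) s)
      rw [rot_iter] at this
      simp only [pe]
      rw [← this]
      congr 1
      ext; simp [Fin.val_add]
    rw [e, ih] at h
    rw [add_mul, one_mul, ← h]
    exact (pow_succ _ _).symm

lemma sign_fix (u : Fin (n ^ 2) → Fin n) (hu : u ∈ RF n) (d : ℕ) (hd : rot^[d] u = u) :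
    ((Equiv.Perm.sign (wp (pe u) d) : ℤ) : ℚ) ^ n = 1 := by
  have hp : ∀ m, wp (pe u) (m * n ^ 2) = 1 := by
    intro m
    induction m with
    | zero => simp [wp]
    | succ m ih => rw [add_mul, one_mul, wp_per u hu, ih]
  have h := wp_mul u d hd (n ^ 2)
  rw [mul_comm, hp] at h
  have h2 := congrArg Equiv.Perm.sign h
  rw [map_pow, map_one] at h2
  rcases Int.units_eq_one_or (Equiv.Perm.sign (wp (pe u) d)) with hs | hs
  · simp [hs]
  · rw [hs] at h2 ⊢
    rcases Nat.even_or_odd n with hn | hn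
    · simp [hn.neg_one_pow]
    · rw [Odd.neg_one_pow (hn.pow)] at h2
      exact absurd h2 (by decide)

lemma rho_rot (e0 : Fin (n ^ 2) ≃ Fin n × Fin n) (u : Fin (n ^ 2) → Fin n) (hu : u ∈ RF n) (d : ℕ) :
    rhoV n (n ^ 2) (cp n d)⁻¹ (Phi e0 (upF u)) =
      ((Equiv.Perm.sign (wp (pe u) d) : ℤ) : ℚ) ^ n • Phi e0 (upF (rot^[d] u)) := by
  rw [rhoV_Phi, inv_inv, upF_iter u hu]
  funext w
  rw [Pi.smul_apply, Phi_renumber, smul_eq_mul, ← mul_assoc, ← mul_pow, sgn_sq, one_pow, one_mul]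

end

lemma chiG_inv (k : ℕ) (g : Equiv.Perm (Fin ((k + 1) ^ 2))) : chiG k g⁻¹ = chiG k g := by
  rw [chiG, chiG]
  refine Finset.sum_congr rfl fun σ _ => ?_
  congr 3
  refine Finset.filter_congr fun u _ => and_congr_right fun _ => ?_
  have key : ∀ h : Equiv.Perm (Fin ((k + 1) ^ 2)), u ∘ h = u → u ∘ (h⁻¹ : Equiv.Perm _) = u := by
    intro h hh
    funext t
    have := congrFun hh (h⁻¹ t)
    simpa using this.symm
  exact ⟨fun h => by simpa using key _ h, key g⟩

theorem fix_count (k d : ℕ) :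
    (((RF (k + 1)).filter fun u => rot^[d] u = u).card : ℤ) = chiG k (cp (k + 1) d) := by
  have e0 : Fin ((k + 1) ^ 2) ≃ Fin (k + 1) × Fin (k + 1) := Fintype.equivOfCardEq (by simp [sq])
  have hfin : Module.finrank ℚ (YY e0).toSubmodule = (RF (k + 1)).card := by
    have h1 : chiY e0 1 = Module.finrank ℚ (YY e0).toSubmodule := by
      rw [chiY, Representation.char_one]
    rw [chiY_eq, chiG_one, ← card_RF] at h1
    exact_mod_cast h1.symm
  have hm : ∀ u, Phi e0 u ∈ (YY e0).toSubmodule := fun u => Submodule.subset_span ⟨u, rfl⟩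
  have hli : LinearIndependent ℚ (fun u : RF (k + 1) => (⟨Phi e0 (upF u.1), hm _⟩ : (YY e0).toSubmodule)) := by
    apply LinearIndependent.of_comp (YY e0).toSubmodule.subtype
    exact indep e0
  have : Nonempty (RF (k + 1)) := by
    rw [← Fintype.card_pos_iff, Fintype.card_coe]
    by_contra h
    have h0 : (RF (k + 1)).card = 0 := by omega
    obtain ⟨u, hu⟩ : ∃ u : Fin ((k + 1) ^ 2) → Fin (k + 1), ∀ i, cntA u i = k + 1 := by
      obtain ⟨p, hp⟩ := cntA_exists (N := (k + 1) ^ 2) (fun _ : Fin (k + 1) => k + 1) (by simp [sq])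
      exact ⟨p, fun i => congrFun hp i⟩
    obtain ⟨w0, hw0⟩ := edge_exists e0 u hu
    rw [h0] at hfin
    rw [Module.finrank_zero_iff] at hfin
    have := hfin.elim ⟨Phi e0 u, hm u⟩ 0
    exact (Phi_edge e0 u w0).mpr hw0 (congrFun (congrArg Subtype.val this) w0)
  let b := basisOfLinearIndependentOfCardEqFinrank hli (by rw [hfin, Fintype.card_coe])
  have hb : ∀ u, b u = ⟨Phi e0 (upF u.1), hm _⟩ := fun u => by simp [b]
  have htr : chiY e0 (cp (k + 1) d)⁻¹ = ∑ u : RF (k + 1), if rot^[d] u.1 = u.1 then (1 : ℚ) else 0 := by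
    rw [chiY, Representation.character, LinearMap.trace_eq_matrix_trace ℚ b, Matrix.trace]
    refine Finset.sum_congr rfl fun u _ => ?_
    rw [Matrix.diag_apply, LinearMap.toMatrix_apply]
    have h1 : rhoY e0 (cp (k + 1) d)⁻¹ (b u) =
        ((Equiv.Perm.sign (wp (pe u.1) d) : ℤ) : ℚ) ^ (k + 1) • b ⟨rot^[d] u.1, RF_rot_iter _ u.2 d⟩ := by
      apply Subtype.ext
      rw [rhoY_coe, hb, hb]
      exact rho_rot e0 u.1 u.2 d
    rw [h1, map_smul, Module.Basis.repr_self]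
    simp only [Finsupp.smul_apply, Finsupp.single_apply, smul_eq_mul]
    by_cases hd : rot^[d] u.1 = u.1
    · rw [if_pos hd, if_pos (Subtype.ext hd), sign_fix u.1 u.2 d hd, one_mul]
    · rw [if_neg hd, if_neg (fun h => hd (congrArg Subtype.val h)), mul_zero]
  rw [chiY_eq, chiG_inv, Finset.sum_coe_sort (RF (k + 1)) (fun u => if rot^[d] u = u then (1 : ℚ) else 0), Finset.sum_boole] at htr
  exact_mod_cast htr.symm

end BnCSP

namespace BnCSP

/-! ### Part G1 : the hook quotient -/

section
variable {M : Type*} [CommMonoid M]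

lemma tri1 (g : ℕ → M) (n : ℕ) : ∏ i ∈ Finset.range n, ∏ l ∈ Finset.range i, g l = ∏ l ∈ Finset.range n, g l ^ (n - 1 - l) := by
  induction n with
  | zero => simp
  | succ n ih =>
    rw [Finset.prod_range_succ, ih, Finset.prod_range_succ, ← Finset.prod_mul_distrib]
    simp only [Nat.add_sub_cancel, Nat.sub_self, pow_zero, mul_one]
    refine Finset.prod_congr rfl fun l hl => ?_
    rw [Finset.mem_range] at hl
    rw [← pow_succ]; congr 1; omega

lemma square_split (f : ℕ → M) (n : ℕ) : ∏ i ∈ Finset.range n, ∏ j ∈ Finset.range n, f (i + j + 1) =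
    f n ^ n * ∏ i ∈ Finset.Icc 1 (n - 1), (f i * f (2 * n - i)) ^ i := by
  have h1 : ∀ i ∈ Finset.range n, ∏ j ∈ Finset.range n, f (i + j + 1) =
      (∏ j ∈ Finset.range (n - i), f (i + j + 1)) * ∏ l ∈ Finset.range i, f (n + l + 1) := by
    intro i hi
    rw [Finset.mem_range] at hi
    conv_lhs => rw [show n = (n - i) + i by omega, Finset.prod_range_add]
    congr 1
    refine Finset.prod_congr rfl fun l _ => ?_
    congr 1; omega
  rw [Finset.prod_congr rfl h1, Finset.prod_mul_distrib, tri1]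
  have h2 : ∏ i ∈ Finset.range n, ∏ j ∈ Finset.range (n - i), f (i + j + 1) =
      f n ^ n * ∏ l ∈ Finset.range n, f (n - 1 - l) ^ (n - 1 - l) := by
    have h3 : ∏ i ∈ Finset.range n, ∏ j ∈ Finset.range (n - i), f (i + j + 1) = 
        ∏ i ∈ Finset.range n, (f n * ∏ l ∈ Finset.range i, f (n - 1 - l)) := by
      rw [← Finset.prod_range_reflect]
      refine Finset.prod_congr rfl fun i hi => ?_
      rw [Finset.mem_range] at hi
      rw [show n - (n - 1 - i) = i + 1 by omega, Finset.prod_range_succ, mul_comm]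
      congr 1
      · congr 1; omega
      · rw [← Finset.prod_range_reflect]
        refine Finset.prod_congr rfl fun j hj => ?_
        rw [Finset.mem_range] at hj
        congr 1; omega
    rw [h3, Finset.prod_mul_distrib, tri1]; simp
  rw [h2, mul_assoc, ← Finset.prod_mul_distrib]
  congr 1
  rcases n with _ | n
  · simp
  simp only [Nat.add_sub_cancel]
  have h4 : ∏ i ∈ Finset.Icc 1 n, (f i * f (2 * (n + 1) - i)) ^ i = 
      ∏ i ∈ Finset.range (n + 1), (f i * f (2 * (n + 1) - i)) ^ i := by
    rw [Finset.prod_range_succ', pow_zero, mul_one, Finset.range_eq_Ico,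
      Finset.prod_Ico_add' (fun i => (f i * f (2 * (n + 1) - i)) ^ i) 0 n 1]
    rfl
  rw [h4, ← Finset.prod_range_reflect (fun i => (f i * f (2 * (n + 1) - i)) ^ i)]
  refine Finset.prod_congr rfl fun i hi => ?_
  rw [Finset.mem_range] at hi
  rw [mul_pow]
  simp only [Nat.add_sub_cancel]
  congr 3; omega

lemma per_one (g : ℕ → M) (K : ℕ) (hg : ∀ x, g (x + K) = g x) (c : ℕ) :
    ∏ j ∈ Finset.range K, g (j + c) = ∏ j ∈ Finset.range K, g j := by
  induction c with
  | zero => simp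
  | succ c ih =>
    rw [← ih]
    rcases K with _ | K
    · simp
    rw [Finset.prod_range_succ, Finset.prod_range_succ']
    congr 1
    · refine Finset.prod_congr rfl fun j _ => ?_
      congr 1; ring
    · rw [zero_add, ← hg c]; congr 1; ring

lemma per_mul (g : ℕ → M) (K : ℕ) (hg : ∀ x, g (x + K) = g x) (c q : ℕ) :
    ∏ j ∈ Finset.range (q * K), g (j + c) = (∏ j ∈ Finset.range K, g j) ^ q := by
  induction q with
  | zero => simp
  | succ q ih =>
    rw [add_mul, one_mul, Finset.prod_range_add, ih, pow_succ]
    congr 1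
    rw [← per_one g K hg (q * K + c)]
    refine Finset.prod_congr rfl fun j _ => ?_
    congr 1; ring

end

lemma sum_per_mul (g : ℕ → ℕ) (K : ℕ) (hg : ∀ x, g (x + K) = g x) (c q : ℕ) :
    ∑ j ∈ Finset.range (q * K), g (j + c) = q • ∑ j ∈ Finset.range K, g j :=
  per_mul (M := Multiplicative ℕ) (fun x => Multiplicative.ofAdd (g x)) K (fun x => by rw [hg]) c q

/-- indicator of divisibility -/
def dv (K h : ℕ) : ℕ := if K ∣ h then 1 else 0

lemma dv_per (K x : ℕ) : dv K (x + K) = dv K x := by simp [dv]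

lemma dv_sum (K : ℕ) (hK : 0 < K) : ∑ j ∈ Finset.range K, dv K j = 1 := by
  rw [Finset.sum_eq_single 0]
  · simp [dv]
  · intro j hj h0
    rw [Finset.mem_range] at hj
    rw [dv, if_neg]
    intro h; exact absurd (Nat.le_of_dvd (by omega) h) (by omega)
  · simp [hK]

/-- number of cells with hook divisible by `K` -/
def hk (K n : ℕ) : ℕ := ∑ i ∈ Finset.range n, ∑ j ∈ Finset.range n, dv K (i + j + 1)

lemma dv_range (K : ℕ) (hK : 0 < K) (q c : ℕ) : ∑ j ∈ Finset.range (q * K), dv K (j + c) = q := by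
  rw [sum_per_mul (dv K) K (dv_per K) c q, dv_sum K hK, smul_eq_mul, mul_one]

lemma dv_range_add (K : ℕ) (hK : 0 < K) (q s c : ℕ) :
    ∑ j ∈ Finset.range (q * K + s), dv K (j + c) = q + ∑ j ∈ Finset.range s, dv K (j + c) := by
  rw [Finset.sum_range_add, dv_range K hK]
  congr 1
  refine Finset.sum_congr rfl fun j _ => ?_
  induction q with
  | zero => simp
  | succ q ih => rw [← ih, ← dv_per K (q * K + j + c)]; congr 1; ring

lemma hk_small (K s : ℕ) (hs : s < K) : hk K s ≤ 2 * s - K := by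
  rw [hk]
  have h1 : ∀ i ∈ Finset.range s, ∑ j ∈ Finset.range s, dv K (i + j + 1) ≤ if K - s ≤ i then 1 else 0 := by
    intro i hi
    rw [Finset.mem_range] at hi
    have h2 : ∀ j ∈ Finset.range s, dv K (i + j + 1) = if j = K - 1 - i then 1 else 0 := by
      intro j hj
      rw [Finset.mem_range] at hj
      rw [dv]
      congr 1
      rw [eq_iff_iff]
      constructor
      · rintro ⟨c, hc⟩
        have : c = 1 := by
          rcases c with _ | _ | c
          · omega
          · rfl
          · nlinarith
        subst this; omega
      · intro h; exact ⟨1, by omega⟩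
    rw [Finset.sum_congr rfl h2, Finset.sum_ite_eq']
    split_ifs with h3 h4
    · exact le_rfl
    · rw [Finset.mem_range] at h3; omega
    · omega
    · exact le_rfl
  refine (Finset.sum_le_sum h1).trans ?_
  rw [Finset.sum_boole]
  simp only [Nat.cast_id]
  have : (Finset.range s).filter (fun i => K - s ≤ i) = Finset.Ico (K - s) s := by
    ext i; simp only [Finset.mem_filter, Finset.mem_range, Finset.mem_Ico]; omega
  rw [this, Nat.card_Ico]
  omega

lemma hk_eq (K : ℕ) (hK : 0 < K) (q s : ℕ) : hk K (q * K + s) = (q * K + s) * q + s * q + hk K s := by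
  rw [hk]
  have h1 : ∀ i, ∑ j ∈ Finset.range (q * K + s), dv K (i + j + 1) = q + ∑ j ∈ Finset.range s, dv K (i + j + 1) := by
    intro i
    have := dv_range_add K hK q s (i + 1)
    simp only [show ∀ j, j + (i + 1) = i + j + 1 from fun j => by ring] at this
    exact this
  simp only [h1]
  rw [Finset.sum_add_distrib, Finset.sum_comm]
  have h2 : ∀ j, ∑ i ∈ Finset.range (q * K + s), dv K (i + j + 1) = q + ∑ i ∈ Finset.range s, dv K (i + j + 1) := by
    intro j
    exact dv_range_add K hK q s (j + 1)
  simp only [h2]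
  rw [Finset.sum_add_distrib, Finset.sum_comm, hk]
  simp [add_assoc]

lemma hk_lt (K : ℕ) (hK : 0 < K) (n : ℕ) : K * hk K n ≤ n ^ 2 ∧ (¬ K ∣ n → K * hk K n < n ^ 2) := by
  obtain ⟨q, s, hs, rfl⟩ : ∃ q s, s < K ∧ n = q * K + s :=
    ⟨n / K, n % K, Nat.mod_lt _ hK, by rw [mul_comm]; exact (Nat.div_add_mod n K).symm⟩
  rw [hk_eq K hK]
  have h1 := hk_small K s hs
  generalize hk K s = t at *
  have h2 : K * t ≤ s ^ 2 ∧ (0 < s → K * t < s ^ 2) := by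
    rcases Nat.lt_or_ge K (2 * s) with h | h
    · have h3 : t + K ≤ 2 * s := by omega
      obtain ⟨e, rfl⟩ := Nat.exists_eq_add_of_lt hs
      constructor
      · nlinarith
      · intro; nlinarith
    · have : t = 0 := by omega
      subst this
      constructor
      · positivity
      · intro h; positivity
  have h3 : (q * K + s) ^ 2 = K * ((q * K + s) * q + s * q) + s ^ 2 := by ring
  rw [h3, mul_add K _ t]
  refine ⟨by omega, fun hd => ?_⟩
  have : 0 < s := by
    rcases Nat.eq_zero_or_pos s with rfl | h
    · exact absurd (by simp) hd
    · exact h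
  have := h2.2 this
  omega

open Polynomial in
lemma qInt_cyc (h L : ℕ) (h0 : 0 < h) (hL : h ≤ L) :
    qInt h = ∏ K ∈ Finset.Icc 2 L, cyclotomic K ℤ ^ dv K h := by
  rw [qInt, ← prod_cyclotomic_eq_geom_sum h0]
  have : h.divisors.erase 1 = (Finset.Icc 2 L).filter (fun K => K ∣ h) := by
    ext K
    simp only [Finset.mem_erase, Nat.mem_divisors, Finset.mem_filter, Finset.mem_Icc]
    constructor
    · rintro ⟨h1, h2, _⟩
      have := Nat.pos_of_dvd_of_pos h2 h0
      have := Nat.le_of_dvd h0 h2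
      exact ⟨⟨by omega, by omega⟩, h2⟩
    · rintro ⟨h1, h2⟩
      exact ⟨by omega, h2, by omega⟩
  rw [this, Finset.prod_filter]
  refine Finset.prod_congr rfl fun K _ => ?_
  rw [dv]; split_ifs <;> simp

/-- the denominator -/
noncomputable def qDen (n : ℕ) : Polynomial ℤ := ∏ i ∈ Finset.range n, ∏ j ∈ Finset.range n, qInt (i + j + 1)

/-- number of multiples of `K` up to `N` -/
def nk (K N : ℕ) : ℕ := ∑ h ∈ Finset.range N, dv K (h + 1)

open Polynomial in
lemma qDen_cyc (n L : ℕ) (hL : 2 * n ≤ L) : qDen n = ∏ K ∈ Finset.Icc 2 L, cyclotomic K ℤ ^ hk K n := by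
  rw [qDen]
  have : ∀ i ∈ Finset.range n, ∏ j ∈ Finset.range n, qInt (i + j + 1) =
      ∏ K ∈ Finset.Icc 2 L, cyclotomic K ℤ ^ ∑ j ∈ Finset.range n, dv K (i + j + 1) := by
    intro i hi
    rw [Finset.mem_range] at hi
    simp only [← Finset.prod_pow_eq_pow_sum]
    rw [Finset.prod_comm]
    refine Finset.prod_congr rfl fun j hj => ?_
    rw [Finset.mem_range] at hj
    exact qInt_cyc _ L (by omega) (by omega)
  rw [Finset.prod_congr rfl this, Finset.prod_comm]
  refine Finset.prod_congr rfl fun K _ => ?_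
  rw [Finset.prod_pow_eq_pow_sum, hk]

open Polynomial in
lemma qFact_cyc (N L : ℕ) (hL : N ≤ L) : qFact N = ∏ K ∈ Finset.Icc 2 L, cyclotomic K ℤ ^ nk K N := by
  rw [qFact]
  have : ∀ i ∈ Finset.range N, qInt (i + 1) =
      ∏ K ∈ Finset.Icc 2 L, cyclotomic K ℤ ^ dv K (i + 1) := by
    intro i hi
    rw [Finset.mem_range] at hi
    exact qInt_cyc _ L (by omega) (by omega)
  rw [Finset.prod_congr rfl this, Finset.prod_comm]
  refine Finset.prod_congr rfl fun K _ => ?_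
  rw [Finset.prod_pow_eq_pow_sum, nk]

lemma hk_le_nk (K : ℕ) (hK : 0 < K) (n : ℕ) : hk K n ≤ nk K (n ^ 2) := by
  have h1 := (hk_lt K hK n).1
  have h2 : hk K n ≤ n ^ 2 / K := by
    rw [Nat.le_div_iff_mul_le hK, mul_comm]; exact h1
  refine h2.trans ?_
  rw [nk]
  calc n ^ 2 / K = ∑ j ∈ Finset.range (n ^ 2 / K * K), dv K (j + 1) := (dv_range K hK _ 1).symm
    _ ≤ _ := Finset.sum_le_sum_of_subset (Finset.range_mono (Nat.div_mul_le_self _ _))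

open Polynomial in
lemma qHook_cyc (n : ℕ) : qHookSquare n =
    ∏ K ∈ Finset.Icc 2 (2 * n + n ^ 2), cyclotomic K ℤ ^ (nk K (n ^ 2) - hk K n) := by
  rw [qHookSquare, ← square_split qInt n]
  change qFact (n ^ 2) /ₘ qDen n = _
  have hm : (qDen n).Monic := by
    rw [qDen_cyc n _ le_rfl]
    exact monic_prod_of_monic _ _ fun K _ => (cyclotomic.monic K ℤ).pow _
  have : qFact (n ^ 2) = qDen n * ∏ K ∈ Finset.Icc 2 (2 * n + n ^ 2), cyclotomic K ℤ ^ (nk K (n ^ 2) - hk K n) := by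
    rw [qDen_cyc n (2 * n + n ^ 2) (by omega), qFact_cyc (n ^ 2) (2 * n + n ^ 2) (by omega), ← Finset.prod_mul_distrib]
    refine Finset.prod_congr rfl fun K hK => ?_
    rw [Finset.mem_Icc] at hK
    rw [← pow_add, Nat.add_sub_cancel' (hk_le_nk K (by omega) n)]
  rw [this, mul_divByMonic_cancel_left _ hm]

open Polynomial in
lemma qHook_mul (n : ℕ) : qDen n * qHookSquare n = qFact (n ^ 2) := by
  rw [qHook_cyc, qDen_cyc n (2 * n + n ^ 2) (by omega), qFact_cyc (n ^ 2) (2 * n + n ^ 2) (by omega), ← Finset.prod_mul_distrib]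
  refine Finset.prod_congr rfl fun K hK => ?_
  rw [Finset.mem_Icc] at hK
  rw [← pow_add, Nat.add_sub_cancel' (hk_le_nk K (by omega) n)]

open Polynomial in
lemma qHook_zero (n K : ℕ) (h1 : K ∣ n ^ 2) (h2 : ¬ K ∣ n) (η : ℂ) (hη : IsPrimitiveRoot η K) :
    aeval η (qHookSquare n) = 0 := by
  have hn : 0 < n := by
    rcases Nat.eq_zero_or_pos n with rfl | h
    · simp at h2
    · exact h
  have hK : 0 < K := Nat.pos_of_dvd_of_pos h1 (by positivity)
  have hK1 : K ≠ 1 := by rintro rfl; exact h2 (one_dvd _)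
  have hle := Nat.le_of_dvd (by positivity) h1
  rw [qHook_cyc, map_prod]
  refine Finset.prod_eq_zero (i := K) (by rw [Finset.mem_Icc]; omega) ?_
  have h3 := (hk_lt K hK n).2 h2
  have h4 : nk K (n ^ 2) = n ^ 2 / K := by
    rw [nk]
    conv_lhs => rw [← Nat.div_mul_cancel h1]
    exact dv_range K hK _ 1
  have h5 : hk K n < nk K (n ^ 2) := by
    rw [h4]
    obtain ⟨c, hc⟩ := h1
    rw [hc, Nat.mul_div_cancel_left _ hK]
    rw [hc] at h3
    exact lt_of_mul_lt_mul_left h3 (by omega)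
  have h6 : aeval η (cyclotomic K ℤ) = 0 := by
    rw [aeval_def, eval₂_eq_eval_map, map_cyclotomic]
    exact hη.isRoot_cyclotomic hK
  rw [map_pow, h6, zero_pow (by omega)]

/-- reduced factor -/
noncomputable def qG (K h : ℕ) : Polynomial ℤ := if K ∣ h then (qInt (h / K)).comp (Polynomial.X ^ K) else qInt h

open Polynomial in
lemma qInt_mul (K j : ℕ) : qInt (K * j) = qInt K * (qInt j).comp (X ^ K) := by
  simp only [qInt]
  induction j with
  | zero => simp
  | succ j ih =>
    rw [Nat.mul_succ, Finset.sum_range_add, ih, Finset.sum_range_succ, add_comp, mul_add]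
    congr 1
    rw [X_pow_comp, ← pow_mul, Finset.sum_mul]
    refine Finset.sum_congr rfl fun i _ => ?_
    rw [← pow_add]; congr 1; ring

lemma qG_mul (K h : ℕ) : qInt h = qInt K ^ dv K h * qG K h := by
  rw [dv, qG]
  split_ifs with hd
  · obtain ⟨j, rfl⟩ := hd
    rcases Nat.eq_zero_or_pos K with rfl | hK
    · simp [qInt]
    · rw [Nat.mul_div_cancel_left _ hK, pow_one, qInt_mul]
  · simp

/-- prime-to part of the value -/
noncomputable def phiV (K : ℕ) (η : ℂ) (h : ℕ) : ℂ := if K ∣ h then 1 else ∑ i ∈ Finset.range h, η ^ i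

/-- the divisible part -/
noncomputable def psiV (K : ℕ) (h : ℕ) : ℂ := if K ∣ h then ((h / K : ℕ) : ℂ) else 1

open Polynomial in
lemma qG_eval (K h : ℕ) (η : ℂ) (hη : IsPrimitiveRoot η K) : aeval η (qG K h) = psiV K h * phiV K η h := by
  rw [qG, psiV, phiV]
  split_ifs with hd
  · rw [aeval_comp]
    simp [hη.pow_eq_one, qInt]
  · simp [qInt]

lemma phiV_per (K : ℕ) (η : ℂ) (hη : IsPrimitiveRoot η K) (hK : 0 < K) (x : ℕ) : phiV K η (x + K) = phiV K η x := by
  rw [phiV, phiV]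
  by_cases h : K ∣ x
  · rw [if_pos h, if_pos (by simpa using h)]
  · rw [if_neg h, if_neg (by simpa using h)]
    have hK1 : 1 < K := by
      rcases Nat.lt_or_ge 1 K with h1 | h1
      · exact h1
      · have : K = 1 := by omega
        subst this; simp at h
    rw [add_comm x K, Finset.sum_range_add, hη.geom_sum_eq_zero hK1, zero_add]
    refine Finset.sum_congr rfl fun i _ => ?_
    rw [pow_add, hη.pow_eq_one, one_mul]

lemma phiV_ne (K : ℕ) (η : ℂ) (hη : IsPrimitiveRoot η K) (x : ℕ) : phiV K η x ≠ 0 := by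
  rw [phiV]
  split_ifs with h
  · exact one_ne_zero
  · intro h0
    have h1 := geom_sum_mul η x
    rw [h0, zero_mul] at h1
    exact h (hη.dvd_of_pow_eq_one x (by linear_combination -h1))

open Polynomial in
lemma qHook_val (n K : ℕ) (hn : 0 < n) (h2 : K ∣ n) (η : ℂ) (hη : IsPrimitiveRoot η K) :
    (∏ i ∈ Finset.range n, ∏ j ∈ Finset.range n, psiV K (i + j + 1)) * aeval η (qHookSquare n) =
      ((n ^ 2 / K).factorial : ℂ) := by
  obtain ⟨m, rfl⟩ := h2
  have hK : 0 < K := Nat.pos_of_mul_pos_right hn |> fun h => by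
    rcases Nat.eq_zero_or_pos K with rfl | h
    · simp at hn
    · exact h
  have hN : (K * m) ^ 2 = (K * m * m) * K := by ring
  have hb : nk K ((K * m) ^ 2) = K * m * m := by rw [nk, hN, dv_range K hK]
  have ha : hk K (K * m) = K * m * m := by
    have := hk_eq K hK m 0
    rw [add_zero, mul_comm m K] at this
    rw [this]; simp [hk]
  have h3 := qHook_mul (K * m)
  have hD : qDen (K * m) = qInt K ^ (K * m * m) * ∏ i ∈ Finset.range (K * m), ∏ j ∈ Finset.range (K * m), qG K (i + j + 1) := by
    conv_rhs => rw [← ha, hk]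
    rw [qDen, ← Finset.prod_pow_eq_pow_sum, ← Finset.prod_mul_distrib]
    refine Finset.prod_congr rfl fun i _ => ?_
    rw [← Finset.prod_pow_eq_pow_sum, ← Finset.prod_mul_distrib]
    exact Finset.prod_congr rfl fun j _ => qG_mul K _
  have hF : qFact ((K * m) ^ 2) = qInt K ^ (K * m * m) * ∏ h ∈ Finset.range ((K * m) ^ 2), qG K (h + 1) := by
    conv_rhs => rw [← hb, nk]
    rw [qFact, ← Finset.prod_pow_eq_pow_sum, ← Finset.prod_mul_distrib]
    exact Finset.prod_congr rfl fun j _ => qG_mul K _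
  have hq : qInt K ^ (K * m * m) ≠ 0 := by
    apply pow_ne_zero
    intro h
    have := congrArg (eval 1) h
    simp [qInt] at this
    omega
  rw [hD, hF, mul_assoc] at h3
  have h4 := congrArg (aeval η) (mul_left_cancel₀ hq h3)
  simp only [map_mul, map_prod, qG_eval K _ η hη, Finset.prod_mul_distrib] at h4
  set P := ∏ j ∈ Finset.range K, phiV K η j with hP
  have hP0 : P ≠ 0 := Finset.prod_ne_zero_iff.mpr fun j _ => phiV_ne K η hη j
  have e1 : ∏ h ∈ Finset.range ((K * m) ^ 2), phiV K η (h + 1) = P ^ (K * m * m) := by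
    rw [hN, per_mul _ K (phiV_per K η hη hK)]
  have e2 : ∏ i ∈ Finset.range (K * m), ∏ j ∈ Finset.range (K * m), phiV K η (i + j + 1) = P ^ (K * m * m) := by
    have : ∀ i, ∏ j ∈ Finset.range (K * m), phiV K η (i + j + 1) = P ^ m := by
      intro i
      rw [mul_comm K m, ← per_mul _ K (phiV_per K η hη hK) (i + 1) m]
      refine Finset.prod_congr rfl fun j _ => ?_
      congr 1; ring
    simp only [this, Finset.prod_const, Finset.card_range]
    rw [← pow_mul]; congr 1; ring
  have e3 : ∏ h ∈ Finset.range ((K * m) ^ 2), psiV K (h + 1) = (((K * m) ^ 2 / K).factorial : ℂ) := by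
    rw [hN, Nat.mul_div_cancel _ hK]
    generalize K * m * m = r
    induction r with
    | zero => simp
    | succ r ih =>
      rw [add_mul, one_mul, Finset.prod_range_add, ih, Nat.factorial_succ, mul_comm]
      push_cast
      congr 1
      obtain ⟨L, rfl⟩ : ∃ L, K = L + 1 := ⟨K - 1, by omega⟩
      rw [Finset.prod_range_succ, Finset.prod_eq_one]
      · have : r * (L + 1) + L + 1 = (r + 1) * (L + 1) := by ring
        rw [this, psiV, if_pos (Dvd.intro_left _ rfl), Nat.mul_div_cancel _ hK]; simp
      · intro j hj
        rw [Finset.mem_range] at hj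
        rw [psiV, if_neg]
        rw [add_assoc, Nat.dvd_add_right (Dvd.intro_left _ rfl)]
        exact fun h => absurd (Nat.le_of_dvd (by omega) h) (by omega)
  rw [e1, e2, e3] at h4
  have h5 : P ^ (K * m * m) ≠ 0 := pow_ne_zero _ hP0
  apply mul_right_cancel₀ h5
  rw [← h4]; ring

end BnCSP

namespace BnCSP

/-! ### Part G2 : the character side -/

section
variable {A : Type*} [Fintype A] [DecidableEq A]

lemma cnt_multi {N : ℕ} (c : A → ℕ) (hc : ∑ a, c a = N) :
    (Finset.univ.filter fun p : Fin N → A => cntA p = c).card * ∏ a, (c a).factorial = N.factorial := by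
  rw [← stab_sum c hc, ← smul_eq_mul, ← Finset.sum_const]
  refine Finset.sum_congr rfl fun p hp => ?_
  have hp : cntA p = c := by simpa using hp
  rw [← Fintype.card_subtype, DomMulAct.stabilizer_card]
  refine Finset.prod_congr rfl fun a _ => ?_
  rw [← hp, cntA, Fintype.card_subtype]

lemma cntA_range {N : ℕ} (v : ℕ → A) (i : A) :
    cntA (fun t : Fin N => v t) i = ∑ t ∈ Finset.range N, if v t = i then 1 else 0 := by
  rw [cntA, Finset.card_filter, Finset.sum_range]

end

section
variable {n : ℕ} [NeZero n]

lemma per_gcd (u : Fin (n ^ 2) → Fin n) (d : ℕ) (h : u ∘ cp n d = u) (t : ℕ) :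
    pe u (t + Nat.gcd d (n ^ 2)) = pe u t := by
  have h1 : ∀ t, pe u (t + d) = pe u t := by
    intro t
    have := congrFun h (Fin.ofNat (n ^ 2) t)
    simp only [Function.comp, cp_apply] at this
    simp only [pe]
    rw [← this]
    congr 1
    ext; simp [Fin.val_add]
  have h2 : ∀ x t, pe u (t + d * x) = pe u t := by
    intro x
    induction x with
    | zero => simp
    | succ x ih => intro t; rw [Nat.mul_succ, ← add_assoc, h1, ih]
  have h3 : ∀ s t : ℕ, s ≡ t [MOD n ^ 2] → pe u s = pe u t := by
    intro s t hst
    simp only [pe]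
    congr 1
    ext; exact hst
  have hN : 0 < n ^ 2 := Nat.pos_of_neZero _
  rcases (Nat.le_of_dvd hN (Nat.gcd_dvd_right d (n ^ 2))).lt_or_eq with hl | he
  · obtain ⟨m, -, hm⟩ := Nat.exists_mul_mod_eq_gcd hl
    rw [← h2 m t]
    apply h3
    refine Nat.ModEq.add_left t ?_
    rw [← hm]
    exact Nat.mod_modEq _ _
  · rw [he, pe_per]

lemma per_mod (u : Fin (n ^ 2) → Fin n) (d : ℕ) (h : u ∘ cp n d = u) (t : ℕ) :
    pe u (t % Nat.gcd d (n ^ 2)) = pe u t := by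
  conv_rhs => rw [← Nat.mod_add_div t (Nat.gcd d (n ^ 2))]
  generalize t / Nat.gcd d (n ^ 2) = x
  induction x with
  | zero => simp
  | succ x ih => rw [Nat.mul_succ, ← add_assoc, per_gcd u d h, ih]

lemma fix_bij (d K : ℕ) (hK : Nat.gcd d (n ^ 2) * K = n ^ 2) (c : Fin n → ℕ) :
    (Finset.univ.filter fun u : Fin (n ^ 2) → Fin n => (∀ i, cntA u i = c i) ∧ u ∘ cp n d = u).card =
    (Finset.univ.filter fun v : Fin (Nat.gcd d (n ^ 2)) → Fin n => ∀ i, K * cntA v i = c i).card := by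
  have hN : 0 < n ^ 2 := Nat.pos_of_neZero _
  have hg : 0 < Nat.gcd d (n ^ 2) := Nat.gcd_pos_of_pos_right _ hN
  have hgl := Nat.le_of_dvd hN (Nat.gcd_dvd_right d (n ^ 2))
  have hdd := Nat.gcd_dvd_left d (n ^ 2)
  have hdn := Nat.gcd_dvd_right d (n ^ 2)
  have hper := fun u h t => per_mod (n := n) u d h t
  generalize hgg : Nat.gcd d (n ^ 2) = g at *
  have hcount : ∀ (v : Fin g → Fin n) (i : Fin n),
      cntA (fun t : Fin (n ^ 2) => v ⟨(t : ℕ) % g, Nat.mod_lt _ hg⟩) i = K * cntA v i := by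
    intro v i
    have h1 := cntA_range (N := n ^ 2) (fun t : ℕ => v ⟨t % g, Nat.mod_lt _ hg⟩) i
    have h2 := cntA_range (N := g) (fun t : ℕ => v ⟨t % g, Nat.mod_lt _ hg⟩) i
    have h3 := sum_per_mul (fun t : ℕ => if v ⟨t % g, Nat.mod_lt _ hg⟩ = i then 1 else 0) g (by intro x; simp) 0 K
    rw [h1, ← hK, mul_comm g K]
    simp only [add_zero] at h3
    rw [h3, ← h2, smul_eq_mul]
    congr 2
    funext t
    congr 1
    ext; simp [Nat.mod_eq_of_lt t.2]
  symm
  refine Finset.card_bij (fun v _ => fun t : Fin (n ^ 2) => v ⟨(t : ℕ) % g, Nat.mod_lt _ hg⟩) ?_ ?_ ?_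
  · intro v hv
    simp only [Finset.mem_filter, Finset.mem_univ, true_and] at hv ⊢
    refine ⟨fun i => by rw [hcount, hv], ?_⟩
    funext t
    simp only [Function.comp, cp_apply]
    congr 1
    ext
    simp only [Fin.val_add, Fin.val_ofNat]
    rw [Nat.mod_mod_of_dvd _ hdn, Nat.add_mod, Nat.mod_mod_of_dvd _ hdn, Nat.mod_eq_zero_of_dvd hdd]
    simp
  · intro v _ v' _ h
    funext s
    have := congrFun h ⟨s, by have := s.2; omega⟩
    simpa [Nat.mod_eq_of_lt s.2] using this
  · intro u hu
    simp only [Finset.mem_filter, Finset.mem_univ, true_and] at hu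
    have he : (fun t : Fin (n ^ 2) => (fun s : Fin g => pe u s) ⟨(t : ℕ) % g, Nat.mod_lt _ hg⟩) = u := by
      funext t
      have := hper u hu.2 t
      simp only [this, pe_val]
    refine ⟨fun s => pe u s, ?_, he⟩
    simp only [Finset.mem_filter, Finset.mem_univ, true_and]
    intro i
    rw [← hcount, he, hu.1]

end

/-- the determinant -/
def AM (n K : ℕ) : Matrix (Fin n) (Fin n) ℚ := Matrix.of fun i j =>
  if K ∣ n + i - j then 1 / (((n + i - j) / K).factorial : ℚ) else 0

lemma chi_det (k d K : ℕ) (hK : Nat.gcd d ((k + 1) ^ 2) * K = (k + 1) ^ 2) :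
    (chiG k (cp (k + 1) d) : ℚ) = (Nat.gcd d ((k + 1) ^ 2)).factorial * (AM (k + 1) K).det := by
  have hK0 : 0 < K := by
    rcases Nat.eq_zero_or_pos K with rfl | h
    · exfalso
      rw [mul_zero] at hK
      have : 0 < (k + 1) ^ 2 := by positivity
      omega
    · exact h
  rw [← Matrix.det_transpose, Matrix.det_apply', chiG, Finset.mul_sum]
  push_cast
  refine Finset.sum_congr rfl fun σ _ => ?_
  rw [mul_left_comm]
  congr 1
  have h1 := fix_bij (n := k + 1) d K hK (mu k σ)
  unfold Cont
  rw [h1]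
  by_cases hd : ∀ i, K ∣ mu k σ i
  · have h2 : ∑ i, mu k σ i / K = Nat.gcd d ((k + 1) ^ 2) := by
      apply Nat.eq_of_mul_eq_mul_left hK0
      rw [Finset.mul_sum, mul_comm K (Nat.gcd _ _), hK, ← mu_sum k σ]
      exact Finset.sum_congr rfl fun i _ => Nat.mul_div_cancel' (hd i)
    have h3 := cnt_multi (fun i => mu k σ i / K) h2
    have h4 : (Finset.univ.filter fun v : Fin (Nat.gcd d ((k + 1) ^ 2)) → Fin (k + 1) => ∀ i, K * cntA v i = mu k σ i) =
        Finset.univ.filter fun v : Fin (Nat.gcd d ((k + 1) ^ 2)) → Fin (k + 1) => cntA v = fun i => mu k σ i / K := by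
      refine Finset.filter_congr fun v _ => ?_
      rw [funext_iff]
      refine forall_congr' fun i => ?_
      obtain ⟨c, hc⟩ := hd i
      rw [hc, Nat.mul_div_cancel_left _ hK0]
      exact Nat.mul_right_inj hK0.ne'
    rw [h4, ← h3]
    push_cast
    rw [mul_assoc, ← Finset.prod_mul_distrib, Finset.prod_eq_one, mul_one]
    intro i _
    simp only [Matrix.transpose_apply, AM, Matrix.of_apply]
    rw [if_pos (show K ∣ k + 1 + (i:ℕ) - (σ i : ℕ) from hd i)]
    change _ * (1 / (((mu k σ i) / K).factorial : ℚ)) = 1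
    rw [mul_one_div_cancel]
    exact_mod_cast Nat.factorial_ne_zero _
  · push Not at hd
    obtain ⟨i, hi⟩ := hd
    have h5 : (Finset.univ.filter fun v : Fin (Nat.gcd d ((k + 1) ^ 2)) → Fin (k + 1) => ∀ i, K * cntA v i = mu k σ i) = ∅ := by
      rw [Finset.filter_eq_empty_iff]
      intro v _ h
      exact hi ⟨_, (h i).symm⟩
    rw [h5, Finset.prod_eq_zero (i := i) (Finset.mem_univ _)]
    · simp
    · simp only [Matrix.transpose_apply, AM, Matrix.of_apply]
      exact if_neg hi

lemma AM_zero (n K : ℕ) (hK : 0 < K) (hd : ¬ K ∣ n) : (AM n K).det = 0 := by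
  rw [← Matrix.det_transpose, Matrix.det_apply']
  refine Finset.sum_eq_zero fun σ _ => ?_
  by_contra hne
  have h0 : ∀ i, K ∣ n + i - σ i := by
    intro i
    by_contra hi
    apply hne
    rw [Finset.prod_eq_zero (i := i) (Finset.mem_univ _), mul_zero]
    simp only [Matrix.transpose_apply, AM, Matrix.of_apply]
    exact if_neg hi
  set q := n / K with hq
  set s := n % K with hs
  have hs0 : 0 < s := Nat.pos_of_ne_zero fun h => hd (Nat.dvd_of_mod_eq_zero h)
  have hsK : s < K := Nat.mod_lt _ hK
  have hn : n = K * q + s := (Nat.div_add_mod n K).symm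
  have hlt : ∀ j : Fin (q + 1), K * (j : ℕ) < n := by
    intro j
    have : K * (j : ℕ) ≤ K * q := Nat.mul_le_mul_left K (by omega)
    omega
  have hmod : ∀ j : Fin (q + 1), (σ ⟨K * j, hlt j⟩ : ℕ) % K = s := by
    intro j
    have h1 := h0 ⟨K * j, hlt j⟩
    have h2 := (σ ⟨K * j, hlt j⟩).2
    have h3 : (σ ⟨K * j, hlt j⟩ : ℕ) ≡ n + K * j [MOD K] := (Nat.modEq_iff_dvd' (by omega)).mpr h1
    rw [h3]
    simp [hs]
  have hlt2 : ∀ j : Fin (q + 1), (σ ⟨K * j, hlt j⟩ : ℕ) / K < q := by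
    intro j
    have h1 := Nat.div_add_mod (σ ⟨K * j, hlt j⟩ : ℕ) K
    rw [hmod] at h1
    have h2 := (σ ⟨K * j, hlt j⟩).2
    have h3 : K * ((σ ⟨K * j, hlt j⟩ : ℕ) / K) < K * q := by omega
    exact lt_of_mul_lt_mul_left h3 (by omega)
  obtain ⟨a, b, hab, he⟩ := Fintype.exists_ne_map_eq_of_card_lt
    (fun j : Fin (q + 1) => (⟨_, hlt2 j⟩ : Fin q)) (by simp)
  apply hab
  have he : (σ ⟨K * a, hlt a⟩ : ℕ) / K = (σ ⟨K * b, hlt b⟩ : ℕ) / K := congrArg Fin.val he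
  have ha := Nat.div_add_mod (σ ⟨K * a, hlt a⟩ : ℕ) K
  have hb := Nat.div_add_mod (σ ⟨K * b, hlt b⟩ : ℕ) K
  rw [hmod] at ha hb
  have : σ ⟨K * a, hlt a⟩ = σ ⟨K * b, hlt b⟩ := Fin.ext (by rw [← ha, ← hb, he])
  have := congrArg Fin.val (σ.injective this)
  simp only at this
  exact Fin.ext (Nat.eq_of_mul_eq_mul_left hK this)

lemma AM_one (m : ℕ) : (AM m 1).det * ∏ a ∈ Finset.range m, ((m + a).factorial : ℚ) = ∏ a ∈ Finset.range m, (a.factorial : ℚ) := by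
  have h1 : AM m 1 = Matrix.of fun i j : Fin m => (1 / ((m + i).factorial : ℚ)) *
      (Matrix.of fun i j : Fin m => (descPochhammer ℚ (j : ℕ)).eval (((m + i : ℕ) : ℚ))) i j := by
    ext i j
    simp only [AM, Matrix.of_apply, one_dvd, if_true, Nat.div_one]
    rw [descPochhammer_eval_eq_descFactorial]
    have hfd := Nat.factorial_mul_descFactorial (n := m + i) (k := j) (by omega)
    have hfp := Nat.factorial_pos (m + i)
    have f1 : (((m + i - j).factorial : ℕ) : ℚ) ≠ 0 := by exact_mod_cast Nat.factorial_ne_zero _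
    have f2 : (((m + i).descFactorial j : ℕ) : ℚ) ≠ 0 := by
      intro h
      rw [Nat.cast_eq_zero] at h
      rw [h, mul_zero] at hfd
      omega
    rw [← hfd]
    push_cast
    field_simp
  rw [h1, Matrix.det_mul_column, ← Matrix.det_eval_matrixOfPolynomials_eq_det_vandermonde
    (fun i : Fin m => (((m + i : ℕ) : ℚ))) (fun j : Fin m => descPochhammer ℚ (j : ℕ))
    (fun j => descPochhammer_natDegree ℚ j) (fun j => monic_descPochhammer ℚ j)]
  have h2 : (Matrix.vandermonde fun i : Fin m => (((m + i : ℕ) : ℚ))).det = ∏ a ∈ Finset.range m, (a.factorial : ℚ) := by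
    have : (fun i : Fin m => (((m + i : ℕ) : ℚ))) = fun i : Fin m => ((i : ℕ) : ℚ) + (m : ℚ) := by
      funext i; push_cast; ring
    rw [this, Matrix.det_vandermonde_add]
    rcases m with _ | m
    · simp
    · rw [Matrix.det_vandermonde_id_eq_superFactorial, ← Nat.prod_range_succ_factorial]
      push_cast
      rfl
  rw [h2, ← Fin.prod_univ_eq_prod_range (fun a => ((m + a).factorial : ℚ)) m, mul_right_comm, ← Finset.prod_mul_distrib, Finset.prod_eq_one, one_mul]
  intro i _
  exact one_div_mul_cancel (by exact_mod_cast Nat.factorial_ne_zero _)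

lemma AM_block (m K : ℕ) (hK : 0 < K) : (AM (m * K) K).det = (AM m 1).det ^ K := by
  have h1 : (AM (m * K) K).submatrix finProdFinEquiv finProdFinEquiv = Matrix.blockDiagonal (fun _ : Fin K => AM m 1) := by
    ext ⟨a, r⟩ ⟨b, s⟩
    simp only [Matrix.submatrix_apply, AM, Matrix.of_apply, Matrix.blockDiagonal_apply, finProdFinEquiv_apply_val, one_dvd, if_true, Nat.div_one]
    by_cases hrs : r = s
    · subst hrs
      rw [if_pos rfl]
      have e : m * K + ((r : ℕ) + K * a) - (r + K * b) = (m + a - b) * K := by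
        have hb : (b : ℕ) ≤ m + a := by omega
        obtain ⟨c, hc⟩ := Nat.exists_eq_add_of_le hb
        have : m * K + ((r : ℕ) + K * a) = (b + c) * K + r := by rw [← hc]; ring
        rw [this, hc]
        have : ((b : ℕ) + c) * K + r = (r + K * b) + c * K := by ring
        rw [this]; simp
      rw [e, if_pos (Dvd.intro_left _ rfl), Nat.mul_div_cancel _ hK]
    · rw [if_neg hrs, if_neg]
      intro hd
      apply hrs
      have hb : (s : ℕ) + K * b ≤ m * K + (r + K * a) := by
        have := s.2
        have : K * ((b : ℕ) + 1) ≤ K * m := Nat.mul_le_mul_left K b.2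
        rw [mul_comm m K]
        rw [Nat.mul_add] at this; omega
      have := (Nat.modEq_iff_dvd' hb).mpr hd
      have h2 : (s : ℕ) % K = r % K := by
        have h3 : ((s : ℕ) + K * b) % K = (m * K + (r + K * a)) % K := this
        simpa [Nat.add_mod] using h3
      rw [Nat.mod_eq_of_lt s.2, Nat.mod_eq_of_lt r.2] at h2
      exact Fin.ext h2.symm
  rw [← Matrix.det_submatrix_equiv_self finProdFinEquiv, h1, Matrix.det_blockDiagonal]
  simp

lemma prod_range_block {M : Type*} [CommMonoid M] (f : ℕ → M) (m K : ℕ) :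
    ∏ i ∈ Finset.range (m * K), f i = ∏ a ∈ Finset.range m, ∏ r ∈ Finset.range K, f (a * K + r) := by
  induction m with
  | zero => simp
  | succ m ih => rw [add_mul, one_mul, Finset.prod_range_add, ih, Finset.prod_range_succ]

lemma psi_prod (m K : ℕ) (hK : 0 < K) :
    ∏ i ∈ Finset.range (m * K), ∏ j ∈ Finset.range (m * K), psiV K (i + j + 1) =
      (∏ a ∈ Finset.range m, ∏ b ∈ Finset.range m, (((a + b + 1 : ℕ) : ℂ))) ^ K := by
  have h1 : ∀ a r, r < K → ∏ j ∈ Finset.range (m * K), psiV K (a * K + r + j + 1) = ∏ b ∈ Finset.range m, (((a + b + 1 : ℕ) : ℂ)) := by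
    intro a r hr
    rw [prod_range_block]
    refine Finset.prod_congr rfl fun b _ => ?_
    rw [Finset.prod_eq_single (K - 1 - r)]
    · have : a * K + r + (b * K + (K - 1 - r)) + 1 = (a + b + 1) * K := by
        have : r + (K - 1 - r) + 1 = K := by omega
        calc _ = a * K + b * K + (r + (K - 1 - r) + 1) := by ring
          _ = _ := by rw [this]; ring
      rw [this, psiV, if_pos (Dvd.intro_left _ rfl), Nat.mul_div_cancel _ hK]
    · intro s hs hne
      rw [Finset.mem_range] at hs
      rw [psiV, if_neg]
      have : a * K + r + (b * K + s) + 1 = (a + b) * K + (r + s + 1) := by ring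
      rw [this, Nat.dvd_add_right (Dvd.intro_left _ rfl)]
      rintro ⟨c, hc⟩
      have : c = 1 := by
        rcases c with _ | _ | c
        · omega
        · rfl
        · nlinarith
      subst this; omega
    · intro h; rw [Finset.mem_range] at h; omega
  rw [prod_range_block, ← Finset.prod_pow]
  refine Finset.prod_congr rfl fun a _ => ?_
  rw [Finset.prod_congr rfl fun r hr => h1 a r (Finset.mem_range.mp hr)]
  simp

lemma fact_prod (m : ℕ) : (∏ a ∈ Finset.range m, ∏ b ∈ Finset.range m, (((a + b + 1 : ℕ) : ℚ))) * ∏ a ∈ Finset.range m, (a.factorial : ℚ) =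
    ∏ a ∈ Finset.range m, ((m + a).factorial : ℚ) := by
  rw [← Finset.prod_mul_distrib]
  refine Finset.prod_congr rfl fun a _ => ?_
  have h : ∀ r : ℕ, (∏ b ∈ Finset.range r, (((a + b + 1 : ℕ) : ℚ))) * (a.factorial : ℚ) = ((r + a).factorial : ℚ) := by
    intro r
    induction r with
    | zero => simp
    | succ r ih =>
      rw [Finset.prod_range_succ, mul_right_comm, ih, show r + 1 + a = (r + a) + 1 by ring, Nat.factorial_succ]
      push_cast; ring
  exact h m

open Polynomial in
theorem chi_eval (k d K : ℕ) (hK : Nat.gcd d ((k + 1) ^ 2) * K = (k + 1) ^ 2) (η : ℂ) (hη : IsPrimitiveRoot η K) :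
    (chiG k (cp (k + 1) d) : ℂ) = aeval η (qHookSquare (k + 1)) := by
  have hK0 : 0 < K := by
    rcases Nat.eq_zero_or_pos K with rfl | h
    · exfalso
      rw [mul_zero] at hK
      have : 0 < (k + 1) ^ 2 := by positivity
      omega
    · exact h
  have h1 := chi_det k d K hK
  by_cases hd : K ∣ k + 1
  · have h2 := qHook_val (k + 1) K (by omega) hd η hη
    obtain ⟨m, hm⟩ := hd
    rw [mul_comm] at hm
    have e : (k + 1) ^ 2 / K = Nat.gcd d ((k + 1) ^ 2) := by
      conv_lhs => rw [← hK]
      exact Nat.mul_div_cancel _ hK0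
    rw [e] at h2
    generalize Nat.gcd d ((k + 1) ^ 2) = g at *
    generalize chiG k (cp (k + 1) d) = χ at *
    rw [hm] at h1 h2 ⊢
    rw [psi_prod m K hK0] at h2
    rw [AM_block m K hK0] at h1
    have h3 := AM_one m
    have h4 := fact_prod m
    have hf : ∏ a ∈ Finset.range m, (a.factorial : ℚ) ≠ 0 := Finset.prod_ne_zero_iff.mpr fun a _ => by
      exact_mod_cast Nat.factorial_ne_zero _
    have h5 : (AM m 1).det * (∏ a ∈ Finset.range m, ∏ b ∈ Finset.range m, (((a + b + 1 : ℕ) : ℚ))) = 1 := by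
      apply mul_right_cancel₀ hf
      rw [mul_assoc, h4, h3, one_mul]
    have h6 : (χ : ℚ) * (∏ a ∈ Finset.range m, ∏ b ∈ Finset.range m, (((a + b + 1 : ℕ) : ℚ))) ^ K = g.factorial := by
      rw [h1, mul_assoc, ← mul_pow, h5, one_pow, mul_one]
    have h7 : (χ : ℂ) * (∏ a ∈ Finset.range m, ∏ b ∈ Finset.range m, (((a + b + 1 : ℕ) : ℂ))) ^ K = g.factorial := by
      have := congrArg (fun x : ℚ => (x : ℂ)) h6
      push_cast at this ⊢
      exact this
    have h8 : (∏ a ∈ Finset.range m, ∏ b ∈ Finset.range m, (((a + b + 1 : ℕ) : ℂ))) ^ K ≠ 0 := by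
      apply pow_ne_zero
      rw [Finset.prod_ne_zero_iff]; intro a _
      rw [Finset.prod_ne_zero_iff]; intro b _
      exact Nat.cast_ne_zero.mpr (Nat.succ_ne_zero _)
    apply mul_right_cancel₀ h8
    rw [h7, ← h2, mul_comm]
  · rw [AM_zero _ K hK0 hd, mul_zero] at h1
    rw [qHook_zero (k + 1) K ⟨_, by rw [← hK, mul_comm]⟩ hd η hη]
    exact_mod_cast h1

end BnCSP

namespace BnCSP

variable {n : ℕ}

lemma asc_neg {p : Fin n → ℤ} (hp : Gen p) (i : Fin n) : asc i (-p) ↔ ¬ asc i p := by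
  by_cases h : (i : ℕ) + 1 < n
  · have h2 : p i ≠ p ⟨i + 1, h⟩ := by
      intro h3; have h4 := hp.inj i ⟨i + 1, h⟩ (by rw [h3]); simp [Fin.ext_iff] at h4
    rw [asc_swap i h, asc_swap i h]
    simp only [Pi.neg_apply]; omega
  · have h2 : p i ≠ 0 := by
      intro h; have := hp.pos i; rw [h] at this; simp at this
    rw [asc_touch i h, asc_touch i h]
    simp only [Pi.neg_apply]; omega

lemma run_neg (u : List (Fin n)) (p : Fin n → ℤ) : run u (-p) = - run u p := by
  induction u generalizing p with
  | nil => rfl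
  | cons i u ih => rw [run_cons, act_neg, ih, run_cons]

lemma run_reverse (u : List (Fin n)) (p : Fin n → ℤ) : run u (run u.reverse p) = p := by
  induction u generalizing p with
  | nil => rfl
  | cons i u ih => rw [List.reverse_cons, run_append, run_cons, run_cons, run_nil, act_act, ih]

lemma path_braid2 (i j : ℕ) (hij : i + 2 ≤ j) (hj : j < n) (p : Fin n → ℤ)
    (h1 : asc ⟨i, by omega⟩ p) (h2 : asc ⟨j, hj⟩ p) :
    path [⟨i, by omega⟩, ⟨j, hj⟩] p ∧ path [⟨j, hj⟩, ⟨i, by omega⟩] p := by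
  have := act_comm i j hij hj p
  simp only [path]
  exact ⟨⟨h1, this.2.1.mpr h2, trivial⟩, ⟨h2, this.2.2.mpr h1, trivial⟩⟩

lemma path_braid3 (i : ℕ) (hi : i + 2 < n) (p : Fin n → ℤ)
    (h1 : asc ⟨i, by omega⟩ p) (h2 : asc ⟨i + 1, by omega⟩ p) :
    path [⟨i, by omega⟩, ⟨i + 1, by omega⟩, ⟨i, by omega⟩] p ∧
      path [⟨i + 1, by omega⟩, ⟨i, by omega⟩, ⟨i + 1, by omega⟩] p := by
  have key : path [⟨i, by omega⟩, ⟨i + 1, by omega⟩, ⟨i, by omega⟩] p := by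
    simp only [path, asc_val i (show i + 1 < n by omega), asc_val (i + 1) hi, act_val i (show i + 1 < n by omega), act_val (i + 1) hi] at h1 h2 ⊢
    simp
    omega
  exact ⟨key, (act_braid3 i hi p).2.mp key⟩

lemma path_braid4 (i : ℕ) (hi : i + 2 = n) (p : Fin n → ℤ)
    (h1 : asc ⟨i, by omega⟩ p) (h2 : asc ⟨i + 1, by omega⟩ p) :
    path [⟨i, by omega⟩, ⟨i + 1, by omega⟩, ⟨i, by omega⟩, ⟨i + 1, by omega⟩] p ∧
      path [⟨i + 1, by omega⟩, ⟨i, by omega⟩, ⟨i + 1, by omega⟩, ⟨i, by omega⟩] p := by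
  have key : path [⟨i, by omega⟩, ⟨i + 1, by omega⟩, ⟨i, by omega⟩, ⟨i + 1, by omega⟩] p := by
    simp only [path, asc_val i (show i + 1 < n by omega), asc_val_last (i + 1) (show i + 1 + 1 = n from hi), act_val i (show i + 1 < n by omega), act_val_last (i + 1) (show i + 1 + 1 = n from hi)] at h1 h2 ⊢
    simp
    omega
  exact ⟨key, (act_braid4 i hi p).2.mp key⟩

lemma M_two (i j : ℕ) (hij : i + 2 ≤ j) (hj : j < n) :
    (CoxeterMatrix.B n).M ⟨i, by omega⟩ ⟨j, hj⟩ = 2 := by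
  simp only [CoxeterMatrix.B, Matrix.of_apply, Fin.mk.injEq]
  rw [if_neg (by omega), if_neg (by omega), if_neg (by omega)]

lemma M_three (i : ℕ) (hi : i + 2 < n) :
    (CoxeterMatrix.B n).M ⟨i, by omega⟩ ⟨i + 1, by omega⟩ = 3 := by
  simp only [CoxeterMatrix.B, Matrix.of_apply, Fin.mk.injEq]
  rw [if_neg (by omega), if_neg (by omega), if_pos (by simp)]

lemma M_four (i : ℕ) (hi : i + 2 = n) :
    (CoxeterMatrix.B n).M ⟨i, by omega⟩ ⟨i + 1, by omega⟩ = 4 := by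
  simp only [CoxeterMatrix.B, Matrix.of_apply, Fin.mk.injEq]
  rw [if_neg (by omega), if_pos (by omega)]

/-- letters as permutations of states -/
def actP (i : Fin n) : Equiv.Perm (Fin n → ℤ) := ⟨act i, act i, act_act i, act_act i⟩

lemma actP_liftable : (CoxeterMatrix.B n).IsLiftable (actP (n := n)) := by
  have sq : ∀ i : Fin n, actP i * actP i = 1 := fun i => Equiv.ext fun p => act_act i p
  have inv1 : ∀ i : Fin n, (actP i)⁻¹ = actP i := fun i => inv_eq_of_mul_eq_one_left (sq i)
  have key : ∀ i j : Fin n, i < j → (actP i * actP j) ^ (CoxeterMatrix.B n).M i j = 1 := by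
    rintro ⟨i, hi⟩ ⟨j, hj⟩ hij
    rw [Fin.mk_lt_mk] at hij
    by_cases h2 : i + 2 ≤ j
    · rw [M_two i j h2 hj]
      refine Equiv.ext fun p => ?_
      change act _ (act _ (act _ (act _ p))) = p
      rw [(act_comm i j h2 hj p).1, act_act, act_act]
    · obtain rfl : j = i + 1 := by omega
      rcases Nat.lt_or_ge (i + 2) n with h | h
      · rw [M_three i h]
        refine Equiv.ext fun p => ?_
        change act _ (act _ (act _ (act _ (act _ (act _ p))))) = p
        have := (act_braid3 i h p).1
        simp only [run_cons, run_nil] at this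
        rw [← this, act_act, act_act, act_act]
      · rw [M_four i (by omega)]
        refine Equiv.ext fun p => ?_
        change act _ (act _ (act _ (act _ (act _ (act _ (act _ (act _ p))))))) = p
        have := (act_braid4 i (by omega) p).1
        simp only [run_cons, run_nil] at this
        rw [← this, act_act, act_act, act_act, act_act]
  intro i j
  rcases lt_trichotomy i j with h | h | h
  · exact key i j h
  · subst h
    rw [sq, one_pow]
  · have h1 := key j i h
    rw [(CoxeterMatrix.B n).symmetric] at h1
    have : actP i * actP j = (actP j * actP i)⁻¹ := by rw [mul_inv_rev, inv1, inv1]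
    rw [this, inv_pow, h1, inv_one]

section
variable {W : Type*} [Group W] (cs : CoxeterSystem (CoxeterMatrix.B n) W)

lemma run_eq_of_wordProd (u v : List (Fin n)) (h : cs.wordProd u = cs.wordProd v) (p : Fin n → ℤ) :
    run u p = run v p := by
  have key : ∀ (u : List (Fin n)) (p : Fin n → ℤ), cs.lift ⟨actP, actP_liftable⟩ (cs.wordProd u) p = run u.reverse p := by
    intro u
    induction u with
    | nil => intro p; simp [run_nil]
    | cons i u ih =>
      intro p
      rw [cs.wordProd_cons, map_mul, Equiv.Perm.mul_apply, ih, cs.lift_apply_simple, List.reverse_cons,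
        run_append]
      rfl
  have h1 := key u.reverse p
  have h2 := key v.reverse p
  rw [List.reverse_reverse] at h1 h2
  rw [← h1, ← h2, cs.wordProd_reverse, cs.wordProd_reverse, h]

lemma braid_lt (i j : Fin n) (hij : i < j) : ∃ b c : List (Fin n),
    (b ++ [i]).length = (c ++ [j]).length ∧ cs.wordProd (b ++ [i]) = cs.wordProd (c ++ [j]) ∧
    ∀ p, run (b ++ [i]) p = run (c ++ [j]) p ∧ (asc i p → asc j p → path (b ++ [i]).reverse p) := by
  have hb := cs.wordProd_braidWord_eq i j
  rw [CoxeterSystem.braidWord, CoxeterSystem.braidWord, (CoxeterMatrix.B n).symmetric j i] at hb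
  obtain ⟨i, hi⟩ := i
  obtain ⟨j, hj⟩ := j
  rw [Fin.mk_lt_mk] at hij
  by_cases h2 : i + 2 ≤ j
  · rw [show (CoxeterMatrix.B n) ⟨i, hi⟩ ⟨j, hj⟩ = 2 from M_two i j h2 hj] at hb
    refine ⟨[⟨j, hj⟩], [⟨i, hi⟩], rfl, hb.symm, fun p => ⟨(act_comm i j h2 hj p).1, fun h3 h4 => ?_⟩⟩
    exact (path_braid2 i j h2 hj p h3 h4).1
  · obtain rfl : j = i + 1 := by omega
    rcases Nat.lt_or_ge (i + 2) n with h | h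
    · rw [show (CoxeterMatrix.B n) ⟨i, hi⟩ ⟨i + 1, hj⟩ = 3 from M_three i h] at hb
      refine ⟨[⟨i, hi⟩, ⟨i + 1, hj⟩], [⟨i + 1, hj⟩, ⟨i, hi⟩], rfl, hb.symm, fun p => ⟨(act_braid3 i h p).1, fun h3 h4 => ?_⟩⟩
      exact (path_braid3 i h p h3 h4).1
    · rw [show (CoxeterMatrix.B n) ⟨i, hi⟩ ⟨i + 1, hj⟩ = 4 from M_four i (by omega)] at hb
      refine ⟨[⟨i + 1, hj⟩, ⟨i, hi⟩, ⟨i + 1, hj⟩], [⟨i, hi⟩, ⟨i + 1, hj⟩, ⟨i, hi⟩], rfl, hb.symm,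
        fun p => ⟨(act_braid4 i (by omega) p).1.symm, fun h3 h4 => ?_⟩⟩
      exact (path_braid4 i (by omega) p h3 h4).1

lemma exists_path {p : Fin n → ℤ} (hp : Gen p) : ∃ z : List (Fin n), path z (start n) ∧ run z (start n) = p := by
  obtain ⟨N, hN⟩ : ∃ N : ℕ, inv p = N := ⟨(inv p).toNat, by have := inv_nonneg p; omega⟩
  induction N generalizing p with
  | zero => exact ⟨[], trivial, (inv_eq_zero hp hN).symm⟩
  | succ N ih =>
    have : p ≠ start n := by
      rintro rfl; rw [inv_start] at hN; push_cast at hN; omega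
    obtain ⟨i, hi⟩ := exists_desc hp this
    obtain ⟨z, hz1, hz2⟩ := ih (hp.act i) (by rw [inv_desc hp i hi, hN]; push_cast; ring)
    refine ⟨z ++ [i], ?_, ?_⟩
    · rw [path_append, hz2]
      exact ⟨hz1, (not_asc hp i).mp hi, trivial⟩
    · rw [run_append, hz2, run_cons, run_nil, act_act]

lemma path_length {u : List (Fin n)} (h : path u (start n)) : inv (run u (start n)) = u.length := by
  rw [(path_iff gen_start u).mp h, inv_start, zero_add]

lemma uniq_path (N : ℕ) : ∀ u v : List (Fin n), u.length = N → path u (start n) → path v (start n) →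
    run u (start n) = run v (start n) → cs.wordProd u = cs.wordProd v := by
  induction N with
  | zero =>
    intro u v hu pu pv h
    have h1 := path_length pu
    have h2 := path_length pv
    have : v.length = 0 := by rw [h] at h1; omega
    rw [List.length_eq_zero_iff] at hu this
    rw [hu, this]
  | succ N ih =>
    intro u v hu pu pv h
    have h1 := path_length pu
    have h2 := path_length pv
    have hv : v.length = N + 1 := by rw [h] at h1; omega
    clear h1 h2
    -- words with the same last letter
    have same : ∀ (x y : List (Fin n)) (i : Fin n), (x ++ [i]).length = N + 1 → path (x ++ [i]) (start n) → path (y ++ [i]) (start n) →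
        run (x ++ [i]) (start n) = run (y ++ [i]) (start n) → cs.wordProd (x ++ [i]) = cs.wordProd (y ++ [i]) := by
      intro x y i hx px py hr
      rw [path_append] at px py
      rw [run_append, run_append] at hr
      have hr' := congrArg (act i) hr
      simp only [run_cons, run_nil, act_act] at hr'
      rw [cs.wordProd_append, cs.wordProd_append, ih x y (by simpa using hx) px.1 py.1 hr']
    -- words with different last letters
    have diff : ∀ (x y : List (Fin n)) (i j : Fin n), i < j → (x ++ [i]).length = N + 1 → (y ++ [j]).length = N + 1 →
        path (x ++ [i]) (start n) → path (y ++ [j]) (start n) →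
        run (x ++ [i]) (start n) = run (y ++ [j]) (start n) → cs.wordProd (x ++ [i]) = cs.wordProd (y ++ [j]) := by
      intro x y i j hij hx hy px py hr
      obtain ⟨b, c, hbc, hw, hall⟩ := braid_lt cs i j hij
      set p := run (x ++ [i]) (start n) with hp
      have gp : Gen p := gen_start.run _
      have di : ∀ (x : List (Fin n)) (i : Fin n), path (x ++ [i]) (start n) → ¬ asc i (run (x ++ [i]) (start n)) := by
        intro x i px
        rw [path_append] at px
        rw [run_append, run_cons, run_nil, not_asc ((gen_start.run _).act _), act_act]
        exact px.2.1
      have d1 : asc i (-p) := (asc_neg gp i).mpr (di x i px)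
      have d2 : asc j (-p) := (asc_neg gp j).mpr (by rw [hr]; exact di y j py)
      have h3 := (path_iff gp.neg _).mp ((hall (-p)).2 d1 d2)
      rw [run_neg, inv_neg (gp.run _), inv_neg gp, List.length_reverse] at h3
      obtain ⟨z, pz, hz⟩ := exists_path (gp.run (b ++ [i]).reverse)
      have r1 : run (b ++ [i]) (run z (start n)) = p := by rw [hz, run_reverse]
      have r2 : run (c ++ [j]) (run z (start n)) = p := by rw [← (hall _).1, r1]
      have p1 : path (z ++ (b ++ [i])) (start n) := by
        rw [path_append, path_iff (gen_start.run _), r1, hz]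
        exact ⟨pz, by omega⟩
      have p2 : path (z ++ (c ++ [j])) (start n) := by
        rw [path_append, path_iff (gen_start.run _), r2, hz, ← hbc]
        exact ⟨pz, by omega⟩
      have e1 := same x (z ++ b) i hx px (by rwa [List.append_assoc]) (by rw [List.append_assoc, run_append z, r1])
      have e2 := same y (z ++ c) j hy py (by rwa [List.append_assoc]) (by rw [List.append_assoc, run_append z, r2, ← hr])
      rw [e1, e2, List.append_assoc, List.append_assoc, cs.wordProd_append z, hw, cs.wordProd_append z]
    rcases List.eq_nil_or_concat' u with rfl | ⟨x, i, rfl⟩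
    · simp at hu
    rcases List.eq_nil_or_concat' v with rfl | ⟨y, j, rfl⟩
    · simp at hv
    rcases lt_trichotomy i j with hij | hij | hij
    · exact diff x y i j hij hu hv pu pv h
    · subst hij; exact same x y i hu pu pv h
    · exact (diff y x j i hij hv hu pv pu h.symm).symm

lemma word_path (ω : List (Fin n)) : ∀ v, path v (start n) → run ω (start n) = run v (start n) →
    cs.wordProd ω = cs.wordProd v := by
  induction ω using List.reverseRecOn with
  | nil =>
    intro v pv h
    exact uniq_path cs _ [] v rfl trivial pv h
  | append_singleton ω i ih =>
    intro v pv h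
    rw [run_append, run_cons, run_nil] at h
    have gp : Gen (run ω (start n)) := gen_start.run _
    by_cases ha : asc i (run ω (start n))
    · obtain ⟨u, pu, hu⟩ := exists_path gp
      rw [cs.wordProd_append, ih u pu hu.symm, ← cs.wordProd_append]
      refine uniq_path cs _ _ v rfl ?_ pv ?_
      · rw [path_append, hu]; exact ⟨pu, ha, trivial⟩
      · rw [run_append, hu, ← h]; rfl
    · obtain ⟨u, pu, hu⟩ := exists_path (gp.act i)
      have e := ih (u ++ [i]) (by rw [path_append, hu]; exact ⟨pu, (not_asc gp i).mp ha, trivial⟩)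
        (by rw [run_append, hu, run_cons, run_nil, act_act])
      rw [cs.wordProd_append, e, cs.wordProd_append, cs.wordProd_singleton, mul_assoc, cs.simple_mul_simple_self, mul_one]
      exact uniq_path cs _ u v rfl pu pv (by rw [hu, h])

lemma word_eq (u v : List (Fin n)) (h : run u (start n) = run v (start n)) : cs.wordProd u = cs.wordProd v := by
  obtain ⟨z, pz, hz⟩ := exists_path (gen_start.run v)
  rw [word_path cs u z pz (by rw [hz, h]), word_path cs v z pz hz.symm]

lemma length_inv' (ω : List (Fin n)) : (cs.length (cs.wordProd ω) : ℤ) = inv (run ω (start n)) := by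
  apply le_antisymm
  · obtain ⟨z, pz, hz⟩ := exists_path (gen_start.run ω)
    rw [word_path cs ω z pz hz.symm, ← hz, path_length pz]
    exact_mod_cast cs.length_wordProd_le z
  · obtain ⟨u, hu, hw⟩ := cs.exists_isReduced (cs.wordProd ω)
    rw [run_eq_of_wordProd cs ω u hw]
    have := inv_run_le (gen_start (n := n)) u
    rw [inv_start] at this
    rw [hw, hu]
    omega

lemma reduced_iff (w0 : W) (hw0 : ∀ u : W, cs.length u ≤ cs.length w0) (ω : List (Fin n)) :
    (cs.IsReduced ω ∧ cs.wordProd ω = w0) ↔ ω ∈ RW n := by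
  obtain ⟨ω0, rfl⟩ := cs.wordProd_surjective w0
  have h0 : run ω0 (start n) = - start n := by
    rw [← inv_top (gen_start.run _)]
    apply le_antisymm (inv_le (gen_start.run _))
    obtain ⟨z, pz, hz⟩ := exists_path (gen_start (n := n)).neg
    have h1 := length_inv' cs z
    rw [hz, (inv_top gen_start.neg).mpr rfl] at h1
    rw [← length_inv' cs, ← h1]
    exact_mod_cast hw0 _
  have h1 : (cs.length (cs.wordProd ω0) : ℤ) = n ^ 2 := by
    rw [length_inv' cs, h0, (inv_top gen_start.neg).mpr rfl]
  rw [mem_RW]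
  constructor
  · rintro ⟨hr, hw⟩
    refine ⟨?_, ?_⟩
    · rw [CoxeterSystem.IsReduced, hw] at hr
      rw [← hr]; exact_mod_cast h1
    · rw [run_eq_of_wordProd cs ω ω0 hw, h0]
  · rintro ⟨hl, hr⟩
    have hw := word_eq cs ω ω0 (by rw [hr, h0])
    refine ⟨?_, hw⟩
    rw [CoxeterSystem.IsReduced, hw, hl]; exact_mod_cast h1

end

end BnCSP

/-- (Rhoades, Theorem 8.1.)  Let `X = R(w₀)` be the set of reduced words for the longest
element `w₀` of the Coxeter group of type `Bₙ`, and let `C = ℤ/n²ℤ` act on `X` by cyclic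
rotation of words.  Then `(X, C, X(q))` exhibits the cyclic sieving phenomenon, where
`X(q) = [n²]_q! / ([n]_q^n ∏_(i=1)^(n-1) ([i]_q [2n-i]_q)^i)`: for every `d ≥ 0`, the
number of reduced words fixed by `c^d` equals `X(ζ^d)`, `ζ` being a primitive `n²`-th
root of unity. -/
theorem reduced_words_longest_element_Bn_cyclic_sieving_hook_form
    {W : Type*} [Group W] (n : ℕ)
    (cs : CoxeterSystem (CoxeterMatrix.Bₙ n) W) (w0 : W)
    (hw0 : ∀ u : W, cs.length u ≤ cs.length w0)
    (ζ : ℂ) (hζ : IsPrimitiveRoot ζ (n ^ 2)) (d : ℕ) :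
    (({ω : List (Fin n) | (cs.IsReduced ω ∧ cs.wordProd ω = w0) ∧
        ω.rotate d = ω}).ncard : ℂ) =
      Polynomial.aeval (ζ ^ d) (qHookSquare n) := by
  have hset : {ω : List (Fin n) | (cs.IsReduced ω ∧ cs.wordProd ω = w0) ∧ ω.rotate d = ω} =
      {ω : List (Fin n) | ω ∈ BnCSP.RW n ∧ ω.rotate d = ω} := by
    ext ω
    exact and_congr_left fun _ => BnCSP.reduced_iff cs w0 hw0 ω
  rw [hset]
  rcases n with _ | k
  · have h1 : {ω : List (Fin 0) | ω ∈ BnCSP.RW 0 ∧ ω.rotate d = ω} = {[]} := by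
      ext ω
      simp only [Set.mem_setOf_eq, Set.mem_singleton_iff]
      constructor
      · rintro ⟨h, _⟩
        exact List.length_eq_zero_iff.mp h.1
      · rintro rfl
        exact ⟨⟨rfl, trivial⟩, by simp⟩
    have h2 : qHookSquare 0 = 1 := by
      simp [qHookSquare, qFact]
    rw [h1, h2]
    simp
  · have hcard : {ω : List (Fin (k + 1)) | ω ∈ BnCSP.RW (k + 1) ∧ ω.rotate d = ω}.ncard =
        ((BnCSP.RF (k + 1)).filter fun u => BnCSP.rot^[d] u = u).card := by
      have hit : ∀ (x : ℕ) (u : Fin ((k + 1) ^ 2) → Fin (k + 1)),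
          List.ofFn (BnCSP.rot^[x] u) = (List.ofFn u).rotate x := by
        intro x u
        induction x with
        | zero => simp
        | succ x ih => rw [Function.iterate_succ_apply', BnCSP.ofFn_rot, ih, List.rotate_rotate]
      rw [← Set.ncard_coe_finset]
      symm
      apply Set.ncard_congr (fun u _ => List.ofFn u)
      · intro u hu
        simp only [Finset.coe_filter, Set.mem_setOf_eq, BnCSP.RF, Finset.mem_filter, Finset.mem_univ, true_and] at hu
        exact ⟨hu.1, by rw [← hit, hu.2]⟩
      · intro u v _ _ h
        exact List.ofFn_injective h
      · rintro ω ⟨h1, h2⟩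
        have hl : ω.length = (k + 1) ^ 2 := h1.1
        obtain ⟨u, rfl⟩ : ∃ u : Fin ((k + 1) ^ 2) → Fin (k + 1), List.ofFn u = ω :=
          ⟨fun t => ω.get (t.cast hl.symm), by
            apply List.ext_getElem
            · simp [hl]
            · intro i h1 h2; simp⟩
        refine ⟨u, ?_, rfl⟩
        simp only [Finset.coe_filter, Set.mem_setOf_eq, BnCSP.RF, Finset.mem_filter, Finset.mem_univ, true_and]
        exact ⟨h1, List.ofFn_injective (by rw [hit, h2])⟩
    have hpos : 0 < (k + 1) ^ 2 := by positivity
    have hK : Nat.gcd d ((k + 1) ^ 2) * orderOf (ζ ^ d) = (k + 1) ^ 2 := by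
      have hfo : IsOfFinOrder ζ := by
        rw [← orderOf_pos_iff, ← hζ.eq_orderOf]; exact hpos
      rw [hfo.orderOf_pow, ← hζ.eq_orderOf, Nat.gcd_comm]
      exact Nat.mul_div_cancel' (Nat.gcd_dvd_left _ _)
    rw [← BnCSP.chi_eval k d _ hK (ζ ^ d) (IsPrimitiveRoot.orderOf _), ← BnCSP.fix_count, hcard]
    push_cast
    rfl
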